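/- Set c_1 = 11.5^{−39} and c_2 = 1.15. For every pair of number fields K ⊆ L (L a finite extension of K), the regulators satisfy R_L / R_K ≥ (c_1 · c_2^{[L:K]})^{[K:ℚ]}. -/

import Mathlib

open MeasureTheory Real
open scoped ENNReal

namespace RegR

/-- convolution -/
noncomputable def conv (f g : ℝ → ℝ≥0∞) (u : ℝ) : ℝ≥0∞ := ∫⁻ x, f x * g (u - x)

/-- the place function -/
noncomputable def fe (e : ℕ) (U : ℝ) : ℝ≥0∞ := ENNReal.ofReal (rexp (-(e * rexp (2 * U / e))))

/-- log-concavity -/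
def LC (T : ℝ → ℝ≥0∞) : Prop := ∀ a s t : ℝ, 0 ≤ s → 0 ≤ t → T a * T (a + s + t) ≤ T (a + s) * T (a + t)

/-- iterated convolution -/
noncomputable def Tl (l : List ℕ) (g : ℝ → ℝ≥0∞) : ℝ → ℝ≥0∞ :=
  l.foldr (fun e T => conv (fe e) T) g

/-- window -/
noncomputable def win (A η : ℝ) : ℝ → ℝ≥0∞ := (Set.Icc (-(A + η)) (-A)).indicator 1

theorem measurable_conv {f g : ℝ → ℝ≥0∞} (hf : Measurable f) (hg : Measurable g) :
    Measurable (conv f g) := by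
  unfold conv
  apply Measurable.lintegral_prod_right' (f := fun p : ℝ × ℝ => f p.2 * g (p.1 - p.2))
  fun_prop

theorem measurable_fe (e : ℕ) : Measurable (fe e) := by
  unfold fe; fun_prop

theorem measurable_win (A η : ℝ) : Measurable (win A η) :=
  measurable_one.indicator measurableSet_Icc

theorem measurable_Tl (l : List ℕ) {g : ℝ → ℝ≥0∞} (hg : Measurable g) : Measurable (Tl l g) := by
  induction l with
  | nil => exact hg
  | cons e l ih => exact measurable_conv (measurable_fe e) ih

theorem rearr (p q r t : ℝ≥0∞) (h1 : p ≤ q) (h2 : r ≤ t) : p * t + q * r ≤ p * r + q * t := by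
  obtain ⟨p', rfl⟩ := exists_add_of_le h1
  obtain ⟨r', rfl⟩ := exists_add_of_le h2
  have : p * r + (p + p') * (r + r') = p * (r + r') + (p + p') * r + p' * r' := by ring
  rw [this]; exact le_self_add

theorem LC_conv {f g : ℝ → ℝ≥0∞} (hfm : Measurable f) (hgm : Measurable g) (hf : LC f) (hg : LC g) :
    LC (conv f g) := by
  intro a s t hs ht
  have prodint : ∀ p q : ℝ → ℝ≥0∞, Measurable p → Measurable q →
      (∫⁻ x, p x) * (∫⁻ y, q y) = ∫⁻ z : ℝ × ℝ, p z.1 * q z.2 := by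
    intro p q hp hq
    rw [Measure.volume_eq_prod, lintegral_prod_mul hp.aemeasurable hq.aemeasurable]
  have shift : ∀ c, conv f g (c + t) = ∫⁻ y, f (y + t) * g (c - y) := by
    intro c
    unfold conv
    rw [← lintegral_add_right_eq_self (fun x => f x * g (c + t - x)) t]
    congr 1; ext y; congr 2; ring
  let F : ℝ × ℝ → ℝ≥0∞ := fun z => f z.1 * f (z.2 + t) * (g (a - z.1) * g (a + s - z.2))
  let G : ℝ × ℝ → ℝ≥0∞ := fun z => f z.1 * f (z.2 + t) * (g (a - z.2) * g (a + s - z.1))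
  have hF : conv f g a * conv f g (a + s + t) = ∫⁻ z, F z := by
    rw [shift (a + s)]
    unfold conv
    rw [prodint _ _ (by fun_prop) (by fun_prop)]
    congr 1; ext z; simp only [F]; ring
  have hG : conv f g (a + s) * conv f g (a + t) = ∫⁻ z, G z := by
    rw [shift a]
    unfold conv
    rw [prodint _ _ (by fun_prop) (by fun_prop)]
    congr 1; ext z; simp only [G]; ring
  have hFm : Measurable F := by fun_prop
  have hGm : Measurable G := by fun_prop
  have swap : ∀ H : ℝ × ℝ → ℝ≥0∞, Measurable H → ∫⁻ z, H z = ∫⁻ z : ℝ × ℝ, H z.swap := by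
    intro H hH
    rw [Measure.volume_eq_prod]
    exact (lintegral_prod_swap H).symm
  rw [hF, hG]
  have h2 : 2 * ∫⁻ z, F z ≤ 2 * ∫⁻ z, G z := by
    rw [two_mul, two_mul]
    nth_rw 2 [swap F hFm]
    nth_rw 2 [swap G hGm]
    rw [← lintegral_add_left hFm, ← lintegral_add_left hGm]
    apply lintegral_mono
    rintro ⟨x, y⟩
    simp only [F, G, Prod.fst_swap, Prod.snd_swap]
    rcases le_total x y with h | h
    · have hA := hf x (y - x) t (by linarith) ht
      have hB := hg (a - y) (y - x) s (by linarith) hs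
      rw [show x + (y - x) + t = y + t by ring, show x + (y - x) = y by ring] at hA
      rw [show a - y + (y - x) + s = a + s - x by ring, show a - y + (y - x) = a - x by ring,
        show a - y + s = a + s - y by ring] at hB
      exact rearr _ _ _ _ hA hB
    · have hA := hf y (x - y) t (by linarith) ht
      have hB := hg (a - x) (x - y) s (by linarith) hs
      rw [show y + (x - y) + t = x + t by ring, show y + (x - y) = x by ring] at hA
      rw [show a - x + (x - y) + s = a + s - y by ring, show a - x + (x - y) = a - y by ring,
        show a - x + s = a + s - x by ring] at hB
      have := rearr _ _ _ _ hA hB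
      rw [add_comm, add_comm (f x * f (y + t) * (g (a - y) * _))]
      exact this
  rwa [ENNReal.mul_le_mul_iff_right (by norm_num) (by norm_num)] at h2

theorem LC_fe (e : ℕ) : LC (fe e) := by
  intro a s t hs ht
  unfold fe
  rw [← ENNReal.ofReal_mul (by positivity), ← ENNReal.ofReal_mul (by positivity), ← Real.exp_add,
    ← Real.exp_add]
  apply ENNReal.ofReal_le_ofReal
  apply Real.exp_le_exp.2
  have he : (0:ℝ) ≤ e := by positivity
  have h1 : 1 ≤ rexp (2 * s / e) := Real.one_le_exp (by positivity)
  have h2 : 1 ≤ rexp (2 * t / e) := Real.one_le_exp (by positivity)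
  have e1 : rexp (2 * (a + s) / e) = rexp (2 * a / e) * rexp (2 * s / e) := by
    rw [← Real.exp_add]; congr 1; ring
  have e2 : rexp (2 * (a + t) / e) = rexp (2 * a / e) * rexp (2 * t / e) := by
    rw [← Real.exp_add]; congr 1; ring
  have e3 : rexp (2 * (a + s + t) / e) = rexp (2 * a / e) * rexp (2 * s / e) * rexp (2 * t / e) := by
    rw [← Real.exp_add, ← Real.exp_add]; congr 1; ring
  rw [e1, e2, e3]
  have : 0 ≤ e * (rexp (2 * a / e) * ((rexp (2 * s / e) - 1) * (rexp (2 * t / e) - 1))) := by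
    have := mul_nonneg (sub_nonneg.2 h1) (sub_nonneg.2 h2)
    positivity
  nlinarith [this]

theorem win_mem {A η x : ℝ} (h : x ∈ Set.Icc (-(A + η)) (-A)) : win A η x = 1 := by
  unfold win; rw [Set.indicator_of_mem h]; rfl

theorem win_notMem {A η x : ℝ} (h : x ∉ Set.Icc (-(A + η)) (-A)) : win A η x = 0 := by
  unfold win; rw [Set.indicator_of_notMem h]

theorem LC_win (A η : ℝ) : LC (win A η) := by
  intro a s t hs ht
  by_cases h1 : a ∈ Set.Icc (-(A + η)) (-A)
  · by_cases h2 : a + s + t ∈ Set.Icc (-(A + η)) (-A)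
    · have h3 : a + s ∈ Set.Icc (-(A + η)) (-A) := ⟨by linarith [h1.1], by linarith [h2.2]⟩
      have h4 : a + t ∈ Set.Icc (-(A + η)) (-A) := ⟨by linarith [h1.1], by linarith [h2.2]⟩
      rw [win_mem h1, win_mem h2, win_mem h3, win_mem h4]
    · rw [win_notMem h2]; simp
  · rw [win_notMem h1]; simp

theorem LC_Tl (l : List ℕ) {g : ℝ → ℝ≥0∞} (hg : Measurable g) (hL : LC g) : LC (Tl l g) := by
  induction l with
  | nil => exact hL
  | cons e l ih => exact LC_conv (measurable_fe e) (measurable_Tl l hg) (LC_fe e) ih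

theorem fe_anti (e : ℕ) : Antitone (fe e) := by
  intro x y h
  unfold fe
  apply ENNReal.ofReal_le_ofReal
  apply Real.exp_le_exp.2
  gcongr

theorem fe_pos (e : ℕ) (x : ℝ) : 0 < fe e x := by
  unfold fe; positivity

theorem conv_anti {f g : ℝ → ℝ≥0∞} (hf : Antitone f) : Antitone (conv f g) := by
  have key : ∀ u, conv f g u = ∫⁻ x, f (u - x) * g x := by
    intro u
    unfold conv
    rw [← lintegral_sub_left_eq_self (fun x => f x * g (u - x)) u]
    congr 1; ext x; congr 2; ring
  intro u v h
  rw [key, key]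
  apply lintegral_mono
  intro x
  dsimp only
  gcongr
  exact hf (by linarith)

theorem Tl_anti {l : List ℕ} (hl : l ≠ []) (g : ℝ → ℝ≥0∞) : Antitone (Tl l g) := by
  cases l with
  | nil => exact absurd rfl hl
  | cons e l => exact conv_anti (fe_anti e)

theorem win_lintegral (A η : ℝ) (φ : ℝ → ℝ≥0∞) : ∫⁻ x, φ x * win A η x = ∫⁻ x in Set.Icc (-(A + η)) (-A), φ x := by
  rw [← lintegral_indicator measurableSet_Icc]
  congr 1; ext x
  by_cases h : x ∈ Set.Icc (-(A + η)) (-A)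
  · rw [win_mem h, Set.indicator_of_mem h, mul_one]
  · rw [win_notMem h, Set.indicator_of_notMem h, mul_zero]

/-- exponential moment -/
noncomputable def mom (T : ℝ → ℝ≥0∞) (z : ℝ) : ℝ≥0∞ := ∫⁻ u, ENNReal.ofReal (rexp (z * u)) * T u

theorem mom_conv {f g : ℝ → ℝ≥0∞} (hf : Measurable f) (hg : Measurable g) (z : ℝ) :
    mom (conv f g) z = mom f z * mom g z := by
  have h1 : mom (conv f g) z = ∫⁻ u, ∫⁻ x, ENNReal.ofReal (rexp (z * u)) * (f x * g (u - x)) := by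
    unfold mom conv
    congr 1; ext u
    rw [lintegral_const_mul _ (by fun_prop)]
  rw [h1, lintegral_lintegral_swap (by fun_prop)]
  unfold mom
  rw [← lintegral_mul_const _ (by fun_prop)]
  congr 1; ext x
  rw [← lintegral_add_right_eq_self (fun u => ENNReal.ofReal (rexp (z * u)) * (f x * g (u - x))) x,
    ← lintegral_const_mul _ (by fun_prop)]
  congr 1; ext u
  rw [add_sub_cancel_right, mul_add, Real.exp_add, ENNReal.ofReal_mul (by positivity)]
  ring

theorem mom_Tl (l : List ℕ) {g : ℝ → ℝ≥0∞} (hg : Measurable g) (z : ℝ) :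
    mom (Tl l g) z = (l.map (fun e => mom (fe e) z)).prod * mom g z := by
  induction l with
  | nil => simp [Tl]
  | cons e l ih =>
    rw [show Tl (e :: l) g = conv (fe e) (Tl l g) from rfl, mom_conv (measurable_fe e) (measurable_Tl l hg),
      ih, List.map_cons, List.prod_cons, mul_assoc]

theorem Tl_pos (l : List ℕ) (hl : l ≠ []) {A η : ℝ} (hη : 0 < η) (u : ℝ) : 0 < Tl l (win A η) u := by
  have aux : ∀ (e : ℕ) (g : ℝ → ℝ≥0∞), Measurable g → 0 < ∫⁻ x, g x → ∀ u, 0 < conv (fe e) g u := by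
    intro e g hg h u
    rw [pos_iff_ne_zero] at h ⊢
    contrapose! h
    unfold conv at h
    have := measurable_fe e
    rw [lintegral_eq_zero_iff (by fun_prop)] at h
    rw [← lintegral_sub_left_eq_self _ u, lintegral_eq_zero_iff (by fun_prop)]
    filter_upwards [h] with x hx
    simpa [(fe_pos e x).ne'] using hx
  have int : ∀ l : List ℕ, 0 < ∫⁻ x, Tl l (win A η) x := by
    intro l
    have hw : 0 < ∫⁻ x, win A η x := by
      have := win_lintegral A η 1
      simp only [Pi.one_apply, one_mul] at this
      rw [this]; simp [hη]
    cases l with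
    | nil => exact hw
    | cons e l =>
      have : ∀ l u, 0 < Tl (e :: l) (win A η) u := by
        intro l
        induction l generalizing e with
        | nil => exact aux e _ (measurable_win A η) hw
        | cons e' l ih =>
          apply aux e _ (measurable_Tl _ (measurable_win A η))
          rw [pos_iff_ne_zero, ne_eq, lintegral_eq_zero_iff (measurable_Tl _ (measurable_win A η))]
          intro h
          obtain ⟨x, hx⟩ := h.exists
          exact (ih e' x).ne' hx
      rw [pos_iff_ne_zero, ne_eq, lintegral_eq_zero_iff (measurable_Tl _ (measurable_win A η))]
      intro h
      obtain ⟨x, hx⟩ := h.exists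
      exact (this l x).ne' hx
  cases l with
  | nil => exact absurd rfl hl
  | cons e l => exact aux e _ (measurable_Tl l (measurable_win A η)) (int l) u

end RegR

open MeasureTheory Real
open scoped ENNReal

namespace RegR

/-- real moment of the place function -/
noncomputable def Me (e : ℕ) (z : ℝ) : ℝ := (e / 2) * (e : ℝ) ^ (-(e * z / 2)) * Gamma (e * z / 2)

theorem Me_pos {e : ℕ} (he : 0 < e) {z : ℝ} (hz : 0 < z) : 0 < Me e z := by
  unfold Me
  have : (0:ℝ) < e := by exact_mod_cast he
  have := Real.Gamma_pos_of_pos (s := e * z / 2) (by positivity)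
  positivity

theorem mom_fe {e : ℕ} (he : 0 < e) {z : ℝ} (hz : 0 < z) : mom (fe e) z = ENNReal.ofReal (Me e z) := by
  have he' : (0:ℝ) < e := by exact_mod_cast he
  have hG : ENNReal.ofReal (Gamma (e * z / 2)) =
      ∫⁻ x in Set.Ioi (0:ℝ), ENNReal.ofReal (rexp (-x) * x ^ (e * z / 2 - 1)) := by
    rw [Real.Gamma_eq_integral (by positivity)]
    apply ofReal_integral_eq_lintegral_ofReal
    · exact Real.GammaIntegral_convergent (by positivity)
    · filter_upwards [self_mem_ae_restrict measurableSet_Ioi] with x hx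
      have : (0:ℝ) < x := hx
      positivity
  have him : Set.image (fun u : ℝ => e * rexp (2 * u / e)) Set.univ = Set.Ioi 0 := by
    ext t
    simp only [Set.image_univ, Set.mem_range, Set.mem_Ioi]
    constructor
    · rintro ⟨u, rfl⟩; positivity
    · intro ht
      refine ⟨e / 2 * Real.log (t / e), ?_⟩
      rw [show 2 * (e / 2 * Real.log (t / e)) / e = Real.log (t / e) by field_simp,
        Real.exp_log (by positivity)]
      field_simp
  have hder : ∀ u ∈ Set.univ, HasDerivWithinAt (fun u : ℝ => e * rexp (2 * u / e)) (2 * rexp (2 * u / e)) Set.univ u := by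
    intro u _
    have : HasDerivAt (fun u : ℝ => e * rexp (2 * u / e)) (e * (rexp (2 * u / e) * (2 * 1 / e))) u :=
      (((hasDerivAt_id u).const_mul 2).div_const (e:ℝ)).exp.const_mul (e:ℝ)
    have h2 : (e:ℝ) * (rexp (2 * u / e) * (2 * 1 / e)) = 2 * rexp (2 * u / e) := by field_simp
    rw [h2] at this
    exact this.hasDerivWithinAt
  have hinj : Set.InjOn (fun u : ℝ => e * rexp (2 * u / e)) Set.univ := by
    intro x _ y _ h
    have h1 : rexp (2 * x / e) = rexp (2 * y / e) := mul_left_cancel₀ he'.ne' h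
    have h2 := Real.exp_injective h1
    field_simp at h2
    linarith
  rw [← him, lintegral_image_eq_lintegral_abs_deriv_mul MeasurableSet.univ hder hinj] at hG
  unfold Me
  rw [ENNReal.ofReal_mul (by positivity), hG, ← lintegral_const_mul' _ _ ENNReal.ofReal_ne_top]
  unfold mom fe
  rw [Measure.restrict_univ]
  congr 1; ext u
  rw [← ENNReal.ofReal_mul (by positivity), ← ENNReal.ofReal_mul (by positivity), ← ENNReal.ofReal_mul (by positivity)]
  congr 1
  rw [abs_of_pos (by positivity), Real.mul_rpow (by positivity) (by positivity), ← Real.exp_mul]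
  have e1 : (e:ℝ) ^ (-(e * z / 2)) = (e:ℝ)⁻¹ * ((e:ℝ) ^ (e * z / 2 - 1))⁻¹ := by
    rw [← Real.rpow_neg_one, ← Real.rpow_neg he'.le, ← Real.rpow_add he']; congr 1; ring
  rw [e1]
  have e2 : rexp (z * u) = rexp (2 * u / e) * rexp (2 * u / e * (e * z / 2 - 1)) := by
    rw [← Real.exp_add]; congr 1; field_simp; ring
  rw [e2]
  have : (e:ℝ) ^ ((e:ℝ) * z / 2 - 1) ≠ 0 := by positivity
  field_simp

theorem mom_win_le (A η : ℝ) {z : ℝ} (hz : 0 ≤ z) :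
    mom (win A η) z ≤ ENNReal.ofReal (η * rexp (-A * z)) := by
  unfold mom
  rw [win_lintegral]
  calc _ ≤ ∫⁻ x in Set.Icc (-(A + η)) (-A), ENNReal.ofReal (rexp (-A * z)) := by
        apply setLIntegral_mono measurable_const
        intro x hx
        apply ENNReal.ofReal_le_ofReal
        apply Real.exp_le_exp.2
        nlinarith [hx.2]
    _ = _ := by
        rw [setLIntegral_const, Real.volume_Icc, ← ENNReal.ofReal_mul (by positivity)]
        congr 1; ring

theorem mom_win_ge (A η : ℝ) {z : ℝ} (hz : 0 ≤ z) :
    ENNReal.ofReal (η * rexp (-(A + η) * z)) ≤ mom (win A η) z := by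
  unfold mom
  rw [win_lintegral]
  calc _ = ∫⁻ x in Set.Icc (-(A + η)) (-A), ENNReal.ofReal (rexp (-(A + η) * z)) := by
        rw [setLIntegral_const, Real.volume_Icc, ← ENNReal.ofReal_mul (by positivity)]
        congr 1; ring
    _ ≤ _ := by
        apply setLIntegral_mono (by fun_prop)
        intro x hx
        apply ENNReal.ofReal_le_ofReal
        apply Real.exp_le_exp.2
        nlinarith [hx.1]

theorem mom_win_add (A η : ℝ) (z : ℝ) {a : ℝ} (ha : 0 ≤ a) :
    mom (win A η) (z + a) ≤ ENNReal.ofReal (rexp (-A * a)) * mom (win A η) z := by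
  unfold mom
  rw [win_lintegral, win_lintegral, ← lintegral_const_mul _ (by fun_prop)]
  apply setLIntegral_mono (by fun_prop)
  intro x hx
  rw [← ENNReal.ofReal_mul (by positivity), ← Real.exp_add]
  apply ENNReal.ofReal_le_ofReal
  apply Real.exp_le_exp.2
  nlinarith [hx.2]

theorem mom_win_sub (A η : ℝ) (z : ℝ) {a : ℝ} (ha : 0 ≤ a) :
    mom (win A η) (z - a) ≤ ENNReal.ofReal (rexp ((A + η) * a)) * mom (win A η) z := by
  unfold mom
  rw [win_lintegral, win_lintegral, ← lintegral_const_mul _ (by fun_prop)]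
  apply setLIntegral_mono (by fun_prop)
  intro x hx
  rw [← ENNReal.ofReal_mul (by positivity), ← Real.exp_add]
  apply ENNReal.ofReal_le_ofReal
  apply Real.exp_le_exp.2
  nlinarith [hx.1]

theorem tail_le {T : ℝ → ℝ≥0∞} (hT : Antitone T) {z : ℝ} (hz : 0 < z) (u : ℝ) :
    T u * ENNReal.ofReal (rexp (z * u) / z) ≤ mom T z := by
  have h1 : ∫⁻ s in Set.Iic u, ENNReal.ofReal (rexp (z * s)) = ENNReal.ofReal (rexp (z * u) / z) := by
    rw [← integral_exp_mul_Iic hz u]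
    symm
    apply ofReal_integral_eq_lintegral_ofReal
    · exact integrableOn_exp_mul_Iic hz u
    · filter_upwards with x; positivity
  rw [← h1, ← lintegral_const_mul _ (by fun_prop)]
  unfold mom
  refine le_trans ?_ (setLIntegral_le_lintegral (Set.Iic u) _)
  refine setLIntegral_mono' measurableSet_Iic ?_
  intro x hx
  rw [mul_comm]
  gcongr
  exact hT hx

theorem mom_Tl_ne_top {l : List ℕ} (hl : ∀ e ∈ l, 0 < e) {A η : ℝ} (hη : 0 < η) {z : ℝ} (hz : 0 < z) :
    mom (Tl l (win A η)) z ≠ ⊤ := by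
  rw [mom_Tl l (measurable_win A η)]
  apply ENNReal.mul_ne_top
  · induction l with
    | nil => simp
    | cons e l ih =>
      rw [List.map_cons, List.prod_cons, mom_fe (hl e (by simp)) hz]
      exact ENNReal.mul_ne_top ENNReal.ofReal_ne_top (ih fun e he => hl e (by simp [he]))
  · exact ne_top_of_le_ne_top ENNReal.ofReal_ne_top (mom_win_le A η hz.le)

theorem Tl_ne_top {l : List ℕ} (hne : l ≠ []) (hl : ∀ e ∈ l, 0 < e) {A η : ℝ} (hη : 0 < η) (u : ℝ) :
    Tl l (win A η) u ≠ ⊤ := by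
  have h := tail_le (Tl_anti hne (win A η)) one_pos u
  intro ht
  rw [ht, ENNReal.top_mul (by simp; positivity)] at h
  exact mom_Tl_ne_top hl hη one_pos (top_le_iff.1 h)

/-- list of multiplicities above `v` -/
def Lst {κ : Type*} [DecidableEq κ] : (n : ℕ) → (Fin n → ℕ) → (Fin n → κ) → κ → List ℕ
  | 0, _, _, _ => []
  | n + 1, e, pr, v => if pr 0 = v then e 0 :: Lst n (fun i => e i.succ) (fun i => pr i.succ) v
      else Lst n (fun i => e i.succ) (fun i => pr i.succ) v

theorem Lst_sum {κ : Type*} [DecidableEq κ] (n : ℕ) (e : Fin n → ℕ) (pr : Fin n → κ) (v : κ) :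
    (Lst n e pr v).sum = ∑ i, if pr i = v then e i else 0 := by
  induction n with
  | zero => simp [Lst]
  | succ n ih =>
    rw [Fin.sum_univ_succ, ← ih, Lst]
    split_ifs <;> simp

theorem Lst_mem {κ : Type*} [DecidableEq κ] (n : ℕ) (e : Fin n → ℕ) (pr : Fin n → κ) (v : κ) (k : ℕ)
    (h : k ∈ Lst n e pr v) : ∃ i, e i = k := by
  induction n with
  | zero => simp [Lst] at h
  | succ n ih =>
    rw [Lst] at h
    split_ifs at h
    · rw [List.mem_cons] at h
      rcases h with h | h
      · exact ⟨0, h.symm⟩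
      · obtain ⟨i, hi⟩ := ih _ _ h; exact ⟨i.succ, hi⟩
    · obtain ⟨i, hi⟩ := ih _ _ h; exact ⟨i.succ, hi⟩

theorem prod_formula {κ : Type*} [DecidableEq κ] [Fintype κ] (n : ℕ) (e : Fin n → ℕ) (pr : Fin n → κ)
    (g : κ → ℝ → ℝ≥0∞) (hg : ∀ v, Measurable (g v)) (p : κ → ℝ) :
    ∫⁻ x : Fin n → ℝ, (∏ i, fe (e i) (x i)) * ∏ v, g v (p v - ∑ i, if pr i = v then x i else 0)
      = ∏ v, Tl (Lst n e pr v) (g v) (p v) := by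
  induction n generalizing p with
  | zero => simp [Lst, Tl, lintegral_unique, volume_pi, Measure.pi_empty_univ]
  | succ n ih =>
    have hfe := measurable_fe
    rw [← (volume_preserving_piFinSuccAbove (fun _ => ℝ) 0).symm.lintegral_comp
      (f := fun x : Fin (n+1) → ℝ => (∏ i, fe (e i) (x i)) * ∏ v, g v (p v - ∑ i, if pr i = v then x i else 0))]
    swap
    · apply Measurable.mul
      · fun_prop
      · refine Finset.measurable_prod _ fun v _ => (hg v).comp ?_
        apply Measurable.const_sub
        refine Finset.measurable_sum _ fun i _ => ?_
        split_ifs <;> fun_prop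
    have key : ∀ y : ℝ × (Fin n → ℝ), ((∏ i, fe (e i) (((MeasurableEquiv.piFinSuccAbove (fun _ => ℝ) 0).symm y) i)) *
        ∏ v, g v (p v - ∑ i, if pr i = v then ((MeasurableEquiv.piFinSuccAbove (fun _ => ℝ) 0).symm y) i else 0))
        = fe (e 0) y.1 * ((∏ i : Fin n, fe (e i.succ) (y.2 i)) *
          ∏ v, g v ((p v - if pr 0 = v then y.1 else 0) - ∑ i : Fin n, if pr i.succ = v then y.2 i else 0)) := by
      intro y
      rw [Fin.prod_univ_succ, mul_assoc]
      simp only [Fin.sum_univ_succ]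
      simp [MeasurableEquiv.piFinSuccAbove, sub_sub]
    simp_rw [key]
    rw [Measure.volume_eq_prod, lintegral_prod]
    swap
    · apply Measurable.aemeasurable
      apply Measurable.mul
      · fun_prop
      apply Measurable.mul
      · fun_prop
      · refine Finset.measurable_prod _ fun v _ => (hg v).comp ?_
        apply Measurable.sub
        · split_ifs <;> fun_prop
        refine Finset.measurable_sum _ fun i _ => ?_
        split_ifs <;> fun_prop
    have step : ∀ x : ℝ, ∫⁻ y : Fin n → ℝ, fe (e 0) x * ((∏ i : Fin n, fe (e i.succ) (y i)) *
          ∏ v, g v ((p v - if pr 0 = v then x else 0) - ∑ i : Fin n, if pr i.succ = v then y i else 0))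
        = (fe (e 0) x * Tl (Lst n (fun i => e i.succ) (fun i => pr i.succ) (pr 0)) (g (pr 0)) (p (pr 0) - x)) *
          ∏ v ∈ Finset.univ.erase (pr 0), Tl (Lst n (fun i => e i.succ) (fun i => pr i.succ) v) (g v) (p v) := by
      intro x
      rw [lintegral_const_mul' _ _ (by unfold fe; exact ENNReal.ofReal_ne_top),
        ih (fun i => e i.succ) (fun i => pr i.succ) (fun v => p v - if pr 0 = v then x else 0),
        ← Finset.mul_prod_erase _ _ (Finset.mem_univ (pr 0)), ← mul_assoc]
      simp only [if_true]
      congr 1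
      apply Finset.prod_congr rfl
      intro v hv
      rw [if_neg (Finset.ne_of_mem_erase hv).symm, sub_zero]
    simp_rw [step]
    rw [lintegral_mul_const]
    swap
    · have := measurable_Tl (Lst n (fun i => e i.succ) (fun i => pr i.succ) (pr 0)) (hg (pr 0))
      fun_prop
    rw [← Finset.mul_prod_erase _ _ (Finset.mem_univ (pr 0))]
    congr 1
    · simp only [Lst, if_true]; rfl
    · apply Finset.prod_congr rfl
      intro v hv
      rw [Lst, if_neg (Finset.ne_of_mem_erase hv).symm]

end RegR

open MeasureTheory Real
open scoped ENNReal

namespace RegR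

theorem upper_tail (T : ℝ → ℝ≥0∞) (hTm : Measurable T) (z : ℝ) {a : ℝ} (ha : 0 ≤ a) (u : ℝ) :
    ∫⁻ s in Set.Ioi u, ENNReal.ofReal (rexp (z * s)) * T s ≤ ENNReal.ofReal (rexp (-a * u)) * mom T (z + a) := by
  unfold mom
  rw [← lintegral_const_mul _ (by fun_prop)]
  refine le_trans ?_ (setLIntegral_le_lintegral (Set.Ioi u) _)
  refine setLIntegral_mono' measurableSet_Ioi ?_
  intro x hx
  have hx' : u < x := hx
  rw [← mul_assoc, ← ENNReal.ofReal_mul (by positivity), ← Real.exp_add]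
  gcongr
  nlinarith

theorem lower_tail (T : ℝ → ℝ≥0∞) (hTm : Measurable T) (z : ℝ) {a : ℝ} (ha : 0 ≤ a) (u : ℝ) :
    ∫⁻ s in Set.Iic u, ENNReal.ofReal (rexp (z * s)) * T s ≤ ENNReal.ofReal (rexp (a * u)) * mom T (z - a) := by
  unfold mom
  rw [← lintegral_const_mul _ (by fun_prop)]
  refine le_trans ?_ (setLIntegral_le_lintegral (Set.Iic u) _)
  refine setLIntegral_mono' measurableSet_Iic ?_
  intro x hx
  have hx' : x ≤ u := hx
  rw [← mul_assoc, ← ENNReal.ofReal_mul (by positivity), ← Real.exp_add]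
  gcongr
  nlinarith

theorem left_part {T : ℝ → ℝ≥0∞} (hTm : Measurable T) (hT : Antitone T)
    (hfin : ∀ u, T u ≠ ⊤) {z ρ δ u : ℝ} (hδ : 0 < δ) (hz : 0 < z) (hρ : ρ < z)
    (hm : mom T z ≠ ⊤)
    (hs : ∀ s ≤ u, T s ≤ ENNReal.ofReal (rexp (ρ * δ)) * T (s + δ)) :
    ∫⁻ s in Set.Iic u, ENNReal.ofReal (rexp (z * s)) * T s ≤
      ENNReal.ofReal (rexp (z * δ) * rexp (z * u) / (z - ρ)) * T u := by
  set φ := ∫⁻ s in Set.Iic u, ENNReal.ofReal (rexp (z * s)) * T s with hφ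
  have hφt : φ ≠ ⊤ := ne_top_of_le_ne_top hm (setLIntegral_le_lintegral (Set.Iic u) _)
  have h1 : φ ≤ ENNReal.ofReal (rexp ((ρ - z) * δ)) * ∫⁻ s in Set.Iic (u + δ), ENNReal.ofReal (rexp (z * s)) * T s := by
    have e1 : ∫⁻ s in Set.Iic (u + δ), ENNReal.ofReal (rexp (z * s)) * T s =
        ∫⁻ s in Set.Iic u, ENNReal.ofReal (rexp (z * (s + δ))) * T (s + δ) := by
      rw [← lintegral_indicator measurableSet_Iic, ← lintegral_indicator measurableSet_Iic,
        ← lintegral_add_right_eq_self _ δ]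
      congr 1; ext s
      by_cases h : s ≤ u
      · rw [Set.indicator_of_mem (show s + δ ∈ Set.Iic (u + δ) by simpa using h),
          Set.indicator_of_mem (show s ∈ Set.Iic u from h)]
      · rw [Set.indicator_of_notMem (show s + δ ∉ Set.Iic (u + δ) by simpa using h),
          Set.indicator_of_notMem (show s ∉ Set.Iic u from h)]
    rw [e1, ← lintegral_const_mul _ (by fun_prop)]
    refine setLIntegral_mono' measurableSet_Iic ?_
    intro s hs'
    calc _ ≤ ENNReal.ofReal (rexp (z * s)) * (ENNReal.ofReal (rexp (ρ * δ)) * T (s + δ)) := by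
          gcongr; exact hs s hs'
      _ = _ := by
          rw [← mul_assoc, ← mul_assoc, ← ENNReal.ofReal_mul (by positivity), ← ENNReal.ofReal_mul (by positivity),
            ← Real.exp_add, ← Real.exp_add]
          congr 3; ring
  have h2 : ∫⁻ s in Set.Iic (u + δ), ENNReal.ofReal (rexp (z * s)) * T s ≤
      φ + ENNReal.ofReal (δ * rexp (z * (u + δ))) * T u := by
    rw [← Set.Iic_union_Ioc_eq_Iic (show u ≤ u + δ by linarith)]
    refine (lintegral_union_le _ _ _).trans ?_
    gcongr
    calc _ ≤ ∫⁻ s in Set.Ioc u (u + δ), ENNReal.ofReal (rexp (z * (u + δ))) * T u := by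
          refine setLIntegral_mono' measurableSet_Ioc ?_
          intro s hs'
          gcongr
          · exact hs'.2
          · exact hT hs'.1.le
      _ = _ := by
          rw [setLIntegral_const, Real.volume_Ioc, add_sub_cancel_left, mul_right_comm,
            ← ENNReal.ofReal_mul (by positivity), mul_comm δ]
  have h3 := h1.trans (mul_le_mul_right h2 _)
  lift φ to NNReal using hφt with φ'
  have hTu : T u = ENNReal.ofReal (T u).toReal := (ENNReal.ofReal_toReal (hfin u)).symm
  rw [hTu, ← ENNReal.ofReal_coe_nnreal, ← ENNReal.ofReal_mul (by positivity), ← ENNReal.ofReal_add (by positivity) (by positivity),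
    ← ENNReal.ofReal_mul (by positivity), ENNReal.ofReal_le_ofReal_iff (by positivity)] at h3
  rw [hTu, ← ENNReal.ofReal_coe_nnreal, ← ENNReal.ofReal_mul (by have := sub_pos.2 hρ; positivity)]
  apply ENNReal.ofReal_le_ofReal
  set t := (T u).toReal
  have ht : 0 ≤ t := ENNReal.toReal_nonneg
  have hφ0 : (0:ℝ) ≤ φ' := φ'.2
  have hq : 0 < z - ρ := sub_pos.2 hρ
  rw [div_mul_eq_mul_div, le_div_iff₀ hq]
  have h4 : rexp ((z - ρ) * δ) * rexp ((ρ - z) * δ) = 1 := by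
    rw [← Real.exp_add]; simp; ring
  have h5 : rexp ((z - ρ) * δ) * φ' ≤ φ' + δ * rexp (z * (u + δ)) * t := by
    calc _ ≤ rexp ((z - ρ) * δ) * (rexp ((ρ - z) * δ) * (φ' + δ * rexp (z * (u + δ)) * t)) := by gcongr
      _ = _ := by rw [← mul_assoc, h4, one_mul]
  have h6 := Real.add_one_le_exp ((z - ρ) * δ)
  have h7 : rexp (z * (u + δ)) = rexp (z * δ) * rexp (z * u) := by rw [← Real.exp_add]; ring_nf
  rw [h7] at h5
  have h8 : δ * (φ' * (z - ρ)) ≤ δ * (rexp (z * δ) * rexp (z * u) * t) := by nlinarith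
  exact le_of_mul_le_mul_left h8 hδ

theorem R2 {T : ℝ → ℝ≥0∞} (hTm : Measurable T) (hT : Antitone T) (hLC : LC T)
    (hpos : ∀ u, 0 < T u) (hfin : ∀ u, T u ≠ ⊤) (hmf : ∀ z, 0 < z → mom T z ≠ ⊤) {z ρ δ u a : ℝ} (hδ : 0 < δ) (hz : 0 < z) (hρ : ρ < z) (ha : 0 < a)
    (hK : rexp (-a * u) * (mom T (z + a)).toReal * (1 + rexp (z * δ) * (z + a) / (z - ρ)) < (mom T z).toReal) :
    T (u + δ) ≤ ENNReal.ofReal (rexp (-(ρ * δ))) * T u := by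
  by_contra hcon
  push Not at hcon
  have hs : ∀ s ≤ u, T s ≤ ENNReal.ofReal (rexp (ρ * δ)) * T (s + δ) := by
    intro s hsu
    have h1 := hLC s (u - s) δ (by linarith) hδ.le
    rw [show s + (u - s) = u by ring] at h1
    have h2 : T u * (ENNReal.ofReal (rexp (-(ρ * δ))) * T s) ≤ T u * T (s + δ) := by
      refine le_trans ?_ h1
      calc _ = T s * (ENNReal.ofReal (rexp (-(ρ * δ))) * T u) := by ring
        _ ≤ _ := by gcongr
    rw [ENNReal.mul_le_mul_iff_right (hpos u).ne' (hfin u)] at h2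
    calc T s = ENNReal.ofReal (rexp (ρ * δ)) * (ENNReal.ofReal (rexp (-(ρ * δ))) * T s) := by
          rw [← mul_assoc, ← ENNReal.ofReal_mul (by positivity), ← Real.exp_add]; simp
      _ ≤ _ := by gcongr
  have h1 := left_part hTm hT hfin hδ hz hρ (hmf z hz) hs
  have h2 := upper_tail T hTm z ha.le u
  have h3 := tail_le hT (show 0 < z + a by linarith) u
  have h4 : mom T z ≤ ENNReal.ofReal (rexp (z * δ) * rexp (z * u) / (z - ρ)) * T u +
      ENNReal.ofReal (rexp (-a * u)) * mom T (z + a) := by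
    have : mom T z = (∫⁻ s in Set.Iic u, ENNReal.ofReal (rexp (z * s)) * T s) + ∫⁻ s in Set.Ioi u, ENNReal.ofReal (rexp (z * s)) * T s := by
      unfold mom
      rw [← Set.compl_Iic, lintegral_add_compl _ measurableSet_Iic]
    rw [this]
    exact add_le_add h1 h2
  have hq : 0 < z - ρ := sub_pos.2 hρ
  have hza : 0 < z + a := by linarith
  rw [← ENNReal.ofReal_toReal (hfin u), ← ENNReal.ofReal_toReal (hmf (z + a) hza), ← ENNReal.ofReal_mul (by positivity),
    ENNReal.ofReal_le_ofReal_iff (by positivity)] at h3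
  rw [← ENNReal.ofReal_toReal (hfin u), ← ENNReal.ofReal_toReal (hmf (z + a) hza), ← ENNReal.ofReal_toReal (hmf z hz), ← ENNReal.ofReal_mul (by positivity),
    ← ENNReal.ofReal_mul (by positivity), ← ENNReal.ofReal_add (by positivity) (by positivity), ENNReal.ofReal_le_ofReal_iff (by positivity)] at h4
  set t := (T u).toReal
  set m1 := (mom T (z + a)).toReal
  set m0 := (mom T z).toReal
  have h5 : rexp (z * u) * t ≤ (z + a) * (rexp (-a * u) * m1) := by
    rw [mul_div_assoc', div_le_iff₀ hza] at h3
    have e : rexp (z * u) = rexp (-a * u) * rexp ((z + a) * u) := by rw [← Real.exp_add]; ring_nf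
    rw [e]
    nlinarith [Real.exp_pos (-a * u)]
  have h6 : rexp (z * δ) * rexp (z * u) / (z - ρ) * t ≤ rexp (z * δ) / (z - ρ) * ((z + a) * (rexp (-a * u) * m1)) := by
    calc _ = rexp (z * δ) / (z - ρ) * (rexp (z * u) * t) := by ring
      _ ≤ _ := by gcongr
  have : rexp (-a * u) * m1 * (1 + rexp (z * δ) * (z + a) / (z - ρ)) =
    rexp (z * δ) / (z - ρ) * ((z + a) * (rexp (-a * u) * m1)) + rexp (-a * u) * m1 := by ring
  linarith

theorem peak_bound {T : ℝ → ℝ≥0∞} (hT : Antitone T) (hLC : LC T)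
    (hpos : ∀ u, 0 < T u) (hfin : ∀ u, T u ≠ ⊤) {z δ : ℝ} (hδ : 0 < δ) (hz : 0 ≤ z)
    (hzT : (T δ).toReal = rexp (-(z * δ)) * (T 0).toReal) (s : ℝ) :
    rexp (z * s) * (T s).toReal ≤ rexp (z * δ) * (T 0).toReal := by
  have hpos' : ∀ u, 0 < (T u).toReal := fun u => ENNReal.toReal_pos (hpos u).ne' (hfin u)
  have hLC' : ∀ a s t : ℝ, 0 ≤ s → 0 ≤ t → (T a).toReal * (T (a + s + t)).toReal ≤ (T (a + s)).toReal * (T (a + t)).toReal := by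
    intro a s t hs ht
    rw [← ENNReal.toReal_mul, ← ENNReal.toReal_mul]
    exact ENNReal.toReal_mono (ENNReal.mul_ne_top (hfin _) (hfin _)) (hLC a s t hs ht)
  have hup : ∀ k : ℕ, (T (k * δ)).toReal ≤ rexp (-(z * (k * δ))) * (T 0).toReal := by
    intro k
    induction k with
    | zero => simp
    | succ k ih =>
      have h := hLC' 0 (k * δ) δ (by positivity) hδ.le
      rw [zero_add, zero_add, hzT, ← mul_assoc, mul_comm] at h
      have h1 := le_of_mul_le_mul_right h (hpos' 0)
      push_cast
      rw [show (k + 1 : ℝ) * δ = k * δ + δ by ring]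
      refine h1.trans ?_
      rw [show -(z * (k * δ + δ)) = -(z * (k * δ)) + -(z * δ) by ring, Real.exp_add]
      nlinarith [Real.exp_pos (-(z * δ))]
  have hdown : ∀ k : ℕ, (T (-(k * δ))).toReal ≤ rexp (z * (k * δ)) * (T 0).toReal := by
    intro k
    induction k with
    | zero => simp
    | succ k ih =>
      have h := hLC' (-((k + 1) * δ)) δ ((k + 1) * δ) hδ.le (by positivity)
      rw [show -((k + 1) * δ) + δ + (k + 1) * δ = δ by ring, show -((k + 1) * δ) + (k + 1) * δ = 0 by ring,
        show -((k + 1) * δ) + δ = -(k * δ) by ring, hzT, ← mul_assoc] at h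
      have h1 := le_of_mul_le_mul_right h (hpos' 0)
      push_cast
      rw [show (k + 1 : ℝ) * δ = k * δ + δ by ring] at h1 ⊢
      rw [show z * (k * δ + δ) = z * (k * δ) + z * δ by ring, Real.exp_add]
      rw [Real.exp_neg, ← div_eq_mul_inv, div_le_iff₀ (Real.exp_pos _)] at h1
      nlinarith [Real.exp_pos (z * δ)]
  have hInt : ∀ k : ℤ, (T (k * δ)).toReal ≤ rexp (-(z * (k * δ))) * (T 0).toReal := by
    intro k
    rcases Int.eq_nat_or_neg k with ⟨n, rfl | rfl⟩
    · exact_mod_cast hup n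
    · have := hdown n
      push_cast
      rw [show -(n:ℝ) * δ = -(n * δ) by ring, show -(z * -(n * δ)) = z * (n * δ) by ring]
      exact this
  have hk1 : (⌊s / δ⌋ : ℝ) * δ ≤ s := by
    have := Int.floor_le (s / δ); rwa [le_div_iff₀ hδ] at this
  have hk2 : s ≤ (⌊s / δ⌋ : ℝ) * δ + δ := by
    have := (Int.lt_floor_add_one (s / δ)).le; rw [div_le_iff₀ hδ] at this; linarith
  have h1 : (T s).toReal ≤ (T (⌊s / δ⌋ * δ)).toReal := ENNReal.toReal_mono (hfin _) (hT hk1)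
  have h2 := h1.trans (hInt _)
  calc _ ≤ rexp (z * (⌊s / δ⌋ * δ + δ)) * (rexp (-(z * (⌊s / δ⌋ * δ))) * (T 0).toReal) := by gcongr
    _ = _ := by rw [← mul_assoc, ← Real.exp_add]; congr 2; ring

theorem peak {T : ℝ → ℝ≥0∞} (hTm : Measurable T) (hT : Antitone T) (hLC : LC T)
    (hpos : ∀ u, 0 < T u) (hfin : ∀ u, T u ≠ ⊤) (hmf : ∀ z, 0 < z → mom T z ≠ ⊤) {z δ : ℝ} (hδ : 0 < δ) (hz : 1 ≤ z)
    (hzT : (T δ).toReal = rexp (-(z * δ)) * (T 0).toReal) {u₁ u₂ : ℝ} (hu : u₂ ≤ u₁)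
    (h1 : 4 * rexp (-u₁) * (mom T (z + 1)).toReal ≤ (mom T z).toReal)
    (h2 : 4 * rexp (u₂ / 2) * (mom T (z - 1 / 2)).toReal ≤ (mom T z).toReal) :
    (mom T z).toReal ≤ 2 * (u₁ - u₂) * rexp (z * δ) * (T 0).toReal := by
  have hpb := peak_bound hT hLC hpos hfin hδ (by linarith) hzT
  have hA := upper_tail T hTm z (a := 1) zero_le_one u₁
  have hB := lower_tail T hTm z (a := 1 / 2) (by norm_num) u₂
  have hC : ∫⁻ s in Set.Ioc u₂ u₁, ENNReal.ofReal (rexp (z * s)) * T s ≤ ENNReal.ofReal (rexp (z * δ) * (T 0).toReal * (u₁ - u₂)) := by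
    calc _ ≤ ∫⁻ s in Set.Ioc u₂ u₁, ENNReal.ofReal (rexp (z * δ) * (T 0).toReal) := by
          refine setLIntegral_mono' measurableSet_Ioc ?_
          intro s _
          rw [← ENNReal.ofReal_toReal (hfin s), ← ENNReal.ofReal_mul (by positivity)]
          exact ENNReal.ofReal_le_ofReal (hpb s)
      _ = _ := by
          rw [setLIntegral_const, Real.volume_Ioc, ← ENNReal.ofReal_mul (by positivity)]
  have hall : mom T z ≤ ENNReal.ofReal (rexp (1 / 2 * u₂)) * mom T (z - 1 / 2) + ENNReal.ofReal (rexp (z * δ) * (T 0).toReal * (u₁ - u₂)) +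
      ENNReal.ofReal (rexp (-1 * u₁)) * mom T (z + 1) := by
    have : mom T z = (∫⁻ s in Set.Iic u₁, ENNReal.ofReal (rexp (z * s)) * T s) + ∫⁻ s in Set.Ioi u₁, ENNReal.ofReal (rexp (z * s)) * T s := by
      unfold mom
      rw [← Set.compl_Iic, lintegral_add_compl _ measurableSet_Iic]
    rw [this, ← Set.Iic_union_Ioc_eq_Iic hu]
    refine add_le_add ((lintegral_union_le _ _ _).trans (add_le_add hB hC)) hA
  have hu' := sub_nonneg.2 hu
  rw [← ENNReal.ofReal_toReal (hmf z (by linarith)), ← ENNReal.ofReal_toReal (hmf (z + 1) (by linarith)),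
    ← ENNReal.ofReal_toReal (hmf (z - 1 / 2) (by linarith)), ← ENNReal.ofReal_mul (by positivity),
    ← ENNReal.ofReal_mul (by positivity), ← ENNReal.ofReal_add (by positivity) (by positivity),
    ← ENNReal.ofReal_add (by positivity) (by positivity), ENNReal.ofReal_le_ofReal_iff (by positivity)] at hall
  rw [show -1 * u₁ = -u₁ by ring, show 1 / 2 * u₂ = u₂ / 2 by ring] at hall
  nlinarith

end RegR

open MeasureTheory Real
open scoped ENNReal

namespace RegR

theorem lg_add_one {x : ℝ} (hx : 0 < x) : Real.log (Gamma (x + 1)) = Real.log x + Real.log (Gamma x) := by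
  rw [Real.Gamma_add_one hx.ne', Real.log_mul hx.ne' (Real.Gamma_pos_of_pos hx).ne']

theorem lg_add_nat {x : ℝ} (hx : 0 < x) (k : ℕ) :
    Real.log (Gamma (x + k)) = (∑ j ∈ Finset.range k, Real.log (x + j)) + Real.log (Gamma x) := by
  induction k with
  | zero => simp
  | succ k ih =>
    rw [Finset.sum_range_succ, show x + ((k + 1 : ℕ) : ℝ) = (x + k) + 1 by push_cast; ring,
      lg_add_one (by positivity), ih]
    ring

theorem lg_convex {x y a b : ℝ} (hx : 0 < x) (hy : 0 < y) (ha : 0 ≤ a) (hb : 0 ≤ b) (hab : a + b = 1) :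
    Real.log (Gamma (a * x + b * y)) ≤ a * Real.log (Gamma x) + b * Real.log (Gamma y) := by
  have := Real.convexOn_log_Gamma.2 (show x ∈ Set.Ioi 0 from hx) (show y ∈ Set.Ioi 0 from hy) ha hb hab
  simpa using this

theorem wendel {w a : ℝ} (hw : 0 < w) (ha : 0 ≤ a) (ha1 : a ≤ 1) :
    Real.log (Gamma (w + a)) ≤ Real.log (Gamma w) + a * Real.log w := by
  have := lg_convex hw (show 0 < w + 1 by linarith) (sub_nonneg.2 ha1) ha (by ring)
  rw [lg_add_one hw, show (1 - a) * w + a * (w + 1) = w + a by ring] at this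
  linarith

theorem chord1 {k z : ℝ} (hk : 0 < k) (hz : 1 ≤ z) :
    Real.log (Gamma k) + z * Real.log k ≤ Real.log (Gamma (z + k)) := by
  have hz0 : 0 < z := by linarith
  have := lg_convex hk (show 0 < z + k by linarith) (a := 1 - 1 / z) (b := 1 / z)
    (sub_nonneg.2 ((div_le_one hz0).2 hz)) (by positivity) (by ring)
  rw [show (1 - 1 / z) * k + 1 / z * (z + k) = k + 1 by field_simp; ring, lg_add_one hk] at this
  have h2 := mul_le_mul_of_nonneg_left this hz0.le
  have h3 : z * ((1 - 1 / z) * Real.log (Gamma k) + 1 / z * Real.log (Gamma (z + k))) =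
    (z - 1) * Real.log (Gamma k) + Real.log (Gamma (z + k)) := by field_simp
  rw [h3] at h2
  linarith

theorem chord2 {k w : ℝ} (hk : 1 < k) (hw : 0 ≤ w) :
    Real.log (Gamma k) + w * Real.log (k - 1) ≤ Real.log (Gamma (w + k)) := by
  have hw1 : 0 < w + 1 := by linarith
  have hk1 : 0 < k - 1 := by linarith
  have := lg_convex hk1 (show 0 < w + k by linarith) (a := w / (w + 1)) (b := 1 / (w + 1))
    (by positivity) (by positivity) (by field_simp)
  have h1 := lg_add_one hk1
  rw [sub_add_cancel] at h1
  rw [show w / (w + 1) * (k - 1) + 1 / (w + 1) * (w + k) = k by field_simp; ring] at this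
  have h2 := mul_le_mul_of_nonneg_left this hw1.le
  have h3 : (w + 1) * (w / (w + 1) * Real.log (Gamma (k - 1)) + 1 / (w + 1) * Real.log (Gamma (w + k))) =
    w * Real.log (Gamma (k - 1)) + Real.log (Gamma (w + k)) := by field_simp
  rw [h3] at h2
  nlinarith

theorem log_tangent {x y : ℝ} (hx : 0 < x) (hy : 0 < y) : Real.log y ≤ Real.log x + (y - x) / x := by
  have := Real.log_le_sub_one_of_pos (show 0 < y / x by positivity)
  rw [Real.log_div hy.ne' hx.ne'] at this
  have e : (y - x) / x = y / x - 1 := by field_simp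
  linarith

theorem lg_nat (k : ℕ) : Real.log (Gamma ((k + 1 : ℕ) : ℝ)) = Real.log (k.factorial) := by
  push_cast
  rw [Real.Gamma_nat_eq_factorial]

theorem sum_log_le {t z : ℝ} (ht : 0 < t) (hz : 0 < z) (k : ℕ) :
    ∑ j ∈ Finset.range k, Real.log (z + j) ≤ Real.log (∏ j ∈ Finset.range k, (t + j)) +
      (z - t) * ∑ j ∈ Finset.range k, 1 / (t + j) := by
  rw [Real.log_prod (fun j _ => by positivity), Finset.mul_sum, ← Finset.sum_add_distrib]
  apply Finset.sum_le_sum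
  intro j _
  have := log_tangent (show 0 < t + j by positivity) (show 0 < z + j by positivity)
  refine this.trans (le_of_eq ?_)
  ring

theorem lowC (k : ℕ) {t z : ℝ} (ht : 0 < t) (hz : 1 ≤ z) :
    z * Real.log (k + 1 : ℕ) - (z - t) * (∑ j ∈ Finset.range (k + 1), 1 / (t + j)) -
      Real.log ((∏ j ∈ Finset.range (k + 1), (t + j)) / k.factorial) ≤ Real.log (Gamma z) := by
  have hz0 : 0 < z := by linarith
  have h1 := chord1 (k := ((k + 1 : ℕ) : ℝ)) (by positivity) hz
  rw [lg_add_nat hz0, lg_nat] at h1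
  have h2 := sum_log_le ht hz0 (k + 1)
  rw [Real.log_div (Finset.prod_ne_zero_iff.2 fun j _ => by positivity) (by positivity)]
  linarith

theorem lowR (k : ℕ) (hk : 0 < k) {t z : ℝ} (ht : 0 < t) (hz : 0 < z) :
    z * Real.log (k : ℕ) - (z - t) * (∑ j ∈ Finset.range (k + 1), 1 / (t + j)) -
      Real.log ((∏ j ∈ Finset.range (k + 1), (t + j)) / k.factorial) ≤ Real.log (Gamma z) := by
  have h1 := chord2 (k := ((k + 1 : ℕ) : ℝ)) (by push_cast; simp [hk]) hz.le
  rw [lg_add_nat hz, lg_nat, show ((k + 1 : ℕ) : ℝ) - 1 = k by push_cast; ring] at h1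
  have h2 := sum_log_le ht hz (k + 1)
  rw [Real.log_div (Finset.prod_ne_zero_iff.2 fun j _ => by positivity) (by positivity)]
  linarith

theorem log_le_aux {P r x : ℝ} (n m : ℕ) (hP : 0 < P) (hm : 0 < 1 + x / m) (h : P ≤ 2 ^ n * (1 + x / m) ^ m) (hm0 : m ≠ 0) (hr : n * Real.log 2 + x ≤ r) :
    Real.log P ≤ r := by
  have h1 := Real.log_le_log hP h
  rw [Real.log_mul (by positivity) (by positivity), Real.log_pow, Real.log_pow] at h1
  have h2 := Real.log_le_sub_one_of_pos hm
  have h3 : (m:ℝ) * Real.log (1 + x / m) ≤ m * (x / m) := by gcongr; linarith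
  rw [mul_div_cancel₀ x (by exact_mod_cast hm0)] at h3
  linarith

theorem gam_C2 {z : ℝ} (hz : 1 ≤ z) : -0.079 + -0.1665 * (z - 1) ≤ Real.log (Gamma z) := by
  have h := lowC 31 (t := 4 / 3) (by norm_num) hz
  have hS : (∑ j ∈ Finset.range (31 + 1), 1 / ((4 / 3 : ℝ) + j)) ≤ 3.624 ∧
      3.623 ≤ (∑ j ∈ Finset.range (31 + 1), 1 / ((4 / 3 : ℝ) + j)) := by
    constructor <;> norm_num [Finset.sum_range_succ]
  have l2 := Real.log_two_gt_d9
  have l2' := Real.log_two_lt_d9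
  have hP : Real.log ((∏ j ∈ Finset.range (31 + 1), ((4 / 3 : ℝ) + j)) / Nat.factorial 31) ≤ 4.75 := by
    refine log_le_aux (x := -0.105) 7 4 ?_ (by norm_num) ?_ (by norm_num) ?_
    · exact div_pos (Finset.prod_pos fun j _ => by positivity) (by positivity)
    · norm_num [Finset.prod_range_succ, Nat.factorial]
    · push_cast; linarith
  have hL : Real.log ((31 + 1 : ℕ) : ℝ) = 5 * Real.log 2 := by
    rw [← Real.log_rpow (by norm_num)]; norm_num
  rw [hL] at h
  set S := (∑ j ∈ Finset.range (31 + 1), 1 / ((4 / 3 : ℝ) + j))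
  nlinarith [mul_nonneg (sub_nonneg.2 hz) (show 0 ≤ 5 * Real.log 2 - S - (-0.1665) by linarith [hS.1])]

theorem gam_C1 {z : ℝ} (hz : 1 ≤ z) : -0.19 + 0.05 * (z - 1) ≤ Real.log (Gamma z) := by
  have h := lowC 15 (t := 8 / 5) (by norm_num) hz
  have hS : (∑ j ∈ Finset.range (15 + 1), 1 / ((8 / 5 : ℝ) + j)) ≤ 2.7132 ∧
      2.713 ≤ (∑ j ∈ Finset.range (15 + 1), 1 / ((8 / 5 : ℝ) + j)) := by
    constructor <;> norm_num [Finset.sum_range_succ]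
  have l2 := Real.log_two_gt_d9
  have l2' := Real.log_two_lt_d9
  have hP : Real.log ((∏ j ∈ Finset.range (15 + 1), ((8 / 5 : ℝ) + j)) / Nat.factorial 15) ≤ 4.586 := by
    refine log_le_aux (x := -0.267) 7 16 ?_ (by norm_num) ?_ (by norm_num) ?_
    · exact div_pos (Finset.prod_pos fun j _ => by positivity) (by positivity)
    · norm_num [Finset.prod_range_succ, Nat.factorial]
    · push_cast; linarith
  have hL : Real.log ((15 + 1 : ℕ) : ℝ) = 4 * Real.log 2 := by
    rw [← Real.log_rpow (by norm_num)]; norm_num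
  rw [hL] at h
  set S := (∑ j ∈ Finset.range (15 + 1), 1 / ((8 / 5 : ℝ) + j))
  nlinarith [mul_nonneg (sub_nonneg.2 hz) (show 0 ≤ 4 * Real.log 2 - S - (0.05) by linarith [hS.1])]

theorem gam_R2 {z : ℝ} (hz : 1 / 2 ≤ z) : 0.31 + -0.85 * (z - 1 / 2) ≤ Real.log (Gamma z) := by
  have h := lowR 16 (by norm_num) (t := 9 / 10) (by norm_num) (by linarith)
  have hS : (∑ j ∈ Finset.range (16 + 1), 1 / ((9 / 10 : ℝ) + j)) ≤ 3.612 ∧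
      3.611 ≤ (∑ j ∈ Finset.range (16 + 1), 1 / ((9 / 10 : ℝ) + j)) := by
    constructor <;> norm_num [Finset.sum_range_succ]
  have l2 := Real.log_two_gt_d9
  have l2' := Real.log_two_lt_d9
  have hP : Real.log ((∏ j ∈ Finset.range (16 + 1), ((9 / 10 : ℝ) + j)) / Nat.factorial 16) ≤ 2.5 := by
    refine log_le_aux (x := 0.415) 3 16 ?_ (by norm_num) ?_ (by norm_num) ?_
    · exact div_pos (Finset.prod_pos fun j _ => by positivity) (by positivity)
    · norm_num [Finset.prod_range_succ, Nat.factorial]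
    · push_cast; linarith
  have hL : Real.log ((16 : ℕ) : ℝ) = 4 * Real.log 2 := by
    rw [← Real.log_rpow (by norm_num)]; norm_num
  rw [hL] at h
  set S := (∑ j ∈ Finset.range (16 + 1), 1 / ((9 / 10 : ℝ) + j))
  nlinarith [mul_nonneg (sub_nonneg.2 hz) (show 0 ≤ 4 * Real.log 2 - S - (-0.85) by linarith [hS.1])]

theorem gam_R1 {z : ℝ} (hz : 1 / 2 ≤ z) : 0.255 + -0.64 * (z - 1 / 2) ≤ Real.log (Gamma z) := by
  have h := lowR 32 (by norm_num) (t := 1) (by norm_num) (by linarith)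
  have hS : (∑ j ∈ Finset.range (32 + 1), 1 / ((1 : ℝ) + j)) ≤ 4.089 ∧
      4.088 ≤ (∑ j ∈ Finset.range (32 + 1), 1 / ((1 : ℝ) + j)) := by
    constructor <;> norm_num [Finset.sum_range_succ]
  have l2 := Real.log_two_gt_d9
  have l2' := Real.log_two_lt_d9
  have hP : Real.log ((∏ j ∈ Finset.range (32 + 1), ((1 : ℝ) + j)) / Nat.factorial 32) ≤ 3.51 := by
    refine log_le_aux (x := 0.04) 5 1 ?_ (by norm_num) ?_ (by norm_num) ?_
    · exact div_pos (Finset.prod_pos fun j _ => by positivity) (by positivity)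
    · norm_num [Finset.prod_range_succ, Nat.factorial]
    · push_cast; linarith
  have hL : Real.log ((32 : ℕ) : ℝ) = 5 * Real.log 2 := by
    rw [← Real.log_rpow (by norm_num)]; norm_num
  rw [hL] at h
  set S := (∑ j ∈ Finset.range (32 + 1), 1 / ((1 : ℝ) + j))
  nlinarith [mul_nonneg (sub_nonneg.2 hz) (show 0 ≤ 5 * Real.log 2 - S - (-0.64) by linarith [hS.1])]


theorem gam_Q {z : ℝ} (hz : 0 < z) :
    Real.log (Gamma (z + 1 / 5)) - Real.log (Gamma z) ≤ -0.0825 + 0.2882 * (z - 1) := by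
  have h1 := wendel (w := z + (31 : ℕ)) (a := 1 / 5) (by positivity) (by norm_num) (by norm_num)
  rw [lg_add_nat hz, show z + ((31:ℕ):ℝ) + 1 / 5 = (z + 1 / 5) + ((31:ℕ):ℝ) by ring, lg_add_nat (by positivity)] at h1
  have h2 : ∑ j ∈ Finset.range 31, Real.log (z + j) - ∑ j ∈ Finset.range 31, Real.log (z + 1 / 5 + j) ≤
      Real.log (∏ j ∈ Finset.range 31, ((1 + j) / (1 + 1 / 5 + j) : ℝ)) + (z - 1) * ∑ j ∈ Finset.range 31, (1 / 5 / ((1 + j) * (1 + 1 / 5 + j)) : ℝ) := by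
    rw [Real.log_prod (fun j _ => by positivity), Finset.mul_sum, ← Finset.sum_add_distrib, ← Finset.sum_sub_distrib]
    apply Finset.sum_le_sum
    intro j _
    have hj : (0:ℝ) ≤ j := by positivity
    have := Real.log_le_sub_one_of_pos (show 0 < (z + j) * (1 + 1 / 5 + j) / ((z + 1 / 5 + j) * (1 + j)) by positivity)
    rw [Real.log_div (by positivity) (by positivity), Real.log_mul (by positivity) (by positivity), Real.log_mul (by positivity) (by positivity)] at this
    rw [Real.log_div (by positivity) (by positivity)]
    have h3 : (z + j) * (1 + 1 / 5 + j) / ((z + 1 / 5 + j) * (1 + j)) - 1 ≤ (z - 1) * (1 / 5 / ((1 + j) * (1 + 1 / 5 + j))) := by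
      have e : (z - 1) * (1 / 5 / ((1 + j) * (1 + 1 / 5 + j))) - ((z + j) * (1 + 1 / 5 + j) / ((z + 1 / 5 + j) * (1 + j)) - 1) =
        1 / 5 * (z - 1) ^ 2 / ((1 + j) * (1 + 1 / 5 + j) * (z + 1 / 5 + j)) := by
        have : (1 + (j:ℝ)) ≠ 0 := by positivity
        have : (1 + 1 / 5 + (j:ℝ)) ≠ 0 := by positivity
        have : (z + 1 / 5 + (j:ℝ)) ≠ 0 := by positivity
        field_simp
        ring
      have : 0 ≤ 1 / 5 * (z - 1) ^ 2 / ((1 + j) * (1 + 1 / 5 + j) * (z + 1 / 5 + j)) := by positivity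
      linarith
    linarith
  have h4 := log_tangent (x := 32) (y := z + (31:ℕ)) (by norm_num) (by positivity)
  have h5 : Real.log 32 = 5 * Real.log 2 := by
    rw [← Real.log_rpow (by norm_num)]; norm_num
  have h6 : Real.log (∏ j ∈ Finset.range 31, ((1 + j) / (1 + 1 / 5 + j) : ℝ)) + Real.log 2 ≤ -0.0827 := by
    rw [← Real.log_mul (Finset.prod_ne_zero_iff.2 fun j _ => by positivity) (by norm_num)]
    refine log_le_aux (x := -0.0827) 0 50 ?_ (by norm_num) ?_ (by norm_num) (by norm_num)
    · exact mul_pos (Finset.prod_pos fun j _ => by positivity) (by norm_num)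
    · norm_num [Finset.prod_range_succ]
  have h7 : ∑ j ∈ Finset.range 31, (1 / 5 / ((1 + j) * (1 + 1 / 5 + j)) : ℝ) + 1 / 5 / 32 ≤ 0.2882 ∧ 
      0.288 ≤ ∑ j ∈ Finset.range 31, (1 / 5 / ((1 + j) * (1 + 1 / 5 + j)) : ℝ) + 1 / 5 / 32 := by
    constructor <;> norm_num [Finset.sum_range_succ]
  set S := ∑ j ∈ Finset.range 31, (1 / 5 / ((1 + j) * (1 + 1 / 5 + j)) : ℝ)
  set P := Real.log (∏ j ∈ Finset.range 31, ((1 + j) / (1 + 1 / 5 + j) : ℝ))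
  push_cast at h1 h4
  have h8 : (z - 1) * (S + 1 / 5 / 32) ≤ 0.0002 + 0.2882 * (z - 1) := by
    rcases le_total 1 z with h | h
    · nlinarith [h7.1]
    · nlinarith [h7.2]
  nlinarith

end RegR

open MeasureTheory Real
open scoped ENNReal

namespace RegR

theorem Me_one (z : ℝ) : Me 1 z = 1 / 2 * Gamma (z / 2) := by
  unfold Me; simp

theorem Me_two (z : ℝ) : Me 2 z = (2:ℝ) ^ (-z) * Gamma z := by
  unfold Me; norm_num

theorem log_Me_one {z : ℝ} (hz : 0 < z) : Real.log (Me 1 z) = Real.log (Gamma (z / 2)) - Real.log 2 := by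
  have := Real.Gamma_pos_of_pos (show 0 < z / 2 by positivity)
  rw [Me_one, Real.log_mul (by norm_num) this.ne']; simp; ring

theorem log_Me_two {z : ℝ} (hz : 0 < z) : Real.log (Me 2 z) = Real.log (Gamma z) - z * Real.log 2 := by
  have := Real.Gamma_pos_of_pos hz
  rw [Me_two, Real.log_mul (by positivity) this.ne', Real.log_rpow (by norm_num)]; ring

theorem ratio_four {e : ℕ} (he : e = 1 ∨ e = 2) {z : ℝ} (hz : 1 ≤ z) :
    Me e (z + 1) * Me e (z - 1 / 2) ^ 2 ≤ 4 * Me e z ^ 3 := by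
  have h0 : 0 < e := by omega
  have p1 := Me_pos h0 (show 0 < z + 1 by linarith)
  have p2 := Me_pos h0 (show 0 < z - 1 / 2 by linarith)
  have p3 := Me_pos h0 (show 0 < z by linarith)
  rw [← Real.log_le_log_iff (by positivity) (by positivity), Real.log_mul (by positivity) (by positivity),
    Real.log_mul (by positivity) (by positivity), Real.log_pow, Real.log_pow]
  have l4 : Real.log 4 = 2 * Real.log 2 := by rw [← Real.log_rpow (by norm_num)]; norm_num
  rw [l4]
  push_cast
  rcases he with rfl | rfl
  · rw [log_Me_one (by linarith), log_Me_one (by linarith), log_Me_one (by linarith)]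
    obtain ⟨w, hw⟩ : ∃ w, w = z / 2 := ⟨_, rfl⟩
    have hw2 : 1 / 2 ≤ w := by linarith
    rw [show (z + 1) / 2 = w + 1 / 2 by rw [hw]; ring, show (z - 1 / 2) / 2 = w - 1 / 4 by rw [hw]; ring, ← hw]
    have a1 := wendel (w := w) (a := 1 / 2) (by linarith) (by norm_num) (by norm_num)
    have a2 := wendel (w := w) (a := 3 / 4) (by linarith) (by norm_num) (by norm_num)
    have a3 := lg_add_one (x := w - 1 / 4) (by linarith)
    rw [show w - 1 / 4 + 1 = w + 3 / 4 by ring] at a3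
    have a4 : Real.log w ≤ Real.log 2 + Real.log (w - 1 / 4) := by
      rw [← Real.log_mul (by norm_num) (by linarith)]
      apply Real.log_le_log <;> linarith
    linarith
  · rw [log_Me_two (by linarith), log_Me_two (by linarith), log_Me_two (by linarith)]
    have a1 := wendel (w := z) (a := 1 / 2) (by linarith) (by norm_num) (by norm_num)
    have a2 := lg_add_one (x := z) (by linarith)
    have a3 := lg_add_one (x := z - 1 / 2) (by linarith)
    rw [show z - 1 / 2 + 1 = z + 1 / 2 by ring] at a3
    have a4 : Real.log z ≤ Real.log 2 + Real.log (z - 1 / 2) := by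
      rw [← Real.log_mul (by norm_num) (by linarith)]
      apply Real.log_le_log <;> linarith
    linarith

theorem lg_supermod {x b c : ℝ} (hx : 0 < x) (hb : 0 < b) (hc : 0 < c) :
    Real.log (Gamma (x + b)) + Real.log (Gamma (x + c)) ≤ Real.log (Gamma x) + Real.log (Gamma (x + c + b)) := by
  have h1 := lg_convex hx (show 0 < x + c + b by linarith) (a := c / (b + c)) (b := b / (b + c)) (by positivity) (by positivity) (by field_simp; ring)
  have h2 := lg_convex hx (show 0 < x + c + b by linarith) (a := b / (b + c)) (b := c / (b + c)) (by positivity) (by positivity) (by field_simp)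
  rw [show c / (b + c) * x + b / (b + c) * (x + c + b) = x + b by field_simp; ring] at h1
  rw [show b / (b + c) * x + c / (b + c) * (x + c + b) = x + c by field_simp; ring] at h2
  have h3 : c / (b + c) = 1 - b / (b + c) := by field_simp; ring
  rw [h3] at h1 h2
  linarith

theorem lg_dup {z : ℝ} (hz : 0 < z) : Real.log (Gamma (z / 2)) + Real.log (Gamma (z / 2 + 1 / 2)) =
    Real.log (Gamma z) + (1 - z) * Real.log 2 + Real.log (√π) := by
  have h := Real.Gamma_mul_Gamma_add_half (z / 2)
  rw [show 2 * (z / 2) = z by ring] at h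
  have p1 := Real.Gamma_pos_of_pos (show 0 < z / 2 by linarith)
  have p2 := Real.Gamma_pos_of_pos (show 0 < z / 2 + 1 / 2 by linarith)
  have p3 := Real.Gamma_pos_of_pos hz
  have hpi := Real.pi_pos
  rw [← Real.log_mul p1.ne' p2.ne', h, Real.log_mul (by positivity) (by positivity), Real.log_mul (by positivity) (by positivity),
    Real.log_rpow (by norm_num)]

theorem ratio_up {e : ℕ} (he : e = 1 ∨ e = 2) {z a : ℝ} (hz : 0 < z) (ha : 0 < a) :
    Me e (z + a) ≤ rexp (e / 2 * (Real.log (Gamma (z + a)) - Real.log (Gamma z) - a * Real.log 2)) * Me e z := by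
  have h0 : 0 < e := by omega
  have p1 := Me_pos h0 (show 0 < z + a by linarith)
  have p3 := Me_pos h0 hz
  rw [← Real.log_le_log_iff (by positivity) (by positivity), Real.log_mul (by positivity) (by positivity), Real.log_exp]
  rcases he with rfl | rfl
  · rw [log_Me_one (by linarith), log_Me_one (by linarith)]
    have h1 := lg_dup hz
    have h2 := lg_dup (show 0 < z + a by linarith)
    have h3 := lg_supermod (x := z / 2) (b := a / 2) (c := 1 / 2) (by positivity) (by positivity) (by norm_num)
    rw [show (z + a) / 2 = z / 2 + a / 2 by ring, show z / 2 + a / 2 + 1 / 2 = z / 2 + 1 / 2 + a / 2 by ring] at h2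
    rw [show (z + a) / 2 = z / 2 + a / 2 by ring]
    push_cast
    linarith
  · rw [log_Me_two (by linarith), log_Me_two (by linarith)]
    push_cast
    linarith

/-- product of moments -/
noncomputable def MM (l : List ℕ) (z : ℝ) : ℝ := (l.map (fun e => Me e z)).prod

def Ok (l : List ℕ) : Prop := ∀ e ∈ l, e = 1 ∨ e = 2

theorem Ok.cons {e : ℕ} {l : List ℕ} (h : Ok (e :: l)) : (e = 1 ∨ e = 2) ∧ Ok l :=
  ⟨h e (by simp), fun x hx => h x (by simp [hx])⟩

theorem MM_pos {l : List ℕ} (hl : Ok l) {z : ℝ} (hz : 0 < z) : 0 < MM l z := by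
  induction l with
  | nil => simp [MM]
  | cons e l ih =>
    have := ih hl.cons.2
    have h2 := Me_pos (e := e) (by have := hl.cons.1; omega) hz
    rw [MM, List.map_cons, List.prod_cons]
    exact mul_pos h2 this

theorem MM_cons (e : ℕ) (l : List ℕ) (z : ℝ) : MM (e :: l) z = Me e z * MM l z := by
  rw [MM, List.map_cons, List.prod_cons]; rfl

theorem mom_eq {l : List ℕ} (hl : Ok l) (A η : ℝ) {z : ℝ} (hz : 0 < z) :
    (mom (Tl l (win A η)) z).toReal = MM l z * (mom (win A η) z).toReal := by
  rw [mom_Tl l (measurable_win A η), ENNReal.toReal_mul]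
  congr 1
  induction l with
  | nil => simp [MM]
  | cons e l ih =>
    rw [MM_cons, List.map_cons, List.prod_cons, ENNReal.toReal_mul, ih hl.cons.2,
      mom_fe (by have := hl.cons.1; omega) hz,
      ENNReal.toReal_ofReal (Me_pos (by have := hl.cons.1; omega) hz).le]

theorem MM_four {l : List ℕ} (hl : Ok l) {z : ℝ} (hz : 1 ≤ z) :
    MM l (z + 1) * MM l (z - 1 / 2) ^ 2 ≤ 4 ^ l.sum * MM l z ^ 3 := by
  induction l with
  | nil => simp [MM]
  | cons e l ih =>
    have h1 := ratio_four hl.cons.1 hz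
    have h2 := ih hl.cons.2
    have he := hl.cons.1
    rw [MM_cons, MM_cons, MM_cons, List.sum_cons, pow_add]
    have q1 := MM_pos hl.cons.2 (show 0 < z + 1 by linarith)
    have q2 := MM_pos hl.cons.2 (show 0 < z - 1 / 2 by linarith)
    have q3 := MM_pos hl.cons.2 (show 0 < z by linarith)
    have q4 := Me_pos (e := e) (by omega) (show 0 < z by linarith)
    have h4 : (4:ℝ) ≤ 4 ^ e := by
      calc (4:ℝ) = 4 ^ 1 := by norm_num
        _ ≤ _ := pow_le_pow_right₀ (by norm_num) (by omega)
    calc _ = (Me e (z + 1) * Me e (z - 1 / 2) ^ 2) * (MM l (z + 1) * MM l (z - 1 / 2) ^ 2) := by ring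
      _ ≤ (4 ^ e * Me e z ^ 3) * (4 ^ l.sum * MM l z ^ 3) := by
        apply mul_le_mul _ h2 (by positivity) (by positivity)
        refine h1.trans ?_
        gcongr
      _ = _ := by ring

theorem MM_low {l : List ℕ} (hl : Ok l) {z p q : ℝ} (hz : 0 < z)
    (h : ∀ e : ℕ, (e = 1 ∨ e = 2) → rexp (e / 2 * p) ≤ Me e z * rexp (e / 2 * q)) :
    rexp ((l.sum : ℕ) / 2 * p) ≤ MM l z * rexp ((l.sum : ℕ) / 2 * q) := by
  induction l with
  | nil => simp [MM]
  | cons e l ih =>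
    have h1 := h e hl.cons.1
    have h2 := ih hl.cons.2
    rw [MM_cons, List.sum_cons, Nat.cast_add]
    rw [add_div, add_mul, add_mul, Real.exp_add, Real.exp_add]
    have q4 := Me_pos (e := e) (by have := hl.cons.1; omega) hz
    calc _ ≤ (Me e z * rexp (e / 2 * q)) * (MM l z * rexp ((l.sum : ℕ) / 2 * q)) := by gcongr
      _ = _ := by ring

theorem MM_up {l : List ℕ} (hl : Ok l) {z a : ℝ} (hz : 0 < z) (ha : 0 < a) :
    MM l (z + a) ≤ rexp ((l.sum : ℕ) / 2 * (Real.log (Gamma (z + a)) - Real.log (Gamma z) - a * Real.log 2)) * MM l z := by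
  induction l with
  | nil => simp [MM]
  | cons e l ih =>
    have h1 := ratio_up hl.cons.1 hz ha
    have h2 := ih hl.cons.2
    rw [MM_cons, MM_cons, List.sum_cons, Nat.cast_add]
    rw [add_div, add_mul, Real.exp_add]
    have q4 := Me_pos (e := e) (by have := hl.cons.1; omega) (show 0 < z by linarith)
    have q5 := MM_pos hl.cons.2 (show 0 < z + a by linarith)
    calc _ ≤ _ := mul_le_mul h1 h2 q5.le (by positivity)
      _ = _ := by ring

theorem Ok.pos {l : List ℕ} (hl : Ok l) : ∀ e ∈ l, 0 < e := fun e he => by have := hl e he; omega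

set_option maxHeartbeats 2000000 in
theorem value {l : List ℕ} (hl : Ok l) (hne : l ≠ []) {A κ C η α β δ : ℝ} (hη : 0 < η) (hδ : 0 < δ)
    (hA : A = (l.sum : ℕ) / 2 * (κ - Real.log 2) + C)
    (hstar : (Tl l (win A η) δ) ≤ ENNReal.ofReal (rexp (-δ)) * Tl l (win A η) 0)
    (hlow : ∀ z, 1 ≤ z → ∀ e : ℕ, (e = 1 ∨ e = 2) →
      rexp (e / 2 * (α + β * (z - 1))) ≤ Me e z * rexp (e / 2 * (-(z * (κ - Real.log 2)))))
    (hC : C + η + δ ≤ (l.sum : ℕ) / 2 * β) :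
    η * rexp ((l.sum : ℕ) / 2 * α - (C + η + δ)) ≤ 2 * (4.2 + η + 1.4 * (l.sum : ℕ)) * (Tl l (win A η) 0).toReal := by
  set T := Tl l (win A η) with hTdef
  set n : ℝ := ((l.sum : ℕ) : ℝ) with hn
  have hn0 : 0 ≤ n := by positivity
  have hTm : Measurable T := measurable_Tl l (measurable_win A η)
  have hT : Antitone T := Tl_anti hne _
  have hLC : LC T := LC_Tl l (measurable_win A η) (LC_win A η)
  have hpos : ∀ u, 0 < T u := Tl_pos l hne hη
  have hfin : ∀ u, T u ≠ ⊤ := Tl_ne_top hne hl.pos hη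
  have hmf : ∀ z, 0 < z → mom T z ≠ ⊤ := fun z hz => mom_Tl_ne_top hl.pos hη hz
  have t0 : 0 < (T 0).toReal := ENNReal.toReal_pos (hpos 0).ne' (hfin 0)
  have tδ : 0 < (T δ).toReal := ENNReal.toReal_pos (hpos δ).ne' (hfin δ)
  have hs' : (T δ).toReal ≤ rexp (-δ) * (T 0).toReal := by
    have := ENNReal.toReal_mono (ENNReal.mul_ne_top ENNReal.ofReal_ne_top (hfin 0)) hstar
    rwa [ENNReal.toReal_mul, ENNReal.toReal_ofReal (by positivity)] at this
  obtain ⟨z, hzdef⟩ : ∃ z, z = -Real.log ((T δ).toReal / (T 0).toReal) / δ := ⟨_, rfl⟩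
  have hzδ : -(z * δ) = Real.log ((T δ).toReal / (T 0).toReal) := by rw [hzdef]; field_simp
  have hzT : (T δ).toReal = rexp (-(z * δ)) * (T 0).toReal := by
    rw [hzδ, Real.exp_log (by positivity)]; field_simp
  have hz : 1 ≤ z := by
    have h1 : Real.log ((T δ).toReal / (T 0).toReal) ≤ -δ := by
      rw [Real.log_le_iff_le_exp (by positivity), div_le_iff₀ t0]; exact hs'
    rw [hzdef, le_div_iff₀ hδ]; linarith
  have hz0 : 0 < z := by linarith
  obtain ⟨m0, hm0⟩ : ∃ m, m = (mom T z).toReal := ⟨_, rfl⟩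
  obtain ⟨m1, hm1⟩ : ∃ m, m = (mom T (z + 1)).toReal := ⟨_, rfl⟩
  obtain ⟨m2, hm2⟩ : ∃ m, m = (mom T (z - 1 / 2)).toReal := ⟨_, rfl⟩
  obtain ⟨w0, hw0⟩ : ∃ m, m = (mom (win A η) z).toReal := ⟨_, rfl⟩
  obtain ⟨w1, hw1⟩ : ∃ m, m = (mom (win A η) (z + 1)).toReal := ⟨_, rfl⟩
  obtain ⟨w2, hw2⟩ : ∃ m, m = (mom (win A η) (z - 1 / 2)).toReal := ⟨_, rfl⟩
  have e0 : m0 = MM l z * w0 := by rw [hm0, hw0]; exact mom_eq hl A η hz0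
  have e1 : m1 = MM l (z + 1) * w1 := by rw [hm1, hw1]; exact mom_eq hl A η (by linarith)
  have e2 : m2 = MM l (z - 1 / 2) * w2 := by rw [hm2, hw2]; exact mom_eq hl A η (by linarith)
  have wfin : ∀ z, 0 ≤ z → mom (win A η) z ≠ ⊤ := fun z hz => ne_top_of_le_ne_top ENNReal.ofReal_ne_top (mom_win_le A η hz)
  have wge : ∀ z, 0 ≤ z → η * rexp (-(A + η) * z) ≤ (mom (win A η) z).toReal := by
    intro z hz
    have := ENNReal.toReal_mono (wfin z hz) (mom_win_ge A η hz)
    rwa [ENNReal.toReal_ofReal (by positivity)] at this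
  have w0p : 0 < w0 := by rw [hw0]; exact lt_of_lt_of_le (by positivity) (wge z hz0.le)
  have w1p : 0 < w1 := by rw [hw1]; exact lt_of_lt_of_le (by positivity) (wge (z + 1) (by linarith))
  have w2p : 0 < w2 := by rw [hw2]; exact lt_of_lt_of_le (by positivity) (wge (z - 1 / 2) (by linarith))
  have q0 := MM_pos hl hz0
  have q1 := MM_pos hl (show 0 < z + 1 by linarith)
  have q2 := MM_pos hl (show 0 < z - 1 / 2 by linarith)
  have p0 : 0 < m0 := by rw [e0]; positivity
  have p1 : 0 < m1 := by rw [e1]; positivity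
  have p2 : 0 < m2 := by rw [e2]; positivity
  have r1 : w1 ≤ rexp (-A) * w0 := by
    have := ENNReal.toReal_mono (ENNReal.mul_ne_top ENNReal.ofReal_ne_top (wfin z hz0.le)) (mom_win_add A η z (a := 1) zero_le_one)
    rwa [ENNReal.toReal_mul, ENNReal.toReal_ofReal (by positivity), mul_one, ← hw0, ← hw1] at this
  have r2 : w2 ≤ rexp ((A + η) * (1 / 2)) * w0 := by
    have := ENNReal.toReal_mono (ENNReal.mul_ne_top ENNReal.ofReal_ne_top (wfin z hz0.le)) (mom_win_sub A η z (a := 1 / 2) (by norm_num))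
    rwa [ENNReal.toReal_mul, ENNReal.toReal_ofReal (by positivity), ← hw0, ← hw2] at this
  have hw : w1 * w2 ^ 2 ≤ rexp η * w0 ^ 3 := by
    calc _ ≤ (rexp (-A) * w0) * (rexp ((A + η) * (1 / 2)) * w0) ^ 2 := by gcongr
      _ = (rexp (-A) * rexp ((A + η) * (1 / 2)) ^ 2) * w0 ^ 3 := by ring
      _ = _ := by rw [← Real.exp_nat_mul, ← Real.exp_add]; congr 2; push_cast; ring
  have hm : m1 * m2 ^ 2 ≤ 4 ^ l.sum * rexp η * m0 ^ 3 := by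
    rw [e0, e1, e2]
    calc _ = (MM l (z + 1) * MM l (z - 1 / 2) ^ 2) * (w1 * w2 ^ 2) := by ring
      _ ≤ (4 ^ l.sum * MM l z ^ 3) * (rexp η * w0 ^ 3) := mul_le_mul (MM_four hl hz) hw (by positivity) (by positivity)
      _ = _ := by ring
  have l4 : Real.log 4 = 2 * Real.log 2 := by rw [← Real.log_rpow (by norm_num)]; norm_num
  have l4' : Real.log 4 ≤ 1.4 := by rw [l4]; linarith [Real.log_two_lt_d9]
  have hlog : Real.log m1 + 2 * Real.log m2 ≤ n * Real.log 4 + η + 3 * Real.log m0 := by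
    have := Real.log_le_log (by positivity) hm
    rw [Real.log_mul (by positivity) (by positivity), Real.log_mul (by positivity) (by positivity), Real.log_mul (by positivity) (by positivity),
      Real.log_pow, Real.log_pow, Real.log_pow, Real.log_exp] at this
    rw [← hn] at this
    norm_num at this ⊢
    linarith
  obtain ⟨u₁, hu1⟩ : ∃ u, u = Real.log 4 + Real.log m1 - Real.log m0 := ⟨_, rfl⟩
  obtain ⟨u₂, hu2⟩ : ∃ u, u = 2 * (Real.log m0 - Real.log 4 - Real.log m2) := ⟨_, rfl⟩
  have hpk := peak hTm hT hLC hpos hfin hmf hδ hz hzT (le_max_right u₁ u₂) (by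
    rw [← hm0, ← hm1]
    calc _ ≤ 4 * rexp (-u₁) * m1 := by gcongr; exact le_max_left _ _
      _ = m0 := by
        rw [hu1, show -(Real.log 4 + Real.log m1 - Real.log m0) = Real.log m0 - Real.log 4 - Real.log m1 by ring,
          Real.exp_sub, Real.exp_sub, Real.exp_log p0, Real.exp_log p1, Real.exp_log (by norm_num)]
        field_simp
      _ ≤ _ := le_rfl) (by
    rw [← hm0, ← hm2, hu2, mul_div_cancel_left₀ _ (by norm_num : (2:ℝ) ≠ 0), Real.exp_sub, Real.exp_sub, Real.exp_log p0, Real.exp_log p2, Real.exp_log (by norm_num)]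
    field_simp
    exact le_rfl)
  have hB : max u₁ u₂ - u₂ ≤ 4.2 + η + 1.4 * n := by
    rcases max_choice u₁ u₂ with h | h
    · rw [h, hu1, hu2]
      have : n * Real.log 4 ≤ n * 1.4 := by gcongr
      linarith [Real.log_two_lt_d9]
    · rw [h]; simp; positivity
  rw [← hm0] at hpk
  have hlo := MM_low hl hz0 (hlow z hz)
  rw [← hn] at hlo
  have hwz := wge z hz0.le
  rw [← hw0] at hwz
  have hfinal : η * rexp (n / 2 * α - (C + η + δ)) ≤ rexp (-(z * δ)) * m0 := by
    calc η * rexp (n / 2 * α - (C + η + δ)) ≤ η * rexp (n / 2 * (α + β * (z - 1)) - (C + η + δ) * z) := by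
          refine mul_le_mul_of_nonneg_left (Real.exp_le_exp.2 ?_) hη.le
          nlinarith [mul_nonneg (sub_nonneg.2 hz) (sub_nonneg.2 hC)]
      _ = rexp (-(z * δ)) * ((rexp (n / 2 * (α + β * (z - 1))) * rexp (n / 2 * (z * (κ - Real.log 2)))) * (η * rexp (-(A + η) * z))) := by
          rw [hA]
          have : ∀ a b c d e : ℝ, a * (b * c * (d * e)) = d * (a * b * c * e) := by intros; ring
          rw [this, ← Real.exp_add, ← Real.exp_add, ← Real.exp_add]
          congr 2; ring
      _ ≤ _ := by
          rw [e0]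
          gcongr
          calc _ ≤ (MM l z * rexp (n / 2 * (-(z * (κ - Real.log 2))))) * rexp (n / 2 * (z * (κ - Real.log 2))) := by gcongr
            _ = MM l z := by
              rw [mul_assoc, ← Real.exp_add]; ring_nf; simp
  calc _ ≤ _ := hfinal
    _ ≤ rexp (-(z * δ)) * (2 * (max u₁ u₂ - u₂) * rexp (z * δ) * (T 0).toReal) := by gcongr
    _ = 2 * (max u₁ u₂ - u₂) * (T 0).toReal := by
      have : rexp (-(z * δ)) * rexp (z * δ) = 1 := by rw [← Real.exp_add]; simp
      linear_combination (2 * (max u₁ u₂ - u₂) * (T 0).toReal) * this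
    _ ≤ _ := by gcongr

end RegR

open MeasureTheory Real
open scoped ENNReal

namespace RegR

theorem Lst_const (l : List ℕ) : Lst l.length l.get (fun _ => ()) () = l := by
  induction l with
  | nil => rfl
  | cons a l ih =>
    show (if () = () then _ else _) = _
    rw [if_pos rfl]
    exact congrArg (a :: ·) ih

theorem Tl_int (l : List ℕ) {g : ℝ → ℝ≥0∞} (hg : Measurable g) (p : ℝ) :
    Tl l g p = ∫⁻ x : Fin l.length → ℝ, (∏ i, fe (l.get i) (x i)) * g (p - ∑ i, x i) := by
  have := prod_formula (κ := Unit) l.length l.get (fun _ => ()) (fun _ => g) (fun _ => hg) (fun _ => p)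
  simp only [Finset.univ_unique, Finset.prod_singleton, if_true] at this
  rw [this]
  exact congrArg (fun l => Tl l g p) (Lst_const l).symm

theorem prod_fe {k : ℕ} (e : Fin k → ℕ) (x : Fin k → ℝ) :
    ∏ i, fe (e i) (x i) = ENNReal.ofReal (rexp (-∑ i, e i * rexp (2 * x i / e i))) := by
  unfold fe
  rw [← ENNReal.ofReal_prod_of_nonneg (fun _ _ => by positivity), ← Real.exp_sum, Finset.sum_neg_distrib]

theorem list_sum_get (l : List ℕ) : ∑ i, ((l.get i : ℕ) : ℝ) = ((l.sum : ℕ) : ℝ) := by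
  rw [← Nat.cast_sum]
  congr 1
  rw [← List.sum_ofFn]; simp

theorem star1 {l : List ℕ} (hl : Ok l) (hne : l ≠ []) {h A η : ℝ} (hh : 0 < h)
    (hA : A = (l.sum : ℕ) / 2 * (Real.log 1.01 - Real.log 2)) (u : ℝ) :
    Tl l (win A η) (u + (l.sum : ℕ) * h) ≤
      ENNReal.ofReal (rexp (-(h * ((l.sum : ℕ) * 1.01 + 2.02 * u)))) * Tl l (win A η) u := by
  have hn1 : 0 < l.sum := by
    cases l with
    | nil => exact absurd rfl hne
    | cons e l => have := hl.cons.1; rw [List.sum_cons]; omega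
  obtain ⟨n, hn⟩ : ∃ n : ℝ, n = ((l.sum : ℕ) : ℝ) := ⟨_, rfl⟩
  have hn0 : 0 < n := by rw [hn]; exact_mod_cast hn1
  rw [← hn] at hA ⊢
  rw [Tl_int l (measurable_win A η), Tl_int l (measurable_win A η),
    ← lintegral_const_mul _ (by
      have := measurable_fe
      have := measurable_win A η
      fun_prop)]
  rw [← lintegral_add_right_eq_self _ (fun i => (l.get i : ℝ) * h)]
  apply lintegral_mono
  intro x
  simp only [Pi.add_apply]
  rw [Finset.sum_add_distrib, ← Finset.sum_mul, list_sum_get, ← hn,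
    show u + n * h - (∑ i, x i + n * h) = u - ∑ i, x i by ring, ← mul_assoc]
  by_cases hx : u - ∑ i, x i ∈ Set.Icc (-(A + η)) (-A)
  swap
  · rw [win_notMem hx]; simp
  gcongr
  rw [prod_fe, prod_fe, ← ENNReal.ofReal_mul (by positivity), ← Real.exp_add]
  apply ENNReal.ofReal_le_ofReal
  apply Real.exp_le_exp.2
  have hpos : ∀ i, (0:ℝ) < (l.get i : ℕ) := fun i => by exact_mod_cast hl.pos _ (List.get_mem l i)
  have e1 : ∑ i, (l.get i : ℝ) * rexp (2 * (x i + (l.get i : ℝ) * h) / (l.get i : ℝ)) =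
      rexp (2 * h) * ∑ i, (l.get i : ℝ) * rexp (2 * x i / (l.get i : ℝ)) := by
    rw [Finset.mul_sum]
    refine Finset.sum_congr rfl fun i _ => ?_
    have := (hpos i).ne'
    rw [show 2 * (x i + (l.get i : ℝ) * h) / (l.get i : ℝ) = 2 * h + 2 * x i / (l.get i : ℝ) by field_simp; ring, Real.exp_add]
    ring
  rw [e1]
  obtain ⟨X, hX⟩ : ∃ X, X = ∑ i, (l.get i : ℝ) * rexp (2 * x i / (l.get i : ℝ)) := ⟨_, rfl⟩
  rw [← hX]
  have hc : ∀ t s : ℝ, rexp s * (1 + t - s) ≤ rexp t := by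
    intro t s
    have := Real.add_one_le_exp (t - s)
    calc _ ≤ rexp s * rexp (t - s) := by gcongr; linarith
      _ = _ := by rw [← Real.exp_add]; congr 1; ring
  have hlow : rexp (2 * (u + A) / n) * n ≤ X := by
    have h1 : ∑ i, (l.get i : ℝ) * (rexp (2 * (u + A) / n) * (1 + 2 * x i / (l.get i : ℝ) - 2 * (u + A) / n)) ≤ X := by
      rw [hX]
      gcongr with i
      exact hc _ _
    have h2 : ∑ i, (l.get i : ℝ) * (rexp (2 * (u + A) / n) * (1 + 2 * x i / (l.get i : ℝ) - 2 * (u + A) / n)) =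
        rexp (2 * (u + A) / n) * (n + 2 * ∑ i, x i - 2 * (u + A)) := by
      have h3 : ∀ i, (l.get i : ℝ) * (rexp (2 * (u + A) / n) * (1 + 2 * x i / (l.get i : ℝ) - 2 * (u + A) / n)) =
          rexp (2 * (u + A) / n) * ((l.get i : ℝ) * (1 - 2 * (u + A) / n) + 2 * x i) := by
        intro i
        have := (hpos i).ne'
        generalize rexp (2 * (u + A) / n) = c
        field_simp
        ring
      simp_rw [h3]
      rw [← Finset.mul_sum, Finset.sum_add_distrib, ← Finset.sum_mul, ← Finset.mul_sum, list_sum_get, ← hn]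
      congr 1
      field_simp
      ring
    rw [h2] at h1
    refine le_trans ?_ h1
    gcongr
    have := hx.2
    linarith
  have e2 : rexp (2 * (u + A) / n) = rexp (2 * u / n) * (1.01 / 2) := by
    rw [hA, show 2 * (u + n / 2 * (Real.log 1.01 - Real.log 2)) / n = 2 * u / n + (Real.log 1.01 - Real.log 2) by field_simp,
      Real.exp_add, Real.exp_sub, Real.exp_log (by norm_num), Real.exp_log (by norm_num)]
  rw [e2] at hlow
  have e3 := Real.add_one_le_exp (2 * u / n)
  have e4 : (2 * u + n) * (1.01 / 2) ≤ X := by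
    refine le_trans ?_ hlow
    calc _ = (2 * u / n + 1) * (1.01 / 2) * n := by field_simp
      _ ≤ _ := by gcongr
  have e5 := Real.add_one_le_exp (2 * h)
  have hX0 : 0 ≤ X := by rw [hX]; exact Finset.sum_nonneg fun i _ => by positivity
  nlinarith [mul_le_mul_of_nonneg_right e5 hX0, mul_le_mul_of_nonneg_left e4 hh.le]

theorem hlow1 (z : ℝ) (hz : 1 ≤ z) (e : ℕ) (he : e = 1 ∨ e = 2) :
      rexp (e / 2 * (-0.2 + 0.04 * (z - 1))) ≤ Me e z * rexp (e / 2 * (-(z * (Real.log 1.01 - Real.log 2)))) := by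
  have q := Me_pos (e := e) (by omega) (show 0 < z by linarith)
  have l1 : Real.log 1.01 ≤ 0.01 := by
    have := Real.log_le_sub_one_of_pos (show (0:ℝ) < 1.01 by norm_num); linarith
  rw [← Real.log_le_log_iff (by positivity) (by positivity), Real.log_mul (by positivity) (by positivity), Real.log_exp, Real.log_exp]
  rcases he with rfl | rfl
  · rw [log_Me_one (by linarith)]
    have := gam_R1 (z := z / 2) (by linarith)
    push_cast
    nlinarith [Real.log_two_lt_d9, Real.log_two_gt_d9]
  · rw [log_Me_two (by linarith)]
    have := gam_C1 hz
    push_cast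
    nlinarith

theorem hlow2 (z : ℝ) (hz : 1 ≤ z) (e : ℕ) (he : e = 1 ∨ e = 2) :
      rexp (e / 2 * (0.281 + 0.1935 * (z - 1))) ≤ Me e z * rexp (e / 2 * (-(z * (-0.36 - Real.log 2)))) := by
  have q := Me_pos (e := e) (by omega) (show 0 < z by linarith)
  rw [← Real.log_le_log_iff (by positivity) (by positivity), Real.log_mul (by positivity) (by positivity), Real.log_exp, Real.log_exp]
  rcases he with rfl | rfl
  · rw [log_Me_one (by linarith)]
    have := gam_R2 (z := z / 2) (by linarith)
    push_cast
    nlinarith [Real.log_two_lt_d9, Real.log_two_gt_d9]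
  · rw [log_Me_two (by linarith)]
    have := gam_C2 hz
    push_cast
    nlinarith

theorem sum_pos' {l : List ℕ} (hl : Ok l) (hne : l ≠ []) : 0 < l.sum := by
    cases l with
    | nil => exact absurd rfl hne
    | cons e l => have := hl.cons.1; rw [List.sum_cons]; omega

theorem reg1 {l : List ℕ} (hl : Ok l) (hne : l ≠ []) {h : ℝ} (hh : 0 < h) {e : ℕ} (he : e = 1 ∨ e = 2)
    (hnh : (l.sum : ℕ) * h ≤ 0.01) (hle : l.sum ≤ 300 * e) :
    ∃ A η : ℝ, 0 < η ∧ (∀ u, Tl l (win A η) (u + (l.sum : ℕ) * h) ≤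
      ENNReal.ofReal (rexp (-(h * ((l.sum : ℕ) * 1.01 + 2.02 * u)))) * Tl l (win A η) u) ∧
      η * (((11.5:ℝ) ^ 37)⁻¹ ^ e * 1.15 ^ l.sum) ≤ (Tl l (win A η) 0).toReal := by
  obtain ⟨n, hn⟩ : ∃ n : ℝ, n = ((l.sum : ℕ) : ℝ) := ⟨_, rfl⟩
  have hn1 : 1 ≤ n := by rw [hn]; exact_mod_cast sum_pos' hl hne
  have hA : n / 2 * (Real.log 1.01 - Real.log 2) = (l.sum : ℕ) / 2 * (Real.log 1.01 - Real.log 2) := by rw [hn]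
  refine ⟨n / 2 * (Real.log 1.01 - Real.log 2), 0.01 * n, by linarith, star1 hl hne hh hA, ?_⟩
  have hst := star1 (η := 0.01 * n) hl hne hh hA 0
  rw [zero_add] at hst
  have hv := value hl hne (A := n / 2 * (Real.log 1.01 - Real.log 2)) (κ := Real.log 1.01) (C := 0) (η := 0.01 * n)
    (α := -0.2) (β := 0.04) (δ := (l.sum : ℕ) * h) (by linarith) (by rw [← hn]; positivity)
    (by rw [hn]; ring) (hst.trans (by
      refine mul_le_mul_left (ENNReal.ofReal_le_ofReal (Real.exp_le_exp.2 ?_)) _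
      rw [← hn]; nlinarith [mul_pos (show 0 < n by linarith) hh])) hlow1 (by rw [← hn] at hnh ⊢; linarith)
  rw [← hn] at hv hnh
  set t := (Tl l (win (n / 2 * (Real.log 1.01 - Real.log 2)) (0.01 * n)) 0).toReal with ht
  have ht0 : 0 ≤ t := ENNReal.toReal_nonneg
  have h1 : 0.01 * n * rexp (-0.12 * n) ≤ (8.4 + 2.82 * n) * t := by
    refine le_trans ?_ (hv.trans (le_of_eq (by ring)))
    gcongr
    linarith
  have e12 : rexp 0.12 * 1.15 ≤ 1.2969 := by
    have h := Real.exp_bound' (x := 0.12) (by norm_num) (by norm_num) (n := 3) (by norm_num)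
    norm_num [Finset.sum_range_succ, Nat.factorial] at h
    linarith
  have h2 : (8.4 + 2.82 * n) * 1.2969 ^ l.sum ≤ ((11.5:ℝ) ^ 37) ^ e := by
    have hnn : n ≤ 300 * e := by rw [hn]; exact_mod_cast hle
    calc (8.4 + 2.82 * n) * 1.2969 ^ l.sum ≤ (8.4 + 2.82 * (300 * e)) * 1.2969 ^ (300 * e) := by
          gcongr; norm_num
      _ ≤ _ := by
        have h10 : (1.2969:ℝ) ^ 10 ≤ 13.47 := by norm_num
        have h300 : (1.2969:ℝ) ^ (300 * e) ≤ 13.47 ^ (30 * e) := by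
          rw [show 300 * e = 10 * (30 * e) by ring, pow_mul]
          gcongr
        refine (mul_le_mul_of_nonneg_left h300 (by positivity)).trans ?_
        rcases he with rfl | rfl
        · norm_num
        · norm_num
  have h3 : rexp (-0.12 * n) * (rexp 0.12) ^ l.sum = 1 := by
    rw [← Real.exp_nat_mul, ← Real.exp_add, ← hn]; ring_nf; simp
  have h4 : (0.01 * n) * (1.15 : ℝ) ^ l.sum ≤ ((11.5:ℝ) ^ 37) ^ e * t := by
    calc (0.01 * n) * (1.15 : ℝ) ^ l.sum = (0.01 * n * rexp (-0.12 * n)) * (rexp 0.12 * 1.15) ^ l.sum := by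
          rw [mul_pow]; linear_combination -(0.01 * n) * (1.15 : ℝ) ^ l.sum * h3
      _ ≤ ((8.4 + 2.82 * n) * t) * 1.2969 ^ l.sum := by gcongr
      _ = ((8.4 + 2.82 * n) * 1.2969 ^ l.sum) * t := by ring
      _ ≤ _ := by gcongr
  rw [inv_pow]
  calc _ = (((11.5:ℝ) ^ 37) ^ e)⁻¹ * ((0.01 * n) * (1.15 : ℝ) ^ l.sum) := by ring
    _ ≤ (((11.5:ℝ) ^ 37) ^ e)⁻¹ * (((11.5:ℝ) ^ 37) ^ e * t) := by gcongr
    _ = t := by field_simp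

theorem star2 {l : List ℕ} (hl : Ok l) (hne : l ≠ []) {h A : ℝ} (hh : 0 < h)
    (hA : A = (l.sum : ℕ) / 2 * (-0.36 - Real.log 2) + 28) (hnh : (l.sum : ℕ) * h ≤ 0.01) (hge : 300 ≤ l.sum) (u : ℝ) :
    Tl l (win A 1) (u + (l.sum : ℕ) * h) ≤
      ENNReal.ofReal (rexp (-(h * ((l.sum : ℕ) * 1.01 + 0.4 / 0.2912 * u)))) * Tl l (win A 1) u := by
  obtain ⟨n, hn⟩ : ∃ n : ℝ, n = ((l.sum : ℕ) : ℝ) := ⟨_, rfl⟩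
  have hn1 : 300 ≤ n := by rw [hn]; exact_mod_cast hge
  have hn0 : 0 < n := by linarith
  rw [← hn] at hA hnh ⊢
  set T := Tl l (win A 1) with hTdef
  have hTm : Measurable T := measurable_Tl l (measurable_win A 1)
  have hT : Antitone T := Tl_anti hne _
  have hLC : LC T := LC_Tl l (measurable_win A 1) (LC_win A 1)
  have hpos : ∀ u, 0 < T u := Tl_pos l hne one_pos
  have hfin : ∀ u, T u ≠ ⊤ := Tl_ne_top hne hl.pos one_pos
  have hmf : ∀ z, 0 < z → mom T z ≠ ⊤ := fun z hz => mom_Tl_ne_top hl.pos one_pos hz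
  obtain ⟨ρ, hρ⟩ : ∃ ρ, ρ = 1.01 + 0.4 / 0.2912 * u / n := ⟨_, rfl⟩
  have hδ : 0 < n * h := by positivity
  have e1 : h * (n * 1.01 + 0.4 / 0.2912 * u) = ρ * (n * h) := by rw [hρ]; field_simp
  rw [e1]
  rcases le_or_gt ρ 0 with h0 | h0
  · calc T (u + n * h) ≤ T u := hT (by linarith)
      _ = 1 * T u := by rw [one_mul]
      _ ≤ _ := by
        gcongr
        rw [ENNReal.one_le_ofReal]
        apply Real.one_le_exp
        nlinarith
  obtain ⟨z, hz⟩ : ∃ z, z = ρ + 0.01 := ⟨_, rfl⟩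
  have hz0 : 0 < z := by linarith
  refine R2 hTm hT hLC hpos hfin hmf (z := z) (a := 1 / 5) hδ hz0 (by linarith) (by norm_num) ?_
  rw [mom_eq hl A 1 hz0, mom_eq hl A 1 (by linarith)]
  have wfin : ∀ z, 0 ≤ z → mom (win A 1) z ≠ ⊤ := fun z hz => ne_top_of_le_ne_top ENNReal.ofReal_ne_top (mom_win_le A 1 hz)
  obtain ⟨w0, hw0⟩ : ∃ m, m = (mom (win A 1) z).toReal := ⟨_, rfl⟩
  obtain ⟨w1, hw1⟩ : ∃ m, m = (mom (win A 1) (z + 1 / 5)).toReal := ⟨_, rfl⟩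
  have w0p : 0 < w0 := by
    rw [hw0]
    have := ENNReal.toReal_mono (wfin z hz0.le) (mom_win_ge A 1 hz0.le)
    rw [ENNReal.toReal_ofReal (by positivity)] at this
    exact lt_of_lt_of_le (by positivity) this
  have r1 : w1 ≤ rexp (-A * (1 / 5)) * w0 := by
    have := ENNReal.toReal_mono (ENNReal.mul_ne_top ENNReal.ofReal_ne_top (wfin z hz0.le)) (mom_win_add A 1 z (a := 1 / 5) (by norm_num))
    rwa [ENNReal.toReal_mul, ENNReal.toReal_ofReal (by positivity), ← hw0, ← hw1] at this
  have r2 := MM_up hl hz0 (show (0:ℝ) < 1 / 5 by norm_num)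
  rw [← hn] at r2
  rw [← hw0, ← hw1]
  have q0 := MM_pos hl hz0
  have q1 := MM_pos hl (show 0 < z + 1 / 5 by linarith)
  have w1n : 0 ≤ w1 := by rw [hw1]; exact ENNReal.toReal_nonneg
  have gQ := gam_Q hz0
  obtain ⟨Q, hQ⟩ : ∃ Q, Q = Real.log (Gamma (z + 1 / 5)) - Real.log (Gamma z) := ⟨_, rfl⟩
  rw [← hQ] at gQ r2
  have hu : u / 5 = n / 2 * ((z - 1.02) * 0.2912) := by
    rw [hz, hρ]; field_simp; ring
  have hr : rexp (-(1 / 5) * u) * (MM l (z + 1 / 5) * w1) ≤ rexp (-(0.45 * z) - 5.6) * (MM l z * w0) := by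
    calc rexp (-(1 / 5) * u) * (MM l (z + 1 / 5) * w1) ≤
        rexp (-(1 / 5) * u) * ((rexp (n / 2 * (Q - 1 / 5 * Real.log 2)) * MM l z) * (rexp (-A * (1 / 5)) * w0)) := by gcongr
      _ = rexp (-(1 / 5) * u + n / 2 * (Q - 1 / 5 * Real.log 2) + -A * (1 / 5)) * (MM l z * w0) := by
        rw [Real.exp_add, Real.exp_add]; ring
      _ ≤ _ := by
        refine mul_le_mul_of_nonneg_right (Real.exp_le_exp.2 ?_) (by positivity)
        have : -(1 / 5) * u + n / 2 * (Q - 1 / 5 * Real.log 2) + -A * (1 / 5) = n / 2 * (Q + 0.072 - (z - 1.02) * 0.2912) - 5.6 := by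
          rw [hA]; linear_combination -hu
        rw [this]
        have h1 : n / 2 * (Q + 0.072 - (z - 1.02) * 0.2912) ≤ n / 2 * (-(0.003 * z)) := by
          gcongr; linarith
        nlinarith
  have hnum : rexp (-(0.45 * z) - 5.6) * (1 + rexp (z * (n * h)) * (z + 1 / 5) / (z - ρ)) < 1 := by
    rw [show z - ρ = 0.01 by rw [hz]; ring]
    have a1 : rexp (z * (n * h)) ≤ rexp (0.01 * z) := Real.exp_le_exp.2 (by nlinarith)
    have a2 : 1 ≤ rexp (0.01 * z) := Real.one_le_exp (by linarith)
    have a3 : 250 ≤ rexp 5.6 := by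
      have b1 := Real.exp_one_gt_d9
      have b2 := Real.quadratic_le_exp_of_nonneg (show (0:ℝ) ≤ 0.6 by norm_num)
      calc (250:ℝ) ≤ 2.718 ^ 5 * 1.78 := by norm_num
        _ ≤ (rexp 1) ^ 5 * rexp 0.6 := by
          gcongr
          · linarith
          · linarith
        _ = _ := by rw [← Real.exp_nat_mul, ← Real.exp_add]; norm_num
    have a4 := Real.add_one_le_exp (0.44 * z)
    have a5 : rexp (-(0.45 * z) - 5.6) * (rexp (0.01 * z) * (rexp (0.44 * z) * rexp 5.6)) = 1 := by
      rw [← Real.exp_add, ← Real.exp_add, ← Real.exp_add]; ring_nf; simp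
    calc _ ≤ rexp (-(0.45 * z) - 5.6) * (rexp (0.01 * z) + rexp (0.01 * z) * (z + 1 / 5) / 0.01) := by gcongr
      _ = rexp (-(0.45 * z) - 5.6) * (rexp (0.01 * z) * (21 + 100 * z)) := by ring
      _ < rexp (-(0.45 * z) - 5.6) * (rexp (0.01 * z) * (rexp (0.44 * z) * rexp 5.6)) := by
        gcongr
        calc 21 + 100 * z < (0.44 * z + 1) * 250 := by linarith
          _ ≤ _ := by gcongr
      _ = 1 := a5
  have hf : 0 ≤ 1 + rexp (z * (n * h)) * (z + 1 / 5) / (z - ρ) := by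
    rw [show z - ρ = 0.01 by rw [hz]; ring]; positivity
  calc _ ≤ (rexp (-(0.45 * z) - 5.6) * (MM l z * w0)) * (1 + rexp (z * (n * h)) * (z + 1 / 5) / (z - ρ)) := by gcongr
    _ = (rexp (-(0.45 * z) - 5.6) * (1 + rexp (z * (n * h)) * (z + 1 / 5) / (z - ρ))) * (MM l z * w0) := by ring
    _ < 1 * (MM l z * w0) := by gcongr
    _ = _ := one_mul _

theorem reg2 {l : List ℕ} (hl : Ok l) (hne : l ≠ []) {h : ℝ} (hh : 0 < h) {e : ℕ} (he : e = 1 ∨ e = 2)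
    (hnh : (l.sum : ℕ) * h ≤ 0.01) (hge : 300 ≤ l.sum) :
    ∃ A η : ℝ, 0 < η ∧ (∀ u, Tl l (win A η) (u + (l.sum : ℕ) * h) ≤
      ENNReal.ofReal (rexp (-(h * ((l.sum : ℕ) * 1.01 + 0.4 / 0.2912 * u)))) * Tl l (win A η) u) ∧
      η * (((11.5:ℝ) ^ 37)⁻¹ ^ e * 1.15 ^ l.sum) ≤ (Tl l (win A η) 0).toReal := by
  obtain ⟨n, hn⟩ : ∃ n : ℝ, n = ((l.sum : ℕ) : ℝ) := ⟨_, rfl⟩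
  have hn1 : 300 ≤ n := by rw [hn]; exact_mod_cast hge
  have hA : n / 2 * (-0.36 - Real.log 2) + 28 = (l.sum : ℕ) / 2 * (-0.36 - Real.log 2) + 28 := by rw [hn]
  refine ⟨n / 2 * (-0.36 - Real.log 2) + 28, 1, by linarith, star2 hl hne hh hA hnh hge, ?_⟩
  have hst := star2 hl hne hh hA hnh hge 0
  rw [zero_add] at hst
  have hv := value hl hne (A := n / 2 * (-0.36 - Real.log 2) + 28) (κ := -0.36) (C := 28) (η := 1)
    (α := 0.281) (β := 0.1935) (δ := (l.sum : ℕ) * h) (by linarith) (by rw [← hn]; positivity)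
    hA (hst.trans (by
      refine mul_le_mul_left (ENNReal.ofReal_le_ofReal (Real.exp_le_exp.2 ?_)) _
      rw [← hn]; nlinarith [mul_pos (show 0 < n by linarith) hh])) hlow2 (by rw [← hn] at hnh ⊢; linarith)
  rw [← hn] at hv hnh
  set t := (Tl l (win (n / 2 * (-0.36 - Real.log 2) + 28) 1) 0).toReal with ht
  have ht0 : 0 ≤ t := ENNReal.toReal_nonneg
  have h1 : rexp (0.1405 * n - 29.01) ≤ (10.4 + 2.8 * n) * t := by
    refine le_trans ?_ (hv.trans (le_of_eq (by ring)))
    rw [one_mul]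
    apply Real.exp_le_exp.2
    linarith
  have e1 : (1.15:ℝ) ≤ rexp 0.14 := by
    have := Real.sum_le_exp_of_nonneg (show (0:ℝ) ≤ 0.14 by norm_num) 4
    norm_num [Finset.sum_range_succ, Nat.factorial] at this
    linarith
  have e2 : rexp 29.01 * (10.4 + 2.8 * n) ≤ 11.5 ^ 37 * rexp (0.0005 * n) := by
    have := Real.add_one_le_exp (0.0005 * n)
    have b1 := Real.exp_one_lt_d9
    have b2 : rexp 29.01 ≤ 2.72 ^ 30 := by
      calc rexp 29.01 ≤ rexp ((30:ℕ) * 1) := Real.exp_le_exp.2 (by norm_num)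
        _ = rexp 1 ^ 30 := Real.exp_nat_mul _ _
        _ ≤ _ := by gcongr; linarith
    calc _ ≤ (2.72:ℝ) ^ 30 * (10.4 + 2.8 * n) := by gcongr
      _ ≤ 11.5 ^ 37 * (0.0005 * n + 1) := by norm_num; linarith
      _ ≤ _ := by gcongr
  have h3 : (1.15:ℝ) ^ l.sum ≤ rexp (0.14 * n) := by
    calc _ ≤ rexp 0.14 ^ l.sum := by gcongr
      _ = _ := by rw [← Real.exp_nat_mul, ← hn]; ring_nf
  have h4 : (1.15 : ℝ) ^ l.sum ≤ (11.5:ℝ) ^ 37 * t := by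
    have hp : 0 < rexp 29.01 * (10.4 + 2.8 * n) := by positivity
    refine le_of_mul_le_mul_left ?_ hp
    calc _ ≤ (11.5 ^ 37 * rexp (0.0005 * n)) * rexp (0.14 * n) := by gcongr
      _ = 11.5 ^ 37 * rexp 29.01 * rexp (0.1405 * n - 29.01) := by
        rw [mul_assoc, mul_assoc, ← Real.exp_add, ← Real.exp_add]; congr 2; ring
      _ ≤ 11.5 ^ 37 * rexp 29.01 * ((10.4 + 2.8 * n) * t) := by gcongr
      _ = _ := by ring
  have h5 : (11.5:ℝ) ^ 37 ≤ ((11.5:ℝ) ^ 37) ^ e := by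
    apply le_self_pow₀ _ (by omega)
    norm_num
  rw [inv_pow, one_mul]
  calc _ ≤ (((11.5:ℝ) ^ 37) ^ e)⁻¹ * (((11.5:ℝ) ^ 37) ^ e * t) := by
        gcongr
        exact h4.trans (by gcongr)
    _ = t := by field_simp

end RegR

open MeasureTheory Real
open scoped ENNReal
set_option linter.unusedSectionVars false

namespace RegR

section theta

variable {E : Type*} [NormedAddCommGroup E] [MeasurableSpace E] [BorelSpace E]

theorem unfold_fd {μ : Measure E} [μ.IsAddLeftInvariant] {Λ : AddSubgroup E} [Countable Λ] {F : Set E}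
    (hF : IsAddFundamentalDomain Λ F μ) {f : E → ℝ≥0∞} (hf : Measurable f) :
    ∫⁻ x, f x ∂μ = ∫⁻ x in F, ∑' g : Λ, f (x + g) ∂μ := by
  rw [hF.lintegral_eq_tsum'' f, lintegral_tsum (fun g => by fun_prop)]
  refine tsum_congr fun g => ?_
  refine lintegral_congr fun x => ?_
  rw [add_comm]; rfl

variable [NormedSpace ℝ E] [FiniteDimensional ℝ E]

/-- Gaussian of a quadratic form -/
noncomputable def Gq (q : E → ℝ) (c : ℝ) (x : E) : ℝ≥0∞ := ENNReal.ofReal (rexp (-(c * q x)))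

/-- periodization -/
noncomputable def Pq (Λ : AddSubgroup E) (q : E → ℝ) (c : ℝ) (x : E) : ℝ≥0∞ := ∑' g : Λ, Gq q c (x + g)

structure QF (q : E → ℝ) : Prop where
  cont : Continuous q
  hom : ∀ (t : ℝ) x, q (t • x) = t ^ 2 * q x
  para : ∀ (a b : ℝ) (x z : E), 0 < a → 0 < b →
    a * q x + b * q (z - x) = (a + b) * q (x - (b / (a + b)) • z) + a * b / (a + b) * q z
  pos : ∃ c : ℝ, 0 < c ∧ ∀ x, c * ‖x‖ ^ 2 ≤ q x

variable {q : E → ℝ}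

theorem QF.meas (h : QF q) (c : ℝ) : Measurable (Gq q c) := by
  have := h.cont.measurable
  unfold Gq; fun_prop

theorem QF.neg (h : QF q) (c : ℝ) (x : E) : Gq q c (-x) = Gq q c x := by
  have := h.hom (-1) x
  unfold Gq
  rw [show -x = (-1 : ℝ) • x by simp, this]; simp

theorem Pq_meas (h : QF q) (Λ : AddSubgroup E) [Countable Λ] (c : ℝ) : Measurable (Pq Λ q c) := by
  have := h.meas c
  unfold Pq
  exact Measurable.ennreal_tsum fun g => by fun_prop

theorem Pq_add (Λ : AddSubgroup E) (c : ℝ) (x : E) (g : Λ) : Pq Λ q c (x + g) = Pq Λ q c x := by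
  unfold Pq
  rw [← (Equiv.addLeft g).tsum_eq (fun g' : Λ => Gq q c (x + g'))]
  refine tsum_congr fun g' => ?_
  simp [add_assoc]

theorem Pq_neg (h : QF q) (Λ : AddSubgroup E) (c : ℝ) (x : E) : Pq Λ q c (-x) = Pq Λ q c x := by
  unfold Pq
  rw [← (Equiv.neg Λ).tsum_eq (fun g' : Λ => Gq q c (x + g'))]
  refine tsum_congr fun g' => ?_
  rw [← h.neg c]
  congr 1
  simp [add_comm]

variable (μ : Measure E) [μ.IsAddHaarMeasure]

theorem scale (h : QF q) {c : ℝ} (hc : 0 < c) :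
    ∫⁻ x, Gq q c x ∂μ = ENNReal.ofReal ((√c ^ Module.finrank ℝ E)⁻¹) * ∫⁻ x, Gq q 1 x ∂μ := by
  have h0 : √c ≠ 0 := by positivity
  have h1 : ∀ x, Gq q c x = Gq q 1 (√c • x) := by
    intro x
    unfold Gq
    rw [h.hom, Real.sq_sqrt hc.le, one_mul]
  simp_rw [h1]
  rw [← lintegral_map (h.meas 1) (measurable_const_smul √c), Measure.map_addHaar_smul μ h0, lintegral_smul_measure,
    abs_of_nonneg (by positivity)]
  rfl

theorem base_ne_top (h : QF q) : ∫⁻ x, Gq q 1 x ∂μ ≠ ⊤ := by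
  obtain ⟨c, hc, hq⟩ := h.pos
  obtain ⟨k, hk⟩ : ∃ k : ℝ, k = Module.finrank ℝ E + 1 := ⟨_, rfl⟩
  have hInt := integrable_one_add_norm (μ := μ) (E := E) (r := k) (by rw [hk]; linarith)
  have hfin := hInt.lintegral_lt_top
  have hk0 : 0 ≤ k := by rw [hk]; positivity
  refine ne_top_of_le_ne_top (ENNReal.mul_ne_top (ENNReal.ofReal_ne_top (r := rexp (k ^ 2 / (4 * c)))) hfin.ne) ?_
  rw [← lintegral_const_mul _ (by fun_prop)]
  apply lintegral_mono
  intro x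
  dsimp only
  unfold Gq
  rw [← ENNReal.ofReal_mul (by positivity)]
  apply ENNReal.ofReal_le_ofReal
  have h1 : 0 < 1 + ‖x‖ := by positivity
  rw [Real.rpow_def_of_pos h1, ← Real.exp_add]
  apply Real.exp_le_exp.2
  have h2 : Real.log (1 + ‖x‖) ≤ ‖x‖ := by
    have := Real.log_le_sub_one_of_pos h1; linarith
  have h3 : k * ‖x‖ ≤ c * ‖x‖ ^ 2 + k ^ 2 / (4 * c) := by
    have : c * ‖x‖ ^ 2 + k ^ 2 / (4 * c) - k * ‖x‖ = c * (‖x‖ - k / (2 * c)) ^ 2 := by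
      field_simp; ring
    have h4 : 0 ≤ c * (‖x‖ - k / (2 * c)) ^ 2 := by positivity
    linarith
  have := hq x
  nlinarith [mul_le_mul_of_nonneg_left h2 hk0]

theorem base_ne_zero (h : QF q) : ∫⁻ x, Gq q 1 x ∂μ ≠ 0 := by
  rw [Ne, lintegral_eq_zero_iff (h.meas 1)]
  intro h0
  have : ∀ᵐ x ∂μ, False := by
    filter_upwards [h0] with x hx
    exact (ENNReal.ofReal_pos.2 (Real.exp_pos (-(1 * q x)))).ne' hx
  have h2 : μ Set.univ = 0 := by simpa [ae_iff] using this
  exact (isOpen_univ.measure_pos μ Set.univ_nonempty).ne' h2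

variable (Λ : AddSubgroup E) [Countable Λ]

theorem gauss_conv (h : QF q) {a b : ℝ} (ha : 0 < a) (hb : 0 < b) (z : E) :
    ∫⁻ x, Gq q a x * Gq q b (z - x) ∂μ = (∫⁻ x, Gq q (a + b) x ∂μ) * Gq q (a * b / (a + b)) z := by
  have h1 : ∀ x, Gq q a x * Gq q b (z - x) = Gq q (a + b) (x - (b / (a + b)) • z) * Gq q (a * b / (a + b)) z := by
    intro x
    unfold Gq
    rw [← ENNReal.ofReal_mul (by positivity), ← ENNReal.ofReal_mul (by positivity), ← Real.exp_add, ← Real.exp_add]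
    congr 2
    have := h.para a b x z ha hb
    linarith
  simp_rw [h1]
  have := h.meas (a + b)
  rw [lintegral_mul_const _ (by fun_prop), lintegral_sub_right_eq_self (fun x => Gq q (a + b) x)]

theorem unfold_PP {F : Set E} (hF : IsAddFundamentalDomain Λ F μ) (h : QF q) {a b : ℝ} (ha : 0 < a) (hb : 0 < b) (y z : E) :
    ∫⁻ x in F, Pq Λ q a (x - y) * Pq Λ q b (z - x) ∂μ =
      (∫⁻ x, Gq q (a + b) x ∂μ) * Pq Λ q (a * b / (a + b)) (z - y) := by
  have m1 := h.meas a
  have m2 := Pq_meas h Λ b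
  have m3 := h.meas b
  have h1 : ∫⁻ x, Gq q a (x - y) * Pq Λ q b (z - x) ∂μ = ∫⁻ x in F, Pq Λ q a (x - y) * Pq Λ q b (z - x) ∂μ := by
    rw [unfold_fd hF (by fun_prop)]
    refine lintegral_congr fun x => ?_
    have : ∀ g : Λ, Pq Λ q b (z - (x + g)) = Pq Λ q b (z - x) := by
      intro g
      rw [← Pq_add Λ b (z - (x + g)) g]
      congr 1; abel
    simp_rw [this]
    rw [ENNReal.tsum_mul_right]
    congr 1
    unfold Pq
    refine tsum_congr fun g => ?_
    congr 1; abel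
  rw [← h1]
  rw [← lintegral_add_right_eq_self _ y]
  simp only [add_sub_cancel_right]
  unfold Pq
  simp_rw [← ENNReal.tsum_mul_left]
  rw [lintegral_tsum (fun g => by fun_prop)]
  refine tsum_congr fun g => ?_
  rw [← gauss_conv μ h ha hb]
  refine lintegral_congr fun x => ?_
  congr 2
  abel

theorem gint_ne_zero (h : QF q) {c : ℝ} (hc : 0 < c) : ∫⁻ x, Gq q c x ∂μ ≠ 0 := by
  rw [scale μ h hc]
  refine mul_ne_zero ?_ (base_ne_zero μ h)
  rw [← pos_iff_ne_zero, ENNReal.ofReal_pos]; positivity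

theorem gint_ne_top (h : QF q) {c : ℝ} (hc : 0 < c) : ∫⁻ x, Gq q c x ∂μ ≠ ⊤ := by
  rw [scale μ h hc]
  exact ENNReal.mul_ne_top ENNReal.ofReal_ne_top (base_ne_top μ h)

theorem Pq_le_zero {F : Set E} (hF : IsAddFundamentalDomain Λ F μ) (h : QF q) {c : ℝ} (hc : 0 < c) (z : E) : Pq Λ q c z ≤ Pq Λ q c 0 := by
  have h2 : 0 < 2 * c := by linarith
  have e1 : (2 * c) * (2 * c) / (2 * c + 2 * c) = c := by field_simp; ring
  have u1 := unfold_PP μ Λ hF h h2 h2 0 z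
  have u2 := unfold_PP μ Λ hF h h2 h2 0 0
  have u3 := unfold_PP μ Λ hF h h2 h2 z z
  rw [e1] at u1 u2 u3
  rw [sub_zero] at u1
  rw [sub_self] at u2 u3
  have m := Pq_meas h Λ (2 * c)
  have key : 2 * (∫⁻ x in F, Pq Λ q (2 * c) (x - 0) * Pq Λ q (2 * c) (z - x) ∂μ) ≤
      (∫⁻ x in F, Pq Λ q (2 * c) (x - 0) * Pq Λ q (2 * c) (0 - x) ∂μ) +
      ∫⁻ x in F, Pq Λ q (2 * c) (x - z) * Pq Λ q (2 * c) (z - x) ∂μ := by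
    rw [← lintegral_const_mul _ (by fun_prop), ← lintegral_add_left (by fun_prop)]
    refine lintegral_mono fun x => ?_
    rw [sub_zero, zero_sub, Pq_neg h, show x - z = -(z - x) by abel, Pq_neg h]
    generalize Pq Λ q (2 * c) x = A
    generalize Pq Λ q (2 * c) (z - x) = B
    rcases eq_or_ne A ⊤ with rfl | hA
    · simp
    rcases eq_or_ne B ⊤ with rfl | hB
    · simp
    lift A to NNReal using hA
    lift B to NNReal using hB
    have := two_mul_le_add_sq (A : ℝ) (B : ℝ)
    have h3 : 2 * A * B ≤ A * A + B * B := by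
      rw [← NNReal.coe_le_coe]; push_cast; nlinarith
    rw [← mul_assoc]
    exact ENNReal.coe_le_coe.2 h3
  rw [u1, u2, u3, ← two_mul ((∫⁻ x, Gq q (2 * c + 2 * c) x ∂μ) * Pq Λ q c 0)] at key
  have k2 := (ENNReal.mul_le_mul_iff_right (by norm_num : (2:ℝ≥0∞) ≠ 0) (by norm_num)).1 key
  exact (ENNReal.mul_le_mul_iff_right (gint_ne_zero μ h (by linarith)) (gint_ne_top μ h (by linarith))).1 k2

theorem theta_mono {F : Set E} (hF : IsAddFundamentalDomain Λ F μ) (h : QF q) {c' : ℝ} (hc : 1 < c') :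
    Pq Λ q 1 0 ≤ ENNReal.ofReal (√c' ^ Module.finrank ℝ E) * Pq Λ q c' 0 := by
  obtain ⟨b, hb⟩ : ∃ b, b = c' / (c' - 1) := ⟨_, rfl⟩
  have hc1 : 0 < c' - 1 := by linarith
  have hb0 : 0 < b := by rw [hb]; positivity
  have hc0 : 0 < c' := by linarith
  have hcb : c' + b = b * c' := by rw [hb]; field_simp; ring
  have e1 : c' * b / (c' + b) = 1 := by rw [hcb]; field_simp
  have u1 := unfold_PP μ Λ hF h hc0 hb0 0 0
  rw [e1, sub_self] at u1
  have m := Pq_meas h Λ b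
  have mb := h.meas b
  have h2 : ∫⁻ x in F, Pq Λ q c' (x - 0) * Pq Λ q b (0 - x) ∂μ ≤ Pq Λ q c' 0 * ∫⁻ x, Gq q b x ∂μ := by
    rw [unfold_fd hF mb, ← lintegral_const_mul _ (by exact m)]
    refine lintegral_mono fun x => ?_
    rw [zero_sub, Pq_neg h]
    exact mul_le_mul_left (Pq_le_zero μ Λ hF h hc0 _) _
  rw [u1, hcb, scale μ h (by positivity), scale μ h hb0] at h2
  have k := base_ne_zero μ h
  have k' := base_ne_top μ h
  set I := ∫⁻ x, Gq q 1 x ∂μ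
  set n := Module.finrank ℝ E
  rw [show √(b * c') = √b * √c' from Real.sqrt_mul hb0.le _, mul_pow, mul_inv, ENNReal.ofReal_mul (by positivity)] at h2
  have h3 : (ENNReal.ofReal ((√b ^ n)⁻¹) * I) * (ENNReal.ofReal ((√c' ^ n)⁻¹) * Pq Λ q 1 0) ≤
      (ENNReal.ofReal ((√b ^ n)⁻¹) * I) * Pq Λ q c' 0 := by
    calc _ = _ := by ring
      _ ≤ _ := h2
      _ = _ := by ring
  have h4 := (ENNReal.mul_le_mul_iff_right (mul_ne_zero (by rw [← pos_iff_ne_zero, ENNReal.ofReal_pos]; positivity) k)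
    (ENNReal.mul_ne_top ENNReal.ofReal_ne_top k')).1 h3
  calc Pq Λ q 1 0 = ENNReal.ofReal (√c' ^ n) * (ENNReal.ofReal ((√c' ^ n)⁻¹) * Pq Λ q 1 0) := by
        rw [← mul_assoc, ← ENNReal.ofReal_mul (by positivity), mul_inv_cancel₀ (by positivity)]; simp
    _ ≤ _ := by gcongr

theorem theta_fin {F : Set E} (hF : IsAddFundamentalDomain Λ F μ) (h : QF q) (hb : Bornology.IsBounded F) : Pq Λ q 1 0 ≠ ⊤ := by
  have hF0 : μ F ≠ 0 := hF.measure_ne_zero (by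
    exact (isOpen_univ.measure_pos μ Set.univ_nonempty).ne' |> fun h0 h1 => h0 (by rw [h1]; rfl))
  obtain ⟨B, hB⟩ : ∃ B, ∀ x ∈ F, q x ≤ B := by
    obtain ⟨r, hr⟩ := hb.subset_closedBall 0
    obtain ⟨B, hB⟩ := (isCompact_closedBall (0:E) r).bddAbove_image h.cont.continuousOn
    exact ⟨B, fun x hx => hB ⟨x, hr hx, rfl⟩⟩
  have key : ∀ x ∈ F, Pq Λ q 1 0 ≤ ENNReal.ofReal (rexp B) * Pq Λ q (1 / 2) x := by
    intro x hx
    unfold Pq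
    rw [← ENNReal.tsum_mul_left]
    refine ENNReal.tsum_le_tsum fun g => ?_
    unfold Gq
    rw [← ENNReal.ofReal_mul (by positivity), ← Real.exp_add]
    apply ENNReal.ofReal_le_ofReal
    apply Real.exp_le_exp.2
    have h1 := h.para 1 1 x (x + g) one_pos one_pos
    have h2 := h.para 1 1 (-x) (g : E) one_pos one_pos
    have h3 : q (-x) = q x := by have := h.hom (-1) x; simpa using this
    obtain ⟨c, hc, hp⟩ := h.pos
    have p1 := (mul_nonneg hc.le (sq_nonneg _)).trans (hp (-x - ((1:ℝ) / (1 + 1)) • (g:E)))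
    rw [h3, sub_neg_eq_add] at h2
    rw [add_sub_cancel_left] at h1
    have p2 := (mul_nonneg hc.le (sq_nonneg _)).trans (hp (x - ((1:ℝ) / (1 + 1)) • (x + g : E)))
    have p3 := hB x hx
    have h5 := h.para 1 1 (x + g) x one_pos one_pos
    have h6 := h.hom (-1) (g : E)
    rw [show x - (x + (g:E)) = (-1 : ℝ) • (g : E) by simp, h6] at h5
    have h4 := h.para 1 1 (x + g) (g : E) one_pos one_pos
    rw [show (g : E) - (x + g) = -x by abel, h3] at h4
    have p4 := (mul_nonneg hc.le (sq_nonneg _)).trans (hp (x + g - ((1:ℝ) / (1 + 1)) • (g : E)))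
    rw [zero_add]
    linarith
  have h1 : Pq Λ q 1 0 * μ F ≤ ENNReal.ofReal (rexp B) * ∫⁻ x, Gq q (1 / 2) x ∂μ := by
    have m := h.meas (1 / 2)
    have m' := Pq_meas h Λ (1 / 2)
    rw [unfold_fd hF m, ← setLIntegral_const, ← lintegral_const_mul _ (by exact m')]
    exact setLIntegral_mono_ae (by exact (m'.const_mul _).aemeasurable) (Filter.Eventually.of_forall fun x hx => key x hx)
  intro htop
  rw [htop, ENNReal.top_mul hF0] at h1
  exact (ENNReal.mul_ne_top ENNReal.ofReal_ne_top (gint_ne_top μ h (by norm_num))) (top_le_iff.1 h1)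

end theta

end RegR

open MeasureTheory Real
open scoped ENNReal
set_option linter.unusedSectionVars false

namespace RegR

section thetaL

open NumberField NumberField.mixedEmbedding
open scoped Classical

theorem para_inner {H : Type*} [NormedAddCommGroup H] [InnerProductSpace ℝ H] (a b : ℝ) (x z : H)
    (ha : 0 < a) (hb : 0 < b) :
    a * ‖x‖ ^ 2 + b * ‖z - x‖ ^ 2 =
      (a + b) * ‖x - (b / (a + b)) • z‖ ^ 2 + a * b / (a + b) * ‖z‖ ^ 2 := by
  rw [norm_sub_sq_real, norm_sub_sq_real, inner_smul_right, _root_.norm_smul, real_inner_comm]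
  have : a + b ≠ 0 := by positivity
  simp only [Real.norm_eq_abs, mul_pow, sq_abs]
  field_simp
  ring

variable (L : Type*) [Field L] [NumberField L]

theorem para_place (w : InfinitePlace L) (a b : ℝ) (x z : mixedSpace L)
    (ha : 0 < a) (hb : 0 < b) :
    a * (normAtPlace w x) ^ 2 + b * (normAtPlace w (z - x)) ^ 2 =
      (a + b) * (normAtPlace w (x - (b / (a + b)) • z)) ^ 2 + a * b / (a + b) * (normAtPlace w z) ^ 2 := by
  obtain hw | hw := w.isReal_or_isComplex
  · simp only [normAtPlace_apply_of_isReal hw]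
    exact para_inner a b (x.1 ⟨w, hw⟩) (z.1 ⟨w, hw⟩) ha hb
  · simp only [normAtPlace_apply_of_isComplex hw]
    exact para_inner a b (x.2 ⟨w, hw⟩) (z.2 ⟨w, hw⟩) ha hb

theorem QF_place (c : InfinitePlace L → ℝ) (hc : ∀ w, 0 < c w) :
    QF (fun x : mixedSpace L => ∑ w, c w * (normAtPlace w x) ^ 2) := by
  constructor
  · have := fun w => continuous_normAtPlace (K := L) w
    fun_prop
  · intro t x
    rw [Finset.mul_sum]
    refine Finset.sum_congr rfl fun w _ => ?_
    rw [normAtPlace_smul, mul_pow, sq_abs]; ring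
  · intro a b x z ha hb
    simp only [Finset.mul_sum]
    rw [← Finset.sum_add_distrib, ← Finset.sum_add_distrib]
    refine Finset.sum_congr rfl fun w _ => ?_
    have := para_place L w a b x z ha hb
    linear_combination (c w) * this
  · obtain ⟨w1, -, h1⟩ := Finset.exists_min_image Finset.univ c Finset.univ_nonempty
    refine ⟨c w1, hc w1, fun x => ?_⟩
    obtain ⟨w, -, hw⟩ := Finset.exists_mem_eq_sup' Finset.univ_nonempty (fun w => normAtPlace w x)
    rw [norm_eq_sup'_normAtPlace, hw]
    calc c w1 * normAtPlace w x ^ 2 ≤ c w * normAtPlace w x ^ 2 := by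
          have := h1 w (Finset.mem_univ w)
          gcongr
      _ ≤ _ := Finset.single_le_sum (f := fun w => c w * normAtPlace w x ^ 2)
          (fun w _ => by have := hc w; positivity) (Finset.mem_univ w)

variable {L}

/-- the product kernel -/
noncomputable def gL (U : InfinitePlace L → ℝ) : ℝ≥0∞ := ∏ w, fe w.mult (U w)

/-- logarithmic vector -/
noncomputable def ell (x : L) : InfinitePlace L → ℝ := fun w => w.mult * Real.log (w x)

/-- multiplicities -/
noncomputable def tau (L : Type*) [Field L] : InfinitePlace L → ℝ := fun w => w.mult

/-- reduced theta series -/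
noncomputable def ThS (U : InfinitePlace L → ℝ) : ℝ≥0∞ :=
  ∑' α : {x : 𝓞 L // x ≠ 0}, gL (U + ell (α.1 : L))

theorem gL_eq (U : InfinitePlace L → ℝ) :
    gL U = ENNReal.ofReal (rexp (-∑ w, (w.mult : ℝ) * rexp (2 * U w / w.mult))) := by
  unfold gL fe
  rw [← ENNReal.ofReal_prod_of_nonneg (fun _ _ => by positivity), ← Real.exp_sum, Finset.sum_neg_distrib]

theorem gL_anti : Antitone (gL (L := L)) := by
  intro U U' h
  unfold gL
  exact Finset.prod_le_prod' fun w _ => fe_anti _ (h w)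

theorem ThS_anti : Antitone (ThS (L := L)) := by
  intro U U' h
  exact ENNReal.tsum_le_tsum fun α => gL_anti (by gcongr)

theorem measurable_gL : Measurable (gL (L := L)) := by
  unfold gL
  exact Finset.measurable_prod _ fun w _ => (measurable_fe _).comp (measurable_pi_apply w)

theorem gL_ell (U : InfinitePlace L → ℝ) {x : L} (hx : x ≠ 0) :
    gL (U + ell x) = Gq (fun x : mixedSpace L => ∑ w : InfinitePlace L, (w.mult * rexp (2 * U w / w.mult)) * (normAtPlace w x) ^ 2)
      1 (mixedEmbedding L x) := by
  rw [gL_eq, Gq]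
  congr 3
  rw [one_mul]
  refine Finset.sum_congr rfl fun w _ => ?_
  have hw : (0:ℝ) < w.mult := by exact_mod_cast InfinitePlace.mult_pos
  have hwx : 0 < w x := InfinitePlace.pos_iff.2 hx
  rw [normAtPlace_apply, Pi.add_apply, ell, show 2 * (U w + w.mult * Real.log (w x)) / w.mult = 2 * U w / w.mult + Real.log (w x) * 2 by field_simp, Real.exp_add, Real.exp_mul, Real.exp_log hwx]
  norm_cast
  ring

/-- integers as lattice points -/
noncomputable def latEquiv : 𝓞 L ≃ (mixedEmbedding.integerLattice L).toAddSubgroup :=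
  Equiv.ofBijective (fun x => ⟨mixedEmbedding L x, by
    change _ ∈ mixedEmbedding.integerLattice L
    exact ⟨x, rfl⟩⟩) (by
    constructor
    · intro x y h
      have := congrArg Subtype.val h
      exact RingOfIntegers.ext (mixedEmbedding_injective L this)
    · rintro ⟨_, ⟨x, rfl⟩⟩
      exact ⟨x, rfl⟩)

theorem latEquiv_apply (x : 𝓞 L) : (latEquiv x : mixedSpace L) = mixedEmbedding L x := rfl

theorem theta_eq (U : InfinitePlace L → ℝ) :
    Pq (mixedEmbedding.integerLattice L).toAddSubgroup
      (fun x : mixedSpace L => ∑ w : InfinitePlace L, (w.mult * rexp (2 * U w / w.mult)) * (normAtPlace w x) ^ 2) 1 0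
      = 1 + ThS U := by
  unfold Pq
  rw [← latEquiv.tsum_eq, ENNReal.tsum_eq_add_tsum_ite (0 : 𝓞 L)]
  congr 1
  · simp [latEquiv_apply, Gq]
  · unfold ThS
    have := tsum_subtype {x : 𝓞 L | x ≠ 0} (fun x : 𝓞 L => gL (U + ell (x : L)))
    refine Eq.trans ?_ this.symm
    refine tsum_congr fun x => ?_
    by_cases hx : x = 0
    · simp [hx]
    · simp only [hx, if_false]
      rw [Set.indicator_of_mem (by exact hx), gL_ell U (by exact_mod_cast hx)]
      rw [latEquiv_apply, zero_add]

theorem isFD : IsAddFundamentalDomain (mixedEmbedding.integerLattice L).toAddSubgroup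
    (ZSpan.fundamentalDomain (latticeBasis L)) (volume : Measure (mixedSpace L)) :=
  fundamentalDomain_integerLattice L

instance countO : Countable (𝓞 L) := Finsupp.Countable.of_moduleFinite (R := ℤ)

instance : Countable (mixedEmbedding.integerLattice L).toAddSubgroup :=
  latEquiv.symm.injective.countable

theorem cpos (U : InfinitePlace L → ℝ) (w : InfinitePlace L) : 0 < w.mult * rexp (2 * U w / w.mult) := by
  have hw : (0:ℝ) < w.mult := by exact_mod_cast InfinitePlace.mult_pos
  positivity

theorem ThS_ne_top (U : InfinitePlace L → ℝ) : ThS U ≠ ⊤ := by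
  have := theta_fin (μ := volume) _ isFD (QF_place L _ (cpos U)) (ZSpan.fundamentalDomain_isBounded _)
  rw [theta_eq] at this
  exact fun h => this (by rw [h]; simp)

theorem ThS_mono (U : InfinitePlace L → ℝ) {h : ℝ} (hh : 0 < h) :
    1 + ThS U ≤ ENNReal.ofReal (rexp (Module.finrank ℚ L * h)) * (1 + ThS (U + h • tau L)) := by
  have := theta_mono (μ := volume) _ isFD (QF_place L _ (cpos U)) (c' := rexp (2 * h)) (by
    rw [← Real.exp_zero]; exact Real.exp_lt_exp.2 (by linarith))
  rw [theta_eq, mixedEmbedding.finrank] at this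
  refine this.trans (le_of_eq ?_)
  congr 1
  · congr 1
    rw [show 2 * h = h + h by ring, Real.exp_add, Real.sqrt_mul_self (by positivity), ← Real.exp_nat_mul]
  · rw [← theta_eq]
    unfold Pq Gq
    refine tsum_congr fun g => ?_
    congr 3
    rw [one_mul, Finset.mul_sum]
    refine Finset.sum_congr rfl fun w _ => ?_
    have hw : (0:ℝ) < w.mult := by exact_mod_cast InfinitePlace.mult_pos
    rw [show 2 * (U + h • tau L) w / w.mult = 2 * U w / w.mult + 2 * h by
      simp only [Pi.add_apply, Pi.smul_apply, tau, smul_eq_mul]; field_simp, Real.exp_add]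
    ring

end thetaL

end RegR

open MeasureTheory Real
open scoped ENNReal
set_option linter.unusedSectionVars false

namespace RegR

section unitlat

open NumberField NumberField.Units NumberField.Units.dirichletUnitTheorem
open scoped Classical

variable (K : Type*) [Field K] [NumberField K]

/-- full logarithmic embedding of units -/
noncomputable def ellU : Additive (𝓞 K)ˣ →+ (InfinitePlace K → ℝ) where
  toFun u := ell ((u.toMul : 𝓞 K) : K)
  map_zero' := by ext w; simp [ell]
  map_add' u v := by
    ext w
    have h1 : w ((u.toMul : 𝓞 K) : K) ≠ 0 := by simp
    have h2 : w ((v.toMul : 𝓞 K) : K) ≠ 0 := by simp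
    simp only [ell, toMul_add, Units.val_mul, map_mul, Pi.add_apply]
    rw [Real.log_mul h1 h2]; ring

/-- unit lattice inside the full space -/
noncomputable def Lam : AddSubgroup (InfinitePlace K → ℝ) := (ellU K).range

variable {K}

theorem mem_Lam {p : InfinitePlace K → ℝ} : p ∈ Lam K ↔ ∃ u : (𝓞 K)ˣ, ell ((u : 𝓞 K) : K) = p :=
  ⟨fun ⟨u, hu⟩ => ⟨u.toMul, hu⟩, fun ⟨u, hu⟩ => ⟨Additive.ofMul u, hu⟩⟩

theorem Lam_sum (γ : Lam K) : ∑ w, (γ : InfinitePlace K → ℝ) w = 0 := by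
  obtain ⟨u, hu⟩ := mem_Lam.1 γ.2
  rw [← hu]
  exact sum_mult_mul_log u

instance countLam : Countable (Lam K) := by
  have : Countable (Additive (𝓞 K)ˣ) := (Units.val_injective (α := 𝓞 K)).countable
  exact (ellU K).rangeRestrict_surjective.countable

variable (K)

/-- restriction of coordinates -/
def rst (p : InfinitePlace K → ℝ) : logSpace K := fun w => p w

theorem measurable_rst : Measurable (rst K) := by
  unfold rst; fun_prop

/-- basis of the log space -/
noncomputable def bas := (Module.Free.chooseBasis ℤ (unitLattice K)).ofZLatticeBasis ℝ

/-- fundamental domain -/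
noncomputable def Fd : Set (InfinitePlace K → ℝ) := rst K ⁻¹' (ZSpan.fundamentalDomain (bas K))

theorem measurable_Fd : MeasurableSet (Fd K) :=
  measurable_rst K (ZSpan.fundamentalDomain_measurableSet _)

variable {K}

theorem rst_inj {γ γ' : Lam K} (h : rst K γ = rst K γ') : γ = γ' := by
  have h1 := Lam_sum γ
  have h2 := Lam_sum γ'
  rw [Fintype.sum_eq_add_sum_subtype_ne _ w₀] at h1 h2
  have h3 : ∀ w : {w : InfinitePlace K // w ≠ w₀}, (γ : InfinitePlace K → ℝ) w = (γ' : InfinitePlace K → ℝ) w :=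
    fun w => congrFun h w
  have h4 : (γ : InfinitePlace K → ℝ) w₀ = (γ' : InfinitePlace K → ℝ) w₀ := by
    have : ∑ w : {w : InfinitePlace K // w ≠ w₀}, (γ : InfinitePlace K → ℝ) w = ∑ w : {w : InfinitePlace K // w ≠ w₀}, (γ' : InfinitePlace K → ℝ) w :=
      Finset.sum_congr rfl fun w _ => h3 w
    linarith
  ext w
  by_cases hw : w = w₀
  · rw [hw, h4]
  · exact h3 ⟨w, hw⟩

theorem rst_mem (γ : Lam K) : rst K γ ∈ unitLattice K := by
  obtain ⟨u, hu⟩ := mem_Lam.1 γ.2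
  refine ⟨Additive.ofMul u, trivial, ?_⟩
  rw [← hu]; rfl

theorem rst_surj {x : logSpace K} (hx : x ∈ unitLattice K) : ∃ γ : Lam K, rst K γ = x := by
  obtain ⟨u, -, hu⟩ := hx
  exact ⟨⟨ellU K u, ⟨u, rfl⟩⟩, hu⟩

theorem bas_span : Submodule.span ℤ (Set.range (bas K)) = unitLattice K :=
  (Module.Free.chooseBasis ℤ (unitLattice K)).ofZLatticeBasis_span ℝ

theorem tile (p : InfinitePlace K → ℝ) : ∃! γ : Lam K, p + γ ∈ Fd K := by
  obtain ⟨v, hv, huniq⟩ := ZSpan.exist_unique_vadd_mem_fundamentalDomain (bas K) (rst K p)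
  have hv' : (v : logSpace K) ∈ unitLattice K := (SetLike.ext_iff.1 (bas_span (K := K)) _).1 v.2
  obtain ⟨γ, hγ⟩ := rst_surj hv'
  refine ⟨γ, ?_, ?_⟩
  · change rst K (p + γ) ∈ ZSpan.fundamentalDomain (bas K)
    have : rst K (p + γ) = v +ᵥ rst K p := by
      rw [Submodule.vadd_def, ← hγ, vadd_eq_add, add_comm]; rfl
    rw [this]; exact hv
  · intro γ' h'
    have hm : rst K γ' ∈ Submodule.span ℤ (Set.range (bas K)) := by rw [bas_span]; exact rst_mem γ'
    have := huniq ⟨_, hm⟩ (by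
      have : rst K (p + γ') = (⟨_, hm⟩ : Submodule.span ℤ (Set.range (bas K))) +ᵥ rst K p := by
        rw [Submodule.vadd_def, vadd_eq_add, add_comm]; rfl
      change _ +ᵥ rst K p ∈ _
      rw [← this]; exact h')
    apply rst_inj
    rw [hγ, ← this]

theorem FdFD : IsAddFundamentalDomain (Lam K) (Fd K) (volume : Measure (InfinitePlace K → ℝ)) := by
  refine IsAddFundamentalDomain.mk' (measurable_Fd K).nullMeasurableSet fun p => ?_
  obtain ⟨γ, h, hu⟩ := tile p
  refine ⟨γ, ?_, fun γ' h' => hu γ' ?_⟩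
  · change (γ : InfinitePlace K → ℝ) + p ∈ _
    rw [add_comm]; exact h
  · change (γ' : InfinitePlace K → ℝ) + p ∈ _ at h'
    rw [add_comm]; exact h'

theorem Fd_below (t : ℝ) : ∃ B : ℝ, ∀ U ∈ Fd K, t ≤ ∑ w, U w → ∀ w, B ≤ U w := by
  obtain ⟨R, hR⟩ := (ZSpan.fundamentalDomain_isBounded (bas K)).exists_norm_le
  have hR0 : 0 ≤ R := by
    obtain ⟨γ, h, -⟩ := tile (0 : InfinitePlace K → ℝ)
    exact (norm_nonneg _).trans (hR _ h)
  refine ⟨min (-R) (t - Fintype.card {w : InfinitePlace K // w ≠ w₀} * R), fun U hU ht w => ?_⟩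
  have h1 : ∀ w : {w : InfinitePlace K // w ≠ w₀}, |U w| ≤ R := fun w => by
    have := (norm_le_pi_norm (rst K U) w).trans (hR _ hU)
    simpa [rst] using this
  by_cases hw : w = w₀
  · rw [Fintype.sum_eq_add_sum_subtype_ne _ w₀] at ht
    have h2 : ∑ w : {w : InfinitePlace K // w ≠ w₀}, U w ≤ Fintype.card {w : InfinitePlace K // w ≠ w₀} * R := by
      have := Finset.sum_le_card_nsmul Finset.univ (fun w : {w : InfinitePlace K // w ≠ w₀} => U w) R
        (fun w _ => (le_abs_self _).trans (h1 w))
      simpa using this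
    rw [hw]
    exact (min_le_right _ _).trans (by linarith)
  · exact (min_le_left _ _).trans (neg_le_of_abs_le (h1 ⟨w, hw⟩))

theorem vol_D : volume (ZSpan.fundamentalDomain (bas K)) = ENNReal.ofReal (regulator K) := by
  have h := ZLattice.covolume_eq_measure_fundamentalDomain (unitLattice K) volume
    (ZLattice.isAddFundamentalDomain (Module.Free.chooseBasis ℤ (unitLattice K)) volume)
  unfold regulator
  rw [h, Measure.real, ENNReal.ofReal_toReal]
  · rfl
  · exact (ZSpan.fundamentalDomain_isBounded _).measure_lt_top.ne

theorem slice (t : ℝ) : volume (Fd K ∩ {p | ∑ w, p w ∈ Set.Icc t (t + 1)}) = ENNReal.ofReal (regulator K) := by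
  let e := MeasurableEquiv.piEquivPiSubtypeProd (fun _ : InfinitePlace K => ℝ) (fun w => w ≠ w₀)
  have he : MeasurePreserving e := volume_preserving_piEquivPiSubtypeProd (fun _ : InfinitePlace K => ℝ) (fun w => w ≠ w₀)
  let D := ZSpan.fundamentalDomain (bas K)
  have hD : MeasurableSet D := ZSpan.fundamentalDomain_measurableSet _
  let S : Set (({w : InfinitePlace K // w ≠ w₀} → ℝ) × ({w : InfinitePlace K // ¬ w ≠ w₀} → ℝ)) :=
    {xy | xy.1 ∈ D ∧ ∑ w, xy.2 w + ∑ w, xy.1 w ∈ Set.Icc t (t + 1)}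
  have hS : MeasurableSet S := by
    refine (measurable_fst hD).inter ?_
    refine measurableSet_Icc.preimage ?_
    fun_prop
  have h1 : Fd K ∩ {p | ∑ w, p w ∈ Set.Icc t (t + 1)} = e ⁻¹' S := by
    ext p
    have : ∑ w, p w = ∑ w : {w : InfinitePlace K // ¬ w ≠ w₀}, p w + ∑ w : {w : InfinitePlace K // w ≠ w₀}, p w := by
      rw [add_comm, Fintype.sum_subtype_add_sum_subtype]
    simp only [Set.mem_inter_iff, Set.mem_ofPred_eq, Set.mem_preimage, S]
    rw [this]
    rfl
  rw [h1, he.measure_preimage hS.nullMeasurableSet]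
  change (volume.prod volume) S = _
  rw [Measure.prod_apply hS, ← vol_D, ← lintegral_indicator_one hD]
  refine lintegral_congr fun x => ?_
  by_cases hx : x ∈ D
  · rw [Set.indicator_of_mem hx]
    have hu : Unique {w : InfinitePlace K // ¬ w ≠ w₀} := ⟨⟨⟨w₀, by simp⟩⟩, fun w => Subtype.ext (by simpa using w.2)⟩
    have h2 : Prod.mk x ⁻¹' S = (MeasurableEquiv.funUnique {w : InfinitePlace K // ¬ w ≠ w₀} ℝ) ⁻¹' (Set.Icc (t - ∑ w, x w) (t + 1 - ∑ w, x w)) := by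
      ext y
      simp only [Set.mem_preimage, Set.mem_ofPred_eq, S, hx, true_and, Set.mem_Icc]
      have : ∑ w, y w = (MeasurableEquiv.funUnique {w : InfinitePlace K // ¬ w ≠ w₀} ℝ) y := by
        convert Fintype.sum_unique (f := fun w => y w)
        rfl
      rw [this]
      constructor <;> rintro ⟨h, h'⟩ <;> constructor <;> linarith
    have h3 := (volume_preserving_funUnique {w : InfinitePlace K // ¬ w ≠ w₀} ℝ).measure_preimage
      (measurableSet_Icc (a := t - ∑ w, x w) (b := t + 1 - ∑ w, x w)).nullMeasurableSet
    rw [h2, Pi.one_apply]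
    refine Eq.trans ?_ (h3.trans ?_)
    · congr!
    · rw [Real.volume_Icc]; ring_nf; simp
  · rw [Set.indicator_of_notMem hx]
    have : Prod.mk x ⁻¹' S = ∅ := by
      ext y; simp [S, hx]
    rw [this]; simp

end unitlat

end RegR

open MeasureTheory Real
open scoped ENNReal
set_option linter.unusedSectionVars false

namespace RegR

section normf

open NumberField
open scoped Classical

variable {K L : Type*} [Field K] [NumberField K] [Field L] [NumberField L] [Algebra K L]

theorem sum_places (f : InfinitePlace L → ℝ) :
    ∑ w : InfinitePlace L, (w.mult : ℝ) * f w = ∑ σ : L →+* ℂ, f (InfinitePlace.mk σ) := by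
  rw [← Finset.univ.sum_fiberwise (fun σ : L →+* ℂ => InfinitePlace.mk σ)]
  refine Finset.sum_congr rfl fun w _ => ?_
  rw [Finset.sum_congr rfl (g := fun _ => f w) (fun σ hσ => by rw [(Finset.mem_filter.1 hσ).2]),
    Finset.sum_const, nsmul_eq_mul]
  congr 2
  exact (InfinitePlace.card_filter_mk_eq w).symm

theorem norm_emb (ψ : K →+* ℂ) (x : L) :
    ‖ψ (Algebra.norm K x)‖ = ∏ σ : L →+* ℂ with σ.comp (algebraMap K L) = ψ, ‖σ x‖ := by
  let := ψ.toAlgebra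
  have h := congrArg norm (Algebra.norm_eq_prod_embeddings K ℂ x)
  rw [norm_prod] at h
  refine Eq.trans h ?_
  refine Finset.prod_bij (fun (σ : L →ₐ[K] ℂ) _ => (σ : L →+* ℂ)) ?_ ?_ ?_ ?_
  · intro σ _
    simp only [Finset.mem_filter, Finset.mem_univ, true_and]
    ext y
    exact σ.commutes y
  · intro σ _ σ' _ h
    ext y
    exact RingHom.congr_fun h y
  · intro σ hσ
    simp only [Finset.mem_filter, Finset.mem_univ, true_and] at hσ
    exact ⟨⟨σ, fun y => RingHom.congr_fun hσ y⟩, Finset.mem_univ _, rfl⟩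
  · intro σ _
    rfl

/-- the norm map on logarithmic spaces -/
noncomputable def Nm (K : Type*) {L : Type*} [Field K] [Field L] [NumberField L] [Algebra K L]
    (U : InfinitePlace L → ℝ) : InfinitePlace K → ℝ :=
  fun v => ∑ w : InfinitePlace L, if w.comap (algebraMap K L) = v then U w else 0

theorem Nm_ell {x : L} (hx : x ≠ 0) : Nm K (ell x) = ell (Algebra.norm K x) := by
  ext v
  unfold Nm ell
  have h1 : ∀ w : InfinitePlace L, (if w.comap (algebraMap K L) = v then w.mult * Real.log (w x) else 0)
      = (w.mult : ℝ) * (if w.comap (algebraMap K L) = v then Real.log (w x) else 0) := by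
    intro w; split_ifs <;> simp
  simp_rw [h1]
  rw [sum_places (fun w : InfinitePlace L => if w.comap (algebraMap K L) = v then Real.log (w x) else 0)]
  have h2 : (v.mult : ℝ) * Real.log (v (Algebra.norm K x)) =
      ∑ v' : InfinitePlace K, (v'.mult : ℝ) * (if v' = v then Real.log (v' (Algebra.norm K x)) else 0) := by
    simp
  rw [h2, sum_places (fun v' : InfinitePlace K => if v' = v then Real.log (v' (Algebra.norm K x)) else 0)]
  rw [← Finset.univ.sum_fiberwise (fun σ : L →+* ℂ => σ.comp (algebraMap K L))]
  refine Finset.sum_congr rfl fun ψ _ => ?_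
  have h3 : ∀ σ ∈ Finset.univ.filter (fun σ : L →+* ℂ => σ.comp (algebraMap K L) = ψ),
      (if (InfinitePlace.mk σ).comap (algebraMap K L) = v then Real.log (InfinitePlace.mk σ x) else 0) =
      if InfinitePlace.mk ψ = v then Real.log ‖σ x‖ else 0 := by
    intro σ hσ
    rw [InfinitePlace.comap_mk, (Finset.mem_filter.1 hσ).2, InfinitePlace.apply]
  rw [Finset.sum_congr rfl h3]
  split_ifs with h
  · rw [InfinitePlace.apply, norm_emb, Real.log_prod]
    intro σ _
    simpa using hx
  · simp

theorem Nm_sum (U : InfinitePlace L → ℝ) : ∑ v, Nm K U v = ∑ w, U w := by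
  unfold Nm
  rw [Finset.sum_comm]
  simp

theorem Nm_add (U U' : InfinitePlace L → ℝ) : Nm K (U + U') = Nm K U + Nm K U' := by
  ext v
  simp only [Nm, Pi.add_apply, ← Finset.sum_add_distrib]
  refine Finset.sum_congr rfl fun w _ => ?_
  split_ifs <;> simp

theorem measurable_Nm : Measurable (Nm K (L := L)) := by
  unfold Nm
  refine measurable_pi_lambda _ fun v => Finset.measurable_sum _ fun w _ => ?_
  split_ifs <;> fun_prop

theorem Nm_Lam {γ : InfinitePlace L → ℝ} (h : γ ∈ Lam L) : Nm K γ ∈ Lam K := by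
  obtain ⟨u, rfl⟩ := mem_Lam.1 h
  rw [Nm_ell (by simp)]
  refine mem_Lam.2 ⟨Units.map (RingOfIntegers.norm K) u, ?_⟩
  congr 1

theorem place_two (w : InfinitePlace L) : w 2 = 2 := by
  rw [← InfinitePlace.norm_embedding_eq w, map_ofNat]
  simp

theorem Nm_tau : Nm K (tau L) = fun v : InfinitePlace K => (v.mult : ℝ) * Module.finrank K L := by
  have h := Nm_ell (K := K) (L := L) (x := 2) two_ne_zero
  have h3 : (Algebra.norm K (2 : L)) = 2 ^ Module.finrank K L := by
    rw [← map_ofNat (algebraMap K L) 2, Algebra.norm_algebraMap]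
  ext v
  have h4 := congrFun h v
  have hl : Real.log 2 ≠ 0 := (Real.log_pos (by norm_num)).ne'
  simp only [Nm, ell, h3, map_pow, place_two, Real.log_pow] at h4
  have h5 : (Nm K (tau L) v) * Real.log 2 = ∑ w : InfinitePlace L, if w.comap (algebraMap K L) = v then w.mult * Real.log 2 else 0 := by
    unfold Nm tau
    rw [Finset.sum_mul]
    refine Finset.sum_congr rfl fun w _ => ?_
    split_ifs <;> simp
  apply mul_right_cancel₀ hl
  rw [h5, h4]; ring

theorem Nm_surj (p : InfinitePlace K → ℝ) : ∃ q : InfinitePlace L → ℝ, Nm K q = p := by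
  obtain ⟨s, hs⟩ := (InfinitePlace.comap_surjective (k := K) (K := L)).hasRightInverse
  refine ⟨fun w => if s (w.comap (algebraMap K L)) = w then p (w.comap (algebraMap K L)) else 0, ?_⟩
  ext v
  unfold Nm
  rw [Finset.sum_eq_single (s v)]
  · have : (s v).comap (algebraMap K L) = v := hs v
    simp [this]
  · intro w _ hw
    by_cases h1 : w.comap (algebraMap K L) = v
    · rw [if_pos h1]; simp only [h1]; rw [if_neg hw.symm]
    · rw [if_neg h1]
  · simp

theorem ell_mul {x y : L} (hx : x ≠ 0) (hy : y ≠ 0) : ell (x * y) = ell x + ell y := by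
  ext w
  simp only [ell, map_mul, Pi.add_apply]
  rw [Real.log_mul (by simpa using hx) (by simpa using hy)]; ring

theorem ell_sum_nonneg {x : 𝓞 L} (hx : x ≠ 0) : 0 ≤ ∑ w, ell (x : L) w := by
  have h := InfinitePlace.prod_eq_abs_norm (x : L)
  have hx' : (x : L) ≠ 0 := by exact_mod_cast hx
  have h1 : ∑ w, ell (x : L) w = Real.log (∏ w : InfinitePlace L, w (x : L) ^ w.mult) := by
    rw [Real.log_prod]
    · simp [ell, Real.log_pow]
    · intro w _
      exact pow_ne_zero _ (by simpa using hx')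
  rw [h1, h]
  apply Real.log_nonneg
  have : (1 : ℚ) ≤ |Algebra.norm ℚ (x : L)| := by
    rw [← Algebra.coe_norm_int]
    have : Algebra.norm ℤ x ≠ 0 := by simpa [Algebra.norm_eq_zero_iff] using hx
    exact_mod_cast Int.one_le_abs this
  exact_mod_cast this

end normf

end RegR

open MeasureTheory Real
open scoped ENNReal
set_option linter.unusedSectionVars false

namespace RegR

section unfolding

open NumberField
open scoped Classical

variable (K L : Type*) [Field K] [NumberField K] [Field L] [NumberField L] [Algebra K L]

/-- enumeration of the places -/
noncomputable def enumW : Fin (Fintype.card (InfinitePlace L)) ≃ InfinitePlace L :=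
  (Fintype.equivFin _).symm

/-- list of local degrees above a place -/
noncomputable def LL (v : InfinitePlace K) : List ℕ :=
  Lst (Fintype.card (InfinitePlace L)) (fun i => (enumW L i).mult)
    (fun i => (enumW L i).comap (algebraMap K L)) v

theorem LL_sum (v : InfinitePlace K) : (LL K L v).sum = v.mult * Module.finrank K L := by
  unfold LL
  rw [Lst_sum, (enumW L).sum_comp (fun w => if w.comap (algebraMap K L) = v then w.mult else 0)]
  have := congrFun (Nm_tau (K := K) (L := L)) v
  unfold Nm tau at this
  exact_mod_cast this

theorem LL_ok (v : InfinitePlace K) : Ok (LL K L v) := by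
  intro e he
  obtain ⟨i, rfl⟩ := Lst_mem _ _ _ _ _ he
  unfold InfinitePlace.mult
  split_ifs <;> simp

theorem LL_ne (v : InfinitePlace K) : LL K L v ≠ [] := by
  intro h
  have := LL_sum K L v
  rw [h, List.sum_nil] at this
  have h1 : 0 < v.mult := InfinitePlace.mult_pos
  have h2 : 0 < Module.finrank K L := by
    have : FiniteDimensional K L := inferInstance
    exact Module.finrank_pos
  have := Nat.mul_pos h1 h2
  omega

variable {K L}

theorem prod_places (g : InfinitePlace K → ℝ → ℝ≥0∞) (hg : ∀ v, Measurable (g v)) (p : InfinitePlace K → ℝ) :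
    ∫⁻ x : InfinitePlace L → ℝ, gL x * ∏ v, g v (p v - Nm K x v) = ∏ v, Tl (LL K L v) (g v) (p v) := by
  unfold LL
  rw [← prod_formula _ _ _ g hg p,
    ← (volume_measurePreserving_piCongrLeft (fun _ : InfinitePlace L => ℝ) (enumW L)).lintegral_comp_emb
      (MeasurableEquiv.measurableEmbedding _)]
  refine lintegral_congr fun x => ?_
  have h1 : ∀ i, (MeasurableEquiv.piCongrLeft (fun _ : InfinitePlace L => ℝ) (enumW L)) x (enumW L i) = x i :=
    fun i => MeasurableEquiv.piCongrLeft_apply_apply (β := fun _ => ℝ) (enumW L) x i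
  congr 1
  · unfold gL
    rw [← (enumW L).prod_comp]
    simp only [h1]
  · refine Finset.prod_congr rfl fun v _ => ?_
    unfold Nm
    rw [← (enumW L).sum_comp]
    simp only [h1]

variable (A η : InfinitePlace K → ℝ)

/-- window function -/
noncomputable def WW (p : InfinitePlace K → ℝ) : ℝ≥0∞ := ∏ v, win (A v) (η v) (-(p v))

/-- periodized window -/
noncomputable def Wper (p : InfinitePlace K → ℝ) : ℝ≥0∞ := ∑' l : Lam K, WW A η (p + l)

/-- the local products -/
noncomputable def JJ (L : Type*) [Field L] [NumberField L] [Algebra K L] (p : InfinitePlace K → ℝ) : ℝ≥0∞ :=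
  ∏ v, Tl (LL K L v) (win (A v) (η v)) (p v)

theorem measurable_WW : Measurable (WW A η) := by
  unfold WW
  exact Finset.measurable_prod _ fun v _ => (measurable_win _ _).comp (measurable_pi_apply v).neg

theorem measurable_Wper : Measurable (Wper A η) := by
  unfold Wper
  have := measurable_WW A η
  exact Measurable.tsum fun l => by fun_prop

theorem Wper_add (p : InfinitePlace K → ℝ) {l : InfinitePlace K → ℝ} (hl : l ∈ Lam K) :
    Wper A η (p + l) = Wper A η p := by
  unfold Wper
  rw [← (Equiv.addLeft (⟨l, hl⟩ : Lam K)).tsum_eq (fun l' : Lam K => WW A η (p + l'))]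
  refine tsum_congr fun l' => ?_
  simp [add_assoc]

theorem int_shift (c : InfinitePlace L → ℝ) (l : InfinitePlace K → ℝ) :
    ∫⁻ U : InfinitePlace L → ℝ, gL (U + c) * WW A η (Nm K U + l) = JJ A η L (Nm K c - l) := by
  unfold JJ
  rw [← prod_places _ (fun v => measurable_win _ _),
    ← lintegral_add_right_eq_self (fun x : InfinitePlace L → ℝ => gL x * ∏ v, win (A v) (η v) ((Nm K c - l) v - Nm K x v)) c]
  refine lintegral_congr fun U => ?_
  congr 1
  unfold WW
  refine Finset.prod_congr rfl fun v _ => ?_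
  congr 1
  rw [Nm_add]
  simp only [Pi.add_apply, Pi.sub_apply]
  ring

theorem int_per (c : InfinitePlace L → ℝ) :
    ∫⁻ U : InfinitePlace L → ℝ, gL (U + c) * Wper A η (Nm K U) = ∑' l : Lam K, JJ A η L (Nm K c - l) := by
  have h1 := measurable_gL (L := L)
  have h2 := measurable_WW A η
  have h3 := measurable_Nm (K := K) (L := L)
  simp_rw [← int_shift]
  rw [← lintegral_tsum (fun l => by fun_prop)]
  refine lintegral_congr fun U => ?_
  rw [ENNReal.tsum_mul_left]
  rfl

/-- the nonzero integers -/
abbrev NZ (L : Type*) [Field L] [NumberField L] := {x : 𝓞 L // x ≠ 0}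

theorem NZ.ne (x : NZ L) : ((x.1 : 𝓞 L) : L) ≠ 0 := by exact_mod_cast x.2

/-- unit action -/
noncomputable def uact (u : (𝓞 L)ˣ) : NZ L ≃ NZ L where
  toFun x := ⟨u * x.1, by simpa using x.2⟩
  invFun x := ⟨(u⁻¹ : (𝓞 L)ˣ) * x.1, by simpa using x.2⟩
  left_inv x := by ext; simp
  right_inv x := by ext; simp

theorem ell_uact (u : (𝓞 L)ˣ) (x : NZ L) : ell ((uact u x).1 : L) = ell ((u : 𝓞 L) : L) + ell (x.1 : L) := by
  rw [← ell_mul (by simp) x.ne]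
  simp [uact]

/-- an integer in the fundamental domain -/
noncomputable def inF (x : InfinitePlace L → ℝ) : ℝ≥0∞ := (Fd L).indicator 1 x

theorem inF_sum (x : InfinitePlace L → ℝ) : ∑' γ : Lam L, inF (x + (γ : InfinitePlace L → ℝ)) = 1 := by
  obtain ⟨γ, h, hu⟩ := tile x
  rw [tsum_eq_single γ]
  · unfold inF; rw [Set.indicator_of_mem h]; rfl
  · intro γ' h'
    unfold inF
    rw [Set.indicator_of_notMem]
    exact fun h2 => h' (hu γ' h2)

theorem unfold_main (Φ : (InfinitePlace L → ℝ) → ℝ≥0∞) (hΦ : Measurable Φ)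
    (hper : ∀ U, ∀ γ ∈ Lam L, Φ (U + γ) = Φ U) (c : InfinitePlace L → ℝ) :
    ∫⁻ U in Fd L, ThS (U + c) * Φ U =
      ∑' α : NZ L, inF (ell (α.1 : L)) * ∫⁻ U, gL (U + (c + ell (α.1 : L))) * Φ U := by
  have h1 := measurable_gL (L := L)
  let f : (InfinitePlace L → ℝ) → ℝ≥0∞ := fun x => ∫⁻ U in Fd L, gL (U + (c + x)) * Φ U
  have hf : ∀ x, ∀ γ ∈ Lam L, f (x + γ) = ∫⁻ U in Fd L, gL (U + γ + (c + x)) * Φ (U + γ) := by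
    intro x γ hγ
    refine lintegral_congr fun U => ?_
    rw [hper U γ hγ, show U + (c + (x + γ)) = U + γ + (c + x) by abel]
  have e1 : ∫⁻ U in Fd L, ThS (U + c) * Φ U = ∑' α : NZ L, f (ell (α.1 : L)) := by
    change _ = ∑' α : NZ L, ∫⁻ U in Fd L, gL (U + (c + ell (α.1 : L))) * Φ U
    rw [← lintegral_tsum (fun α => by fun_prop)]
    refine lintegral_congr fun U => ?_
    rw [ENNReal.tsum_mul_right]
    unfold ThS
    simp only [add_assoc]
  have e2 : ∑' α : NZ L, f (ell (α.1 : L)) = ∑' γ : Lam L, ∑' α : NZ L, inF (ell (α.1 : L) + (γ : InfinitePlace L → ℝ)) * f (ell (α.1 : L)) := by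
    rw [ENNReal.tsum_comm]
    refine tsum_congr fun α => ?_
    rw [ENNReal.tsum_mul_right, inF_sum, one_mul]
  have e3 : ∀ γ : Lam L, ∑' α : NZ L, inF (ell (α.1 : L) + (γ : InfinitePlace L → ℝ)) * f (ell (α.1 : L)) =
      ∑' α : NZ L, inF (ell (α.1 : L)) * f (ell (α.1 : L) + ((-γ : Lam L) : InfinitePlace L → ℝ)) := by
    intro γ
    obtain ⟨u, hu⟩ := mem_Lam.1 (-γ).2
    rw [← (uact u).tsum_eq]
    refine tsum_congr fun α => ?_
    rw [ell_uact, hu]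
    congr 2
    · simp
    · rw [add_comm]
  rw [e1, e2]
  simp_rw [e3]
  refine ((Equiv.neg (Lam L)).tsum_eq (fun γ : Lam L => ∑' α : NZ L, inF (ell (α.1 : L)) *
    f (ell (α.1 : L) + (γ : InfinitePlace L → ℝ)))).trans ?_
  rw [ENNReal.tsum_comm]
  refine tsum_congr fun α => ?_
  rw [ENNReal.tsum_mul_left, unfold_fd FdFD (by fun_prop), lintegral_tsum (fun α => by fun_prop)]
  congr 1
  exact tsum_congr fun γ => hf _ _ γ.2

theorem I_eq (h : ℝ) : ∫⁻ U in Fd L, ThS (U + h • tau L) * Wper A η (Nm K U) =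
      ∑' α : NZ L, inF (ell (α.1 : L)) * ∑' l : Lam K,
        JJ A η L (fun v => (Nm K (ell (α.1 : L)) v - (l : InfinitePlace K → ℝ) v) + ((LL K L v).sum : ℕ) * h) := by
  have h2 := measurable_Wper A η
  have h3 := measurable_Nm (K := K) (L := L)
  rw [unfold_main (fun U => Wper A η (Nm K U)) (by fun_prop)]
  · refine tsum_congr fun α => ?_
    congr 1
    rw [int_per]
    refine tsum_congr fun l => ?_
    congr 1
    have h4 : Nm K (h • tau L) = h • Nm K (tau L) := by
      ext v
      simp only [Nm, Pi.smul_apply, smul_eq_mul, Finset.mul_sum]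
      refine Finset.sum_congr rfl fun w _ => ?_
      split_ifs <;> simp
    ext v
    rw [Nm_add, h4, Nm_tau, LL_sum]
    simp only [Pi.add_apply, Pi.sub_apply, Pi.smul_apply, smul_eq_mul]
    push_cast
    ring
  · intro U γ hγ
    rw [Nm_add, Wper_add A η _ (Nm_Lam hγ)]

end unfolding

end RegR

open MeasureTheory Real
open scoped ENNReal
set_option linter.unusedSectionVars false

namespace RegR

section covol

open NumberField NumberField.Units
open scoped Classical

variable {K L : Type*} [Field K] [NumberField K] [Field L] [NumberField L] [Algebra K L]

theorem measurable_inF : Measurable (inF (L := L)) := by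
  unfold inF
  exact measurable_one.indicator (measurable_Fd L)

theorem lint_inF (f : (InfinitePlace L → ℝ) → ℝ≥0∞) : ∫⁻ U in Fd L, f U = ∫⁻ U, inF U * f U := by
  rw [← lintegral_indicator (measurable_Fd L)]
  refine lintegral_congr fun U => ?_
  unfold inF
  by_cases h : U ∈ Fd L <;> simp [h]

theorem per_shift {Φ : (InfinitePlace L → ℝ) → ℝ≥0∞} (hΦ : Measurable Φ)
    (hper : ∀ U, ∀ γ ∈ Lam L, Φ (U + γ) = Φ U) (q : InfinitePlace L → ℝ) :
    ∫⁻ U in Fd L, Φ (U + q) = ∫⁻ U in Fd L, Φ U := by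
  have hm := measurable_inF (L := L)
  rw [lint_inF, ← lintegral_sub_right_eq_self _ q, unfold_fd FdFD (by fun_prop)]
  refine lintegral_congr fun U => ?_
  have : ∀ γ : Lam L, inF (U + (γ : InfinitePlace L → ℝ) - q) * Φ (U + γ - q + q) = inF (U - q + (γ : InfinitePlace L → ℝ)) * Φ U := by
    intro γ
    rw [sub_add_cancel, hper U γ γ.2, show U + (γ : InfinitePlace L → ℝ) - q = U - q + (γ : InfinitePlace L → ℝ) by abel]
  simp_rw [this]
  rw [ENNReal.tsum_mul_right, inF_sum, one_mul]

variable (A η : InfinitePlace K → ℝ)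

theorem WW_int (hη : ∀ v, 0 < η v) : ∫⁻ p, WW A η p = ENNReal.ofReal (∏ v, η v) := by
  have h1 : WW A η = (Set.pi Set.univ fun v => Set.Icc (A v) (A v + η v)).indicator 1 := by
    ext p
    unfold WW
    by_cases hp : p ∈ Set.pi Set.univ fun v => Set.Icc (A v) (A v + η v)
    · rw [Set.indicator_of_mem hp, Pi.one_apply]
      refine Finset.prod_eq_one fun v _ => ?_
      have := hp v trivial
      rw [Set.mem_Icc] at this
      unfold win
      rw [Set.indicator_of_mem]
      · rfl
      · rw [Set.mem_Icc]; constructor <;> linarith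
    · rw [Set.indicator_of_notMem hp]
      simp only [Set.mem_pi, Set.mem_univ, true_imp_iff, not_forall] at hp
      obtain ⟨v, hv⟩ := hp
      refine Finset.prod_eq_zero (Finset.mem_univ v) ?_
      unfold win
      rw [Set.indicator_of_notMem]
      intro h
      apply hv
      rw [Set.mem_Icc] at h ⊢
      constructor <;> linarith
  rw [h1, lintegral_indicator_one (MeasurableSet.univ_pi fun v => measurableSet_Icc), volume_pi_pi,
    ENNReal.ofReal_prod_of_nonneg (fun v _ => (hη v).le)]
  refine Finset.prod_congr rfl fun v _ => ?_
  rw [Real.volume_Icc]; ring_nf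

/-- indicator of the unit interval -/
noncomputable def I1 (x : ℝ) : ℝ≥0∞ := (Set.Icc (0:ℝ) 1).indicator 1 x

theorem measurable_I1 : Measurable I1 := measurable_one.indicator measurableSet_Icc

theorem slice_int (t : ℝ) (c : ℝ≥0∞) : ∫⁻ p in Fd K, I1 (∑ w, p w - t) * c = ENNReal.ofReal (regulator K) * c := by
  have hm : Measurable fun p : InfinitePlace K → ℝ => I1 (∑ w, p w - t) := by
    have := measurable_I1; fun_prop
  rw [lintegral_mul_const _ hm, ← slice t]
  congr 1
  have hs : MeasurableSet {p : InfinitePlace K → ℝ | ∑ w, p w ∈ Set.Icc t (t + 1)} :=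
    measurableSet_Icc.preimage (by fun_prop)
  rw [Set.inter_comm, ← Measure.restrict_apply hs, ← lintegral_indicator_one hs]
  refine lintegral_congr fun p => ?_
  unfold I1 Set.indicator
  congr 1
  simp only [Set.mem_Icc, Set.mem_ofPred_eq, eq_iff_iff]
  constructor <;> rintro ⟨h, h'⟩ <;> constructor <;> linarith

theorem covol_eq (hη : ∀ v, 0 < η v) :
    ENNReal.ofReal (regulator K) * ∫⁻ U in Fd L, Wper A η (Nm K U) =
      ENNReal.ofReal (regulator L) * ENNReal.ofReal (∏ v, η v) := by
  have hI := measurable_I1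
  have hW := measurable_Wper A η
  have hWW := measurable_WW A η
  have hN := measurable_Nm (K := K) (L := L)
  have hN' : ∀ q : InfinitePlace K → ℝ, ∫⁻ U in Fd L, Wper A η (Nm K U + q) = ∫⁻ U in Fd L, Wper A η (Nm K U) := by
    intro q
    obtain ⟨q', rfl⟩ := Nm_surj (K := K) (L := L) q
    simp_rw [← Nm_add]
    refine per_shift (Φ := fun U => Wper A η (Nm K U)) (by fun_prop) ?_ q'
    intro U γ hγ
    rw [Nm_add, Wper_add A η _ (Nm_Lam hγ)]
  have e1 : ENNReal.ofReal (regulator K) * ∫⁻ U in Fd L, Wper A η (Nm K U) =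
      ∫⁻ p in Fd K, ∫⁻ U in Fd L, I1 (∑ w, p w - 0) * Wper A η (Nm K U + p) := by
    rw [← slice_int 0]
    refine lintegral_congr fun p => ?_
    rw [lintegral_const_mul _ (by fun_prop), hN']
  have e2 : ∀ U : InfinitePlace L → ℝ, ∫⁻ p in Fd K, I1 (∑ w, p w - 0) * Wper A η (Nm K U + p) =
      ∫⁻ p, I1 (∑ w, p w - ∑ w, U w) * WW A η p := by
    intro U
    rw [← lintegral_add_right_eq_self (fun p : InfinitePlace K → ℝ => I1 (∑ w, p w - ∑ w, U w) * WW A η p) (Nm K U)]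
    refine Eq.trans ?_ (unfold_fd FdFD (f := fun p : InfinitePlace K → ℝ =>
      I1 (∑ w, (p + Nm K U) w - ∑ w, U w) * WW A η (p + Nm K U)) (by fun_prop)).symm
    refine lintegral_congr fun p => ?_
    unfold Wper
    rw [← ENNReal.tsum_mul_left]
    refine tsum_congr fun l => ?_
    congr 2
    · simp only [Pi.add_apply, Finset.sum_add_distrib, Lam_sum, Nm_sum]
      ring
    · abel
  have e3 : ∀ p : InfinitePlace K → ℝ, ∫⁻ U in Fd L, I1 (∑ w, p w - ∑ w, U w) * WW A η p =
      ENNReal.ofReal (regulator L) * WW A η p := by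
    intro p
    rw [← slice_int (∑ w, p w - 1)]
    refine lintegral_congr fun U => ?_
    congr 1
    unfold I1 Set.indicator
    congr 1
    simp only [Set.mem_Icc, eq_iff_iff]
    constructor <;> rintro ⟨h, h'⟩ <;> constructor <;> linarith
  rw [e1, lintegral_lintegral_swap (by fun_prop)]
  simp_rw [e2]
  rw [lintegral_lintegral_swap (by fun_prop)]
  simp_rw [e3]
  rw [lintegral_const_mul _ hWW, WW_int A η hη]

theorem I_fin (h : ∫⁻ U in Fd L, Wper A η (Nm K U) ≠ ⊤) :
    ∫⁻ U in Fd L, ThS U * Wper A η (Nm K U) ≠ ⊤ := by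
  have hW := measurable_Wper A η
  have hN := measurable_Nm (K := K) (L := L)
  obtain ⟨B, hB⟩ := Fd_below (K := L) (∑ v, A v)
  have h1 : ∫⁻ U in Fd L, ThS U * Wper A η (Nm K U) ≤ ∫⁻ U in Fd L, ThS (fun _ : InfinitePlace L => B) * Wper A η (Nm K U) := by
    refine setLIntegral_mono (by fun_prop) fun U hU => ?_
    by_cases h0 : Wper A η (Nm K U) = 0
    · simp [h0]
    · have : ∃ l : Lam K, WW A η (Nm K U + l) ≠ 0 := by
        by_contra! hc
        exact h0 (by unfold Wper; simp [hc])
      obtain ⟨l, hl⟩ := this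
      have h2 : ∀ v, A v ≤ (Nm K U + l) v := by
        intro v
        unfold WW at hl
        have := Finset.prod_ne_zero_iff.1 hl v (Finset.mem_univ v)
        unfold win at this
        have := (Set.mem_of_indicator_ne_zero this).2
        linarith
      have h3 : ∑ v, A v ≤ ∑ w, U w := by
        have := Finset.sum_le_sum fun v (_ : v ∈ Finset.univ) => h2 v
        simpa only [Pi.add_apply, Finset.sum_add_distrib, Lam_sum, Nm_sum, add_zero] using this
      have h4 : ThS U ≤ ThS (fun _ : InfinitePlace L => B) := ThS_anti fun w => hB U hU h3 w
      gcongr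
  refine ne_top_of_le_ne_top ?_ h1
  rw [lintegral_const_mul _ (by fun_prop)]
  exact ENNReal.mul_ne_top (ThS_ne_top _) h

theorem I_ge : JJ A η L (fun _ => 0) ≤ ∫⁻ U in Fd L, ThS U * Wper A η (Nm K U) := by
  have := I_eq (K := K) (L := L) A η 0
  simp only [zero_smul, add_zero, mul_zero] at this
  rw [this]
  obtain ⟨γ, hγ, -⟩ := tile (0 : InfinitePlace L → ℝ)
  obtain ⟨u, hu⟩ := mem_Lam.1 γ.2
  let α : NZ L := ⟨u, u.ne_zero⟩
  have hα : ell (α.1 : L) = γ := hu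
  refine le_trans ?_ (ENNReal.le_tsum α)
  have h1 : inF (ell (α.1 : L)) = 1 := by
    unfold inF
    rw [Set.indicator_of_mem]
    · rfl
    · rw [hα]; simpa using hγ
  rw [h1, one_mul]
  refine le_trans (le_of_eq ?_) (ENNReal.le_tsum (⟨Nm K (γ : InfinitePlace L → ℝ), Nm_Lam γ.2⟩ : Lam K))
  rw [hα]
  simp

theorem I_dec {h β : ℝ} (hh : 0 < h) (hβ : 0 ≤ β)
    (hT : ∀ v u, Tl (LL K L v) (win (A v) (η v)) (u + ((LL K L v).sum : ℕ) * h) ≤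
      ENNReal.ofReal (rexp (-(h * (((LL K L v).sum : ℕ) * 1.01 + β * u)))) * Tl (LL K L v) (win (A v) (η v)) u) :
    ∫⁻ U in Fd L, ThS (U + h • tau L) * Wper A η (Nm K U) ≤
      ENNReal.ofReal (rexp (-(h * ((∑ v, (((LL K L v).sum : ℕ) : ℝ)) * 1.01)))) * ∫⁻ U in Fd L, ThS U * Wper A η (Nm K U) := by
  have h0 := I_eq (K := K) (L := L) A η 0
  simp only [zero_smul, add_zero, mul_zero] at h0
  rw [h0, I_eq, ← ENNReal.tsum_mul_left]
  refine ENNReal.tsum_le_tsum fun α => ?_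
  rw [mul_left_comm]
  gcongr
  rw [← ENNReal.tsum_mul_left]
  refine ENNReal.tsum_le_tsum fun l => ?_
  unfold JJ
  refine (Finset.prod_le_prod' fun v _ => hT v _).trans ?_
  rw [Finset.prod_mul_distrib]
  gcongr
  rw [← ENNReal.ofReal_prod_of_nonneg (fun _ _ => by positivity), ← Real.exp_sum]
  apply ENNReal.ofReal_le_ofReal
  apply Real.exp_le_exp.2
  rw [Finset.sum_neg_distrib, neg_le_neg_iff, ← Finset.mul_sum, Finset.sum_add_distrib, ← Finset.sum_mul, ← Finset.mul_sum,
    Finset.sum_sub_distrib, Lam_sum, Nm_sum, sub_zero]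
  have := ell_sum_nonneg α.2
  have h2 : 0 ≤ β * ∑ w, ell (α.1 : L) w := by positivity
  nlinarith

end covol

end RegR

open MeasureTheory Real
open scoped ENNReal
set_option linter.unusedSectionVars false

namespace RegR

section final

open NumberField NumberField.Units
open scoped Classical

variable {K L : Type*} [Field K] [NumberField K] [Field L] [NumberField L] [Algebra K L]

theorem I_mono (A η : InfinitePlace K → ℝ) {h : ℝ} (hh : 0 < h) :
    (∫⁻ U in Fd L, Wper A η (Nm K U)) + ∫⁻ U in Fd L, ThS U * Wper A η (Nm K U) ≤
      ENNReal.ofReal (rexp (Module.finrank ℚ L * h)) *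
        ((∫⁻ U in Fd L, Wper A η (Nm K U)) + ∫⁻ U in Fd L, ThS (U + h • tau L) * Wper A η (Nm K U)) := by
  have hW := measurable_Wper A η
  have hN := measurable_Nm (K := K) (L := L)
  rw [← lintegral_add_left (by fun_prop), ← lintegral_add_left (by fun_prop),
    ← lintegral_const_mul' _ _ ENNReal.ofReal_ne_top]
  refine lintegral_mono fun U => ?_
  have := ThS_mono U hh
  calc Wper A η (Nm K U) + ThS U * Wper A η (Nm K U) = (1 + ThS U) * Wper A η (Nm K U) := by ring
    _ ≤ (ENNReal.ofReal (rexp (Module.finrank ℚ L * h)) * (1 + ThS (U + h • tau L))) * Wper A η (Nm K U) := by gcongr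
    _ = _ := by ring

theorem num1 {a b : ℝ} (ha : 0 ≤ a) (hb : 0 ≤ b) (h : a + b ≤ rexp 0.01 * (a + rexp (-0.0101) * b)) :
    0.0098 * b ≤ a := by
  have e1 : rexp 0.01 * rexp (-0.0101) = rexp (-0.0001) := by rw [← Real.exp_add]; norm_num
  have h2 : a + b ≤ rexp 0.01 * a + rexp (-0.0001) * b := by rw [← e1]; linarith
  have h3 : rexp 0.01 ≤ 1.0101 + 0.00001 := by
    have := Real.exp_bound' (x := 0.01) (by norm_num) (by norm_num) (n := 2) (by norm_num)
    norm_num [Finset.sum_range_succ, Nat.factorial] at this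
    norm_num
    linarith
  have h4 : rexp (-0.0001) ≤ 1 - 0.0001 + 0.0000001 := by
    have h5 : rexp (-0.0001) = (rexp 0.0001)⁻¹ := by rw [← Real.exp_neg]
    have h6 := Real.add_one_le_exp (0.0001 : ℝ)
    rw [h5]
    calc (rexp 0.0001)⁻¹ ≤ (0.0001 + 1 : ℝ)⁻¹ := by gcongr
      _ ≤ _ := by norm_num
  nlinarith

theorem choose_par {h : ℝ} (hh : 0 < h) (hnh : (Module.finrank ℚ K * Module.finrank K L : ℝ) * h ≤ 0.01) :
    ∃ β : ℝ, 0 ≤ β ∧ ∀ v : InfinitePlace K, ∃ A η : ℝ, 0 < η ∧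
      (∀ u, Tl (LL K L v) (win A η) (u + ((LL K L v).sum : ℕ) * h) ≤
      ENNReal.ofReal (rexp (-(h * (((LL K L v).sum : ℕ) * 1.01 + β * u)))) * Tl (LL K L v) (win A η) u) ∧
      η * (((11.5:ℝ) ^ 37)⁻¹ ^ v.mult * 1.15 ^ (LL K L v).sum) ≤ (Tl (LL K L v) (win A η) 0).toReal := by
  have he : ∀ v : InfinitePlace K, v.mult = 1 ∨ v.mult = 2 := by
    intro v; unfold InfinitePlace.mult; split_ifs <;> simp
  have hn : ∀ v : InfinitePlace K, (((LL K L v).sum : ℕ) : ℝ) * h ≤ 0.01 := by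
    intro v
    refine le_trans ?_ hnh
    gcongr
    rw [LL_sum]
    have : v.mult ≤ Module.finrank ℚ K := by
      rw [← InfinitePlace.sum_mult_eq]
      exact Finset.single_le_sum (f := fun w : InfinitePlace K => w.mult) (fun _ _ => Nat.zero_le _) (Finset.mem_univ v)
    push_cast
    gcongr
  rcases le_total (Module.finrank K L) 300 with hm | hm
  · refine ⟨2.02, by norm_num, fun v => reg1 (LL_ok K L v) (LL_ne K L v) hh (he v) (hn v) ?_⟩
    rw [LL_sum]; nlinarith
  · refine ⟨0.4 / 0.2912, by norm_num, fun v => reg2 (LL_ok K L v) (LL_ne K L v) hh (he v) (hn v) ?_⟩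
    rw [LL_sum]
    rcases he v with h | h <;> rw [h] <;> omega

theorem main_ineq : (0.0098 : ℝ) * (((11.5:ℝ) ^ 37)⁻¹ ^ Module.finrank ℚ K *
      1.15 ^ (Module.finrank ℚ K * Module.finrank K L)) * regulator K ≤ regulator L := by
  have hKL : Module.finrank ℚ K * Module.finrank K L = Module.finrank ℚ L := Module.finrank_mul_finrank ℚ K L
  have hn : 0 < Module.finrank ℚ L := Module.finrank_pos
  have hnR : (0 : ℝ) < Module.finrank ℚ L := by exact_mod_cast hn
  have hKLR : (Module.finrank ℚ K * Module.finrank K L : ℝ) = Module.finrank ℚ L := by exact_mod_cast hKL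
  obtain ⟨h, hh⟩ : ∃ h : ℝ, h = 0.01 / Module.finrank ℚ L := ⟨_, rfl⟩
  have hpos : 0 < h := by rw [hh]; positivity
  have hnh : (Module.finrank ℚ L : ℝ) * h = 0.01 := by rw [hh]; field_simp
  obtain ⟨β, hβ, hv⟩ := choose_par (K := K) (L := L) hpos (by rw [hKLR, hnh])
  choose A η hη hT hlow using hv
  have hmult : ∑ v : InfinitePlace K, v.mult = Module.finrank ℚ K := InfinitePlace.sum_mult_eq
  have hsum : ∑ v, (LL K L v).sum = Module.finrank ℚ L := by
    simp_rw [LL_sum]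
    rw [← Finset.sum_mul, hmult, hKL]
  have hRK := regulator_pos K
  have hRL := regulator_pos L
  have hcov := covol_eq (K := K) (L := L) A η hη
  have hI0 : ∫⁻ U in Fd L, Wper A η (Nm K U) ≠ ⊤ := by
    intro htop
    rw [htop, ENNReal.mul_top (by simpa using hRK)] at hcov
    exact (ENNReal.mul_ne_top ENNReal.ofReal_ne_top ENNReal.ofReal_ne_top) hcov.symm
  have hI := I_fin A η hI0
  have hge := I_ge (K := K) (L := L) A η
  have hdec := I_dec (K := K) (L := L) A η hpos hβ hT
  have hmono := I_mono (K := K) (L := L) A η hpos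
  rw [hnh] at hmono
  have e1 : -(h * ((∑ v, (((LL K L v).sum : ℕ) : ℝ)) * 1.01)) = -0.0101 := by
    rw [← Nat.cast_sum, hsum]
    have : h * ((Module.finrank ℚ L : ℝ) * 1.01) = ((Module.finrank ℚ L : ℝ) * h) * 1.01 := by ring
    rw [this, hnh]; norm_num
  rw [e1] at hdec
  have hall := hmono.trans (mul_le_mul_right (add_le_add_right hdec _) _)
  generalize hI0d : ∫⁻ U in Fd L, Wper A η (Nm K U) = I0 at *
  generalize hId : ∫⁻ U in Fd L, ThS U * Wper A η (Nm K U) = I at *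
  have hreal := ENNReal.toReal_mono (ENNReal.mul_ne_top ENNReal.ofReal_ne_top
    (ENNReal.add_ne_top.2 ⟨hI0, ENNReal.mul_ne_top ENNReal.ofReal_ne_top hI⟩)) hall
  rw [ENNReal.toReal_add hI0 hI, ENNReal.toReal_mul, ENNReal.toReal_add hI0 (ENNReal.mul_ne_top ENNReal.ofReal_ne_top hI),
    ENNReal.toReal_mul, ENNReal.toReal_ofReal (by positivity), ENNReal.toReal_ofReal (by positivity)] at hreal
  have hab := num1 ENNReal.toReal_nonneg ENNReal.toReal_nonneg hreal
  have hcovR := congrArg ENNReal.toReal hcov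
  have hηp : 0 < ∏ v, η v := Finset.prod_pos fun v _ => hη v
  rw [ENNReal.toReal_mul, ENNReal.toReal_mul, ENNReal.toReal_ofReal hRK.le, ENNReal.toReal_ofReal hRL.le,
    ENNReal.toReal_ofReal hηp.le] at hcovR
  have hb : (∏ v, η v) * (((11.5:ℝ) ^ 37)⁻¹ ^ Module.finrank ℚ K *
      1.15 ^ (Module.finrank ℚ K * Module.finrank K L)) ≤ I.toReal := by
    refine le_trans ?_ (ENNReal.toReal_mono hI hge)
    unfold JJ
    rw [ENNReal.toReal_prod, hKL, ← hsum, ← hmult, ← Finset.prod_pow_eq_pow_sum, ← Finset.prod_pow_eq_pow_sum,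
      ← Finset.prod_mul_distrib, ← Finset.prod_mul_distrib]
    refine Finset.prod_le_prod (fun v _ => ?_) fun v _ => hlow v
    have := hη v
    positivity
  generalize (((11.5:ℝ) ^ 37)⁻¹ ^ Module.finrank ℚ K *
      1.15 ^ (Module.finrank ℚ K * Module.finrank K L)) = X at *
  have h1 : 0.0098 * ((∏ v, η v) * X) ≤ I0.toReal := le_trans (by gcongr) hab
  have h2 : regulator K * (0.0098 * ((∏ v, η v) * X)) ≤ regulator L * ∏ v, η v := by
    rw [← hcovR]; gcongr
  refine le_of_mul_le_mul_right ?_ hηp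
  linarith

end final

end RegR

theorem regulator_ratio_ge (K L : Type*) [Field K] [NumberField K] [Field L] [NumberField L]
    [Algebra K L] :
    NumberField.Units.regulator L / NumberField.Units.regulator K ≥
      (((11.5 : ℝ) ^ (39 : ℕ))⁻¹ * (1.15 : ℝ) ^ (Module.finrank K L)) ^
        (Module.finrank ℚ K) := by
  have h := RegR.main_ineq (K := K) (L := L)
  have hd : 1 ≤ Module.finrank ℚ K := Module.finrank_pos
  rw [ge_iff_le, le_div_iff₀ (NumberField.Units.regulator_pos K)]
  refine le_trans ?_ h
  refine mul_le_mul_of_nonneg_right ?_ (NumberField.Units.regulator_pos K).le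
  have e : (11.5 : ℝ) ^ 39 = 11.5 ^ 2 * 11.5 ^ 37 := by rw [← pow_add]
  rw [mul_pow, ← pow_mul, mul_comm (Module.finrank K L), ← mul_assoc, e, mul_inv, mul_pow]
  gcongr
  calc (((11.5 : ℝ) ^ 2)⁻¹) ^ Module.finrank ℚ K ≤ (((11.5 : ℝ) ^ 2)⁻¹) ^ 1 :=
        pow_le_pow_of_le_one (by positivity) (by norm_num) hd
    _ ≤ 0.0098 := by norm_num
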